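/- Let m ≥ 3, x ≥ 2 be integers. If m divides xy, x(y−1) is even, and m is even whenever y = 2, then the complete symmetric equipartite digraph K_{(x:y)}* has a C⃗_m-factorization. -/

import Mathlib

/-- A factorization of the digraph with arc set `A` (on vertex set `V`) into `k`
arc-disjoint spanning factors, where every connected component of the `i`-th factor
is a directed cycle of length `c i` (a `C⃗_{c i}`-factor; for `c i = 2` this is a
`K_2*`-factor, i.e. its components are double arcs).  The `i`-th factor is encoded by
a permutation `f i` of the vertex set, its arc set being `{(x, f i x) : x ∈ V}`;
the requirement that all components be directed `c i`-cycles says exactly that every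
point of `f i` has minimal period `c i`.  The factors are pairwise arc-disjoint and
their arc sets partition `A`. -/
def IsFactorization {V : Type} (A : Set (V × V)) {k : ℕ} (c : Fin k → ℕ) : Prop :=
  ∃ f : Fin k → Equiv.Perm V,
    (∀ (i : Fin k) (x : V), Function.minimalPeriod (⇑(f i)) x = c i) ∧
    (∀ (i j : Fin k) (x : V), f i x = f j x → i = j) ∧
    (∀ p : V × V, p ∈ A ↔ ∃ i, f i p.1 = p.2)

open Equiv Function

/-- Pairs `f i false`, `f i true` of permutations of `V`. Both members of the `i`-th pair fix the
hole `H i` pointwise and have all other cycles of length `m`; the arcs `(v, f i b v)` off the holes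
partition `A`; and if `c` holds, the two members of a pair share the proper colouring `χ i`. -/
structure PairedFactors (c : Prop) {V ι : Type} (H : ι → V → Prop) (A : V → V → Prop) (m : ℕ) where
  f : ι → Bool → Perm V
  χ : ι → V → Fin 3
  fix : ∀ i b v, H i v → f i b v = v
  period : ∀ i b v, ¬ H i v → minimalPeriod (f i b) v = m
  inj : ∀ i b j d v, ¬ H i v → ¬ H j v → f i b v = f j d v → i = j ∧ b = d
  arc : ∀ u v, A u v ↔ ∃ i b, ¬ H i u ∧ f i b u = v
  colour : c → ∀ i b v, ¬ H i v → χ i (f i b v) ≠ χ i v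

/-- The digraph `A` has a factorization into pairs of directed `m`-cycle factors. -/
def Fac (c : Prop) {V : Type} (A : V → V → Prop) (m : ℕ) : Prop :=
  ∃ ι : Type, Nonempty (PairedFactors c (fun (_ : ι) (_ : V) => False) A m)

theorem minimalPeriod_eq_of_iterate {V W : Type} {F : V → V} {G : W → W} {φ : V → W}
    (hφ : Injective φ) {v : V} (h : ∀ n, G (φ (F^[n] v)) = φ (F^[n + 1] v)) :
    minimalPeriod G (φ v) = minimalPeriod F v := by
  have key : ∀ n, G^[n] (φ v) = φ (F^[n] v) := by
    intro n
    induction n with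
    | zero => rfl
    | succ n ih => rw [iterate_succ_apply', ih, h]
  rw [minimalPeriod_eq_minimalPeriod_iff]
  intro n
  simp [IsPeriodicPt, IsFixedPt, key, hφ.eq_iff]

theorem minimalPeriod_of_semiconj {V W : Type} {F : V → V} {G : W → W} {φ : V → W}
    (hφ : Injective φ) (h : ∀ v, G (φ v) = φ (F v)) (v : V) :
    minimalPeriod G (φ v) = minimalPeriod F v :=
  minimalPeriod_eq_of_iterate hφ fun n => by rw [h, iterate_succ_apply']

theorem minimalPeriod_permCongr {V W : Type} (e : V ≃ W) (F : Perm V) (w : W) :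
    minimalPeriod (e.permCongr F) w = minimalPeriod F (e.symm w) := by
  conv_lhs => rw [← e.apply_symm_apply w]
  exact minimalPeriod_of_semiconj e.injective (by simp) _

namespace PairedFactors

variable {c : Prop} {V W ι κ : Type} {H : ι → V → Prop} {A : V → V → Prop} {m : ℕ}

/-- Transport along bijections of the vertices and of the indices. -/
def congr (D : PairedFactors c H A m) (e : V ≃ W) (r : κ ≃ ι) {H' : κ → W → Prop}
    {A' : W → W → Prop} (hH : ∀ k v, H' k (e v) ↔ H (r k) v)
    (hA : ∀ u v, A' (e u) (e v) ↔ A u v) : PairedFactors c H' A' m where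
  f k b := e.permCongr (D.f (r k) b)
  χ k w := D.χ (r k) (e.symm w)
  fix k b v h := by
    obtain ⟨v, rfl⟩ := e.surjective v
    simp [D.fix _ _ _ ((hH _ _).1 h)]
  period k b v h := by
    obtain ⟨v, rfl⟩ := e.surjective v
    rw [minimalPeriod_permCongr, e.symm_apply_apply]
    exact D.period _ _ _ (fun h' => h ((hH _ _).2 h'))
  inj k b l d v h h' hv := by
    obtain ⟨v, rfl⟩ := e.surjective v
    have := D.inj (r k) b (r l) d v (fun h' => h ((hH _ _).2 h')) (fun h => h' ((hH _ _).2 h))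
      (by simpa using hv)
    simpa using this
  arc u v := by
    obtain ⟨u, rfl⟩ := e.surjective u
    obtain ⟨v, rfl⟩ := e.surjective v
    rw [hA, D.arc]
    simp only [hH, permCongr_apply, symm_apply_apply, EmbeddingLike.apply_eq_iff_eq]
    exact r.surjective.exists (p := fun i => ∃ b, ¬H i u ∧ D.f i b u = v)
  colour hc k b v h := by
    obtain ⟨v, rfl⟩ := e.surjective v
    simpa using D.colour hc (r k) b v (fun h' => h ((hH _ _).2 h'))

end PairedFactors

theorem Fac.congr {c : Prop} {V W : Type} {A : V → V → Prop} {A' : W → W → Prop} {m : ℕ}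
    (h : Fac c A m) (e : V ≃ W) (hA : ∀ u v, A' (e u) (e v) ↔ A u v) : Fac c A' m := by
  obtain ⟨ι, ⟨D⟩⟩ := h
  exact ⟨ι, ⟨D.congr e (Equiv.refl ι) (by simp) hA⟩⟩

theorem Fac.iUnion {c : Prop} {V β : Type} {A : β → V → V → Prop} {m : ℕ}
    (hdis : ∀ a b u v, A a u v → A b u v → a = b) (h : ∀ a, Fac c (A a) m) :
    Fac c (fun u v => ∃ a, A a u v) m := by
  choose ι D using h
  replace D := fun a => (D a).some
  refine ⟨Σ a, ι a, ⟨⟨fun i => (D i.1).f i.2, fun i => (D i.1).χ i.2, by simp,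
    fun i => (D i.1).period i.2, ?_, ?_, fun hc i => (D i.1).colour hc i.2⟩⟩⟩
  · rintro ⟨a, i⟩ b ⟨a', j⟩ d v _ _ h
    obtain rfl : a = a' := hdis a a' v ((D a).f i b v) (((D a).arc _ _).2 ⟨i, b, id, rfl⟩)
      (((D a').arc _ _).2 ⟨j, d, id, h.symm⟩)
    obtain ⟨rfl, rfl⟩ := (D a).inj i b j d v id id h
    exact ⟨rfl, rfl⟩
  · intro u v
    simp only [(D _).arc, Sigma.exists]

theorem Fac.sup {c : Prop} {V : Type} {A B : V → V → Prop} {m : ℕ} (hA : Fac c A m)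
    (hB : Fac c B m) (hdis : ∀ u v, A u v → ¬ B u v) : Fac c (fun u v => A u v ∨ B u v) m := by
  refine (Fac.iUnion (A := fun b : Bool => if b then A else B) (c := c) (m := m) ?_ ?_).congr
    (Equiv.refl V) ?_
  · intro a b u v
    have := hdis u v
    cases a <;> cases b <;> simp <;> tauto
  · intro b
    cases b <;> simpa
  · intro u v
    simp [or_comm]

/-- Disjoint copies of a digraph. -/
theorem Fac.copies {c : Prop} {V : Type} {A : V → V → Prop} {m : ℕ} (h : Fac c A m) (β : Type) :
    Fac c (fun u v : β × V => u.1 = v.1 ∧ A u.2 v.2) m := by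
  obtain ⟨ι, ⟨D⟩⟩ := h
  refine ⟨ι, ⟨⟨fun i b => Equiv.prodCongr (Equiv.refl β) (D.f i b), fun i v => D.χ i v.2,
    by simp, ?_, ?_, ?_, ?_⟩⟩⟩
  · rintro i b ⟨a, v⟩ h
    exact (minimalPeriod_of_semiconj (φ := Prod.mk a) (Prod.mk_right_injective a)
      (fun v => rfl) v).trans (D.period i b v h)
  · rintro i b j d ⟨a, v⟩ - - h
    exact D.inj i b j d v id id (Prod.mk_right_injective a h)
  · rintro ⟨a, u⟩ ⟨a', v⟩
    simp [D.arc]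
  · rintro hc i b ⟨a, v⟩ h
    exact D.colour hc i b v h

/-- A factorization, in pairs of factors, of the equipartite digraph with `y` parts of size `x`. -/
def EP (c : Prop) (m y x : ℕ) : Prop :=
  Fac c (fun u v : Fin y × Fin x => u.1 ≠ v.1) m

theorem exists_equiv_fin_prod {V P : Type} [Finite V] (p : V → P) {y x : ℕ} (hx : 0 < x)
    (hp : ∀ u, Nat.card {v // p v = p u} = x) (hV : Nat.card V = y * x) :
    ∃ e : V ≃ Fin y × Fin x, ∀ u v, (e u).1 = (e v).1 ↔ p u = p v := by
  have hq : ∀ k : Set.range p, Nonempty ({v // Set.rangeFactorization p v = k} ≃ Fin x) := by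
    rintro ⟨_, u, rfl⟩
    refine ⟨(Equiv.subtypeEquivRight fun v => ?_).trans (Finite.equivFinOfCardEq (hp u))⟩
    simp [Set.rangeFactorization, Subtype.ext_iff]
  let e : V ≃ Set.range p × Fin x :=
    ((Equiv.sigmaFiberEquiv (Set.rangeFactorization p)).symm.trans
      (Equiv.sigmaCongrRight fun k => (hq k).some)).trans (Equiv.sigmaEquivProd _ _)
  have hy : Nat.card (Set.range p) = y := by
    have := Nat.card_congr e
    rw [Nat.card_prod, Nat.card_fin, hV] at this
    exact (Nat.eq_of_mul_eq_mul_right hx this).symm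
  refine ⟨e.trans (Equiv.prodCongr (Finite.equivFinOfCardEq hy) (Equiv.refl _)), fun u v => ?_⟩
  simp only [Equiv.trans_apply, Equiv.prodCongr_apply, Prod.map_fst, EmbeddingLike.apply_eq_iff_eq]
  change Set.rangeFactorization p u = Set.rangeFactorization p v ↔ _
  simp [Set.rangeFactorization, Subtype.ext_iff]

theorem Fac.ep {c : Prop} {V P : Type} [Finite V] {p : V → P} {y x m : ℕ}
    (h : Fac c (fun u v => p u ≠ p v) m) (hx : 0 < x)
    (hp : ∀ u, Nat.card {v // p v = p u} = x) (hV : Nat.card V = y * x) : EP c m y x := by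
  obtain ⟨e, he⟩ := exists_equiv_fin_prod p hx hp hV
  exact h.congr e fun u v => by simp [he]

theorem Fac.ep_of_involution {c : Prop} {V : Type} [Finite V] {σ : V → V} {y m : ℕ}
    (h : Fac c (fun u v => u ≠ v ∧ v ≠ σ u) m) (hσ : ∀ v, σ (σ v) = v) (hσ' : ∀ v, σ v ≠ v)
    (hV : Nat.card V = y * 2) : EP c m y 2 := by
  have key : ∀ u v, ({u, σ u} : Set V) = {v, σ v} ↔ u = v ∨ v = σ u := by
    intro u v
    constructor
    · intro h
      have : v ∈ ({u, σ u} : Set V) := by rw [h]; simp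
      simpa [eq_comm] using this
    · rintro (rfl | rfl)
      · rfl
      · rw [hσ, Set.pair_comm]
  refine Fac.ep (p := fun v => ({v, σ v} : Set V)) ?_ two_pos ?_ hV
  · convert h using 3
    simp [key]
  · intro u
    have : {v | ({v, σ v} : Set V) = {u, σ u}} = {u, σ u} := by
      ext v
      simp only [Set.mem_ofPred_eq, key, Set.mem_insert_iff, Set.mem_singleton_iff]
      constructor
      · rintro (rfl | rfl) <;> simp [hσ]
      · rintro (rfl | rfl) <;> simp [hσ]
    change Nat.card {v | ({v, σ v} : Set V) = {u, σ u}} = 2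
    rw [this, Nat.card_coe_set_eq, Set.ncard_pair (hσ' u).symm]

theorem EP.trans {c : Prop} {m q y x : ℕ} (h : EP c m y x) (h' : EP c m q (y * x)) :
    EP c m (q * y) x := by
  have h₁ : Fac c (fun u v : Fin q × Fin y × Fin x => u.1 ≠ v.1) m :=
    h'.congr (Equiv.prodCongr (Equiv.refl _) finProdFinEquiv.symm) (by simp)
  have h₂ := h₁.sup (h.copies (Fin q)) (by tauto)
  refine h₂.congr ((Equiv.prodAssoc _ _ _).symm.trans
    (Equiv.prodCongr finProdFinEquiv (Equiv.refl _))) ?_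
  rintro ⟨a, b, d⟩ ⟨a', b', d'⟩
  simp only [trans_apply, prodAssoc_symm_apply, prodCongr_apply, Prod.map_fst, ne_eq,
    EmbeddingLike.apply_eq_iff_eq, Prod.mk.injEq]
  tauto

theorem exists_position {V : Type} (F : Perm V) (m : ℕ) :
    ∃ π : V → ZMod m, ∀ v, minimalPeriod F v = m → π (F v) = π v + 1 := by
  let r : V → V := fun v => (Quotient.mk (Perm.SameCycle.setoid F) v).out
  have hr : ∀ v, F.SameCycle (r v) v := fun v =>
    Quotient.exact (Quotient.out_eq (Quotient.mk (Perm.SameCycle.setoid F) v))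
  have hrF : ∀ v, r (F v) = r v := fun v => by
    have : Quotient.mk (Perm.SameCycle.setoid F) (F v) = Quotient.mk (Perm.SameCycle.setoid F) v :=
      Quotient.sound (Perm.sameCycle_apply_left.2 (Perm.SameCycle.refl F v))
    simp only [r, this]
  choose n hn using hr
  refine ⟨fun v => (n v : ZMod m), fun v hv => ?_⟩
  have h := hn (F v)
  rw [hrF] at h
  have h₁ : (F ^ (n (F v) - n v - 1)) v = v := by
    have h₂ : (F ^ (n (F v) - n v - 1)) v = (F ^ (-1 : ℤ)) ((F ^ n (F v)) (r v)) := by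
      have h₃ : n (F v) - n v - 1 + n v = -1 + n (F v) := by ring
      rw [← Perm.mul_apply, ← zpow_add, ← h₃, zpow_add, Perm.mul_apply, hn v]
    rw [h₂, h]
    simp
  have h₃ := (MulAction.zpow_smul_eq_iff_minimalPeriod_dvd (a := F) (b := v)).1 h₁
  have h₄ : minimalPeriod (fun x => F • x) v = m := hv
  rw [h₄] at h₃
  have := (ZMod.intCast_zmod_eq_zero_iff_dvd _ m).2 h₃
  push_cast at this
  linear_combination this

/-- A proper colouring of the directed cycle of length `m`. -/
def cycleColour (m : ℕ) (j : ZMod m) : Fin 3 :=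
  if j.val + 1 = m then 2 else if j.val % 2 = 0 then 0 else 1

theorem cycleColour_ne {m : ℕ} (hm : 2 ≤ m) (j : ZMod m) :
    cycleColour m (j + 1) ≠ cycleColour m j := by
  have : NeZero m := ⟨by omega⟩
  have hj := j.val_lt
  have h : (j + 1).val = if j.val + 1 = m then 0 else j.val + 1 := by
    have : Fact (1 < m) := ⟨by omega⟩
    rw [ZMod.val_add, ZMod.val_one]
    split_ifs with h
    · rw [h, Nat.mod_self]
    · exact Nat.mod_eq_of_lt (by omega)
  simp only [cycleColour, h]
  split_ifs <;> simp <;> omega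

theorem exists_colouring {V : Type} (F : Perm V) {m : ℕ} (hm : 2 ≤ m) :
    ∃ χ : V → Fin 3, ∀ v, minimalPeriod F v = m → χ (F v) ≠ χ v := by
  obtain ⟨π, hπ⟩ := exists_position F m
  exact ⟨fun v => cycleColour m (π v), fun v hv => by
    simp only [hπ v hv]
    exact cycleColour_ne hm _⟩

/-- The skew product of `F` with the translations by `s`. -/
def skew {V G : Type} [AddGroup G] (F : Perm V) (s : V → G) : Perm (V × G) :=
  Equiv.prodShear F fun v => Equiv.addRight (s v)

@[simp]
theorem skew_apply {V G : Type} [AddGroup G] (F : Perm V) (s : V → G) (p : V × G) :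
    skew F s p = (F p.1, p.2 + s p.1) := rfl

theorem minimalPeriod_skew {V G : Type} [AddCommGroup G] (F : Perm V) (s : V → G) {v : V} {ℓ : ℕ}
    {c : G} (hℓ : minimalPeriod F v = ℓ) (hs : ∑ t ∈ Finset.range ℓ, s (F^[t] v) = c) (z : G) :
    minimalPeriod (skew F s) (v, z) = ℓ * addOrderOf c := by
  have hit : ∀ n z, (skew F s)^[n] (v, z) = (F^[n] v, z + ∑ t ∈ Finset.range n, s (F^[t] v)) := by
    intro n z
    induction n with
    | zero => simp
    | succ n ih =>
      rw [iterate_succ_apply', ih, skew_apply, iterate_succ_apply', Finset.sum_range_succ, add_assoc]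
  have hper : IsPeriodicPt F ℓ v := hℓ ▸ isPeriodicPt_minimalPeriod F v
  have hℓz : ∀ z, (skew F s)^[ℓ] (v, z) = (v, z + c) := fun z => by
    rw [hit, hs]
    exact Prod.ext hper rfl
  have hk : ∀ k : ℕ, ∀ z, (skew F s)^[ℓ * k] (v, z) = (v, z + k • c) := by
    intro k
    induction k with
    | zero => simp
    | succ k ih =>
      intro z
      rw [mul_add, mul_one, iterate_add_apply, hℓz, ih, add_smul, one_smul]
      congr 1
      abel
  apply Nat.dvd_antisymm
  · apply IsPeriodicPt.minimalPeriod_dvd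
    rw [IsPeriodicPt, IsFixedPt, hk, addOrderOf_nsmul_eq_zero, add_zero]
  · have h := isPeriodicPt_minimalPeriod (skew F s) (v, z)
    generalize minimalPeriod (skew F s) (v, z) = n at h
    have h₁ : IsPeriodicPt F n v := by
      have := congrArg Prod.fst h
      rwa [hit] at this
    obtain ⟨k, rfl⟩ := hℓ ▸ h₁.minimalPeriod_dvd
    refine mul_dvd_mul_left _ (addOrderOf_dvd_of_nsmul_eq_zero ?_)
    rw [IsPeriodicPt, IsFixedPt, hk] at h
    simpa using h

namespace PairedFactors

variable {c : Prop} {V ι : Type} {H : ι → V → Prop} {A : V → V → Prop} {m : ℕ}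

/-- Blow up all vertices by the group `G`, by means of skew products. -/
def skewProduct (D : PairedFactors c H A m) {G κ : Type} [AddCommGroup G] (a : ℕ)
    (s : ι → Bool → κ → V → G) (h₀ : ∀ i b k v, H i v → s i b k v = 0)
    (hbij : ∀ i b v, ¬ H i v → Bijective fun k => s i b k v)
    (hsum : ∀ i b k v, ¬ H i v → ∃ c₀ : G, addOrderOf c₀ = a ∧
      ∑ t ∈ Finset.range m, s i b k ((D.f i b)^[t] v) = c₀) :
    PairedFactors c (fun (i : ι × κ) (v : V × G) => H i.1 v.1) (fun u v => A u.1 v.1) (m * a) where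
  f i b := skew (D.f i.1 b) (s i.1 b i.2)
  χ i v := D.χ i.1 v.1
  fix := by
    rintro ⟨i, k⟩ b ⟨v, z⟩ h
    simp [D.fix i b v h, h₀ i b k v h]
  period := by
    rintro ⟨i, k⟩ b ⟨v, z⟩ h
    obtain ⟨c₀, rfl, hc⟩ := hsum i b k v h
    exact minimalPeriod_skew _ _ (D.period i b v h) hc z
  inj := by
    rintro ⟨i, k⟩ b ⟨j, l⟩ d ⟨v, z⟩ h h' e
    simp only [skew_apply, Prod.mk.injEq, add_right_inj] at e
    obtain ⟨rfl, rfl⟩ := D.inj i b j d v h h' e.1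
    exact ⟨Prod.ext rfl ((hbij i b v h).1 e.2), rfl⟩
  arc := by
    rintro ⟨u, z⟩ ⟨v, w⟩
    simp only [D.arc, skew_apply, Prod.exists, Prod.mk.injEq]
    constructor
    · rintro ⟨i, b, h, e⟩
      obtain ⟨k, hk⟩ := (hbij i b u h).2 (w - z)
      refine ⟨i, k, b, h, e, ?_⟩
      simp only at hk
      rw [hk, add_sub_cancel]
    · rintro ⟨i, k, b, h, e, -⟩
      exact ⟨i, b, h, e⟩
  colour := by
    rintro hc ⟨i, k⟩ b ⟨v, z⟩ h
    exact D.colour hc i b v h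

/-- The reflection of two layers given by `g`. -/
def layerSwap {V : Type} (g : V → Bool) : Perm (V × Bool) :=
  Function.Involutive.toPerm (fun p => (p.1, xor p.2 (g p.1))) fun p => by simp

/-- The permutation acting by `F b` on the layer `b`. -/
def layered {V : Type} (F : Bool → Perm V) : Perm (V × Bool) where
  toFun p := (F p.2 p.1, p.2)
  invFun p := ((F p.2).symm p.1, p.2)
  left_inv p := by simp
  right_inv p := by simp

/-- The layer shifts used for doubling. -/
def doublingShift (t₁ t₂ : Bool) (j : Fin 3) : Bool :=
  if j = 0 then t₁ else if j = 1 then t₂ else xor t₁ t₂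

theorem doublingShift_surjective : ∀ i j : Fin 3, i ≠ j → ∀ a b : Bool,
    ∃ t₁ t₂, doublingShift t₁ t₂ i = a ∧ doublingShift t₁ t₂ j = b := by
  decide

theorem doublingShift_injective : ∀ i j : Fin 3, i ≠ j → ∀ t₁ t₂ t₁' t₂' : Bool,
    doublingShift t₁ t₂ i = doublingShift t₁' t₂' i →
    doublingShift t₁ t₂ j = doublingShift t₁' t₂' j → t₁ = t₁' ∧ t₂ = t₂' := by
  decide

theorem conj_layerSwap_apply {V : Type} (F : Bool → Perm V) (g : V → Bool) (v : V) (z : Bool) :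
    (layerSwap g).permCongr (layered F) (v, z) =
      (F (xor z (g v)) v, xor (xor z (g v)) (g (F (xor z (g v)) v))) := rfl

/-- Blow up all vertices by two. -/
def double (D : PairedFactors c H A m) (hc : c) :
    PairedFactors c (fun (i : ι × Bool) (v : V × Bool) => H i.1 v.1)
      (fun u v => A u.1 v.1) m where
  f i b := (layerSwap fun v => doublingShift i.2 b (D.χ i.1 v)).permCongr (layered (D.f i.1))
  χ i v := D.χ i.1 v.1
  fix := by
    rintro ⟨i, k⟩ b ⟨v, z⟩ h
    rw [conj_layerSwap_apply]
    simp [D.fix i _ v h]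
  period := by
    rintro ⟨i, k⟩ b ⟨v, z⟩ h
    rw [minimalPeriod_permCongr]
    exact (minimalPeriod_of_semiconj (φ := fun v => (v, _)) (Prod.mk_left_injective _)
      (fun v => rfl) v).trans (D.period i _ v h)
  inj := by
    rintro ⟨i, k⟩ b ⟨j, l⟩ d ⟨v, z⟩ h h' e
    simp only [conj_layerSwap_apply, Prod.mk.injEq] at e
    obtain ⟨rfl, e₁⟩ := D.inj i _ j _ v h h' e.1
    have e₂ := e.2
    rw [← e₁, Bool.xor_right_inj] at e₂
    rw [Bool.xor_right_inj] at e₁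
    obtain ⟨rfl, rfl⟩ := doublingShift_injective _ _ (D.colour hc i _ v h) _ _ _ _ e₂ e₁
    exact ⟨rfl, rfl⟩
  arc := by
    rintro ⟨u, z⟩ ⟨v, w⟩
    simp only [D.arc, conj_layerSwap_apply, Prod.exists, Prod.mk.injEq]
    constructor
    · rintro ⟨i, b, h, rfl⟩
      obtain ⟨t₁, t₂, e₁, e₂⟩ := doublingShift_surjective _ _ (D.colour hc i b u h).symm
        (xor z b) (xor b w)
      refine ⟨i, t₁, t₂, h, ?_⟩
      simp [e₁, e₂]
    · rintro ⟨i, t₁, t₂, h, e, -⟩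
      exact ⟨i, _, h, e⟩
  colour := by
    rintro hc ⟨i, k⟩ b ⟨v, z⟩ h
    exact D.colour hc i _ v h

end PairedFactors

theorem exists_isUnit_sum_eq_zero {m n : ℕ} (h : Even m ∨ Odd n ∧ 3 ≤ m) :
    ∃ e : ℕ → ZMod n, (∀ k, IsUnit (e k)) ∧ ∑ k ∈ Finset.range m, e k = 0 := by
  by_cases hm : Even m
  · exact ⟨fun k => (-1) ^ k, fun k => isUnit_one.neg.pow k, by simp [neg_one_geom_sum, hm]⟩
  obtain ⟨hn, hm3⟩ := h.resolve_left hm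
  have h2 : IsUnit (2 : ZMod n) := by
    have := (ZMod.unitOfCoprime 2 (Nat.coprime_two_left.2 hn)).isUnit
    simpa using this
  refine ⟨fun k => (-1) ^ k + (if k = 1 then 2 else 0) + (if k = 2 then -3 else 0), ?_, ?_⟩
  · intro k
    dsimp only
    split_ifs with h₁ h₂ h₂
    · omega
    · simp only [h₁]
      norm_num
    · simp only [h₂]
      norm_num [h2]
    · simpa using isUnit_one.neg.pow k
  · simp only [Finset.sum_add_distrib, neg_one_geom_sum, hm, Finset.sum_ite_eq', Finset.mem_range]
    rw [if_neg id, if_pos (by omega), if_pos (by omega)]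
    norm_num

theorem sum_range_add_natCast {m : ℕ} [NeZero m] {M : Type} [AddCommMonoid M] (g : ZMod m → M)
    (j : ZMod m) : ∑ t ∈ Finset.range m, g (j + t) = ∑ k : ZMod m, g k := by
  refine Finset.sum_bij' (fun t _ => j + t) (fun k _ => (k - j).val) ?_ ?_ ?_ ?_ ?_
  · simp
  · intro k _
    simpa using ZMod.val_lt _
  · intro t ht
    simp [ZMod.val_cast_of_lt (Finset.mem_range.1 ht)]
  · simp
  · simp

theorem sum_val {m : ℕ} [NeZero m] {M : Type} [AddCommMonoid M] (e : ℕ → M) :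
    ∑ k : ZMod m, e k.val = ∑ k ∈ Finset.range m, e k := by
  rw [← sum_range_add_natCast _ 0]
  refine Finset.sum_congr rfl fun t ht => ?_
  rw [zero_add, ZMod.val_cast_of_lt (Finset.mem_range.1 ht)]

namespace PairedFactors

variable {c : Prop} {V ι : Type} {H : ι → V → Prop} {A : V → V → Prop} {m : ℕ}

theorem blowup (D : PairedFactors c H A m) {n a : ℕ} (hn : 0 < n) (hm : 2 ≤ m)
    (h : Even m ∨ Odd n) (ha : a ∣ n) :
    Nonempty (PairedFactors c (fun (i : ι × ZMod n) (v : V × ZMod n) => H i.1 v.1)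
      (fun u v => A u.1 v.1) (m * a)) := by
  have : NeZero n := ⟨hn.ne'⟩
  have : NeZero m := ⟨by omega⟩
  obtain ⟨e, he, hsum⟩ : ∃ e : ℕ → ZMod n, (∀ k, IsUnit (e k)) ∧ ∑ k ∈ Finset.range m, e k = 0 := by
    by_cases hm2 : Even m
    · exact exists_isUnit_sum_eq_zero (.inl hm2)
    · refine exists_isUnit_sum_eq_zero (.inr ⟨h.resolve_left hm2, ?_⟩)
      rcases hm.eq_or_lt with rfl | h
      · simp at hm2
      · exact h
  choose π hπ using fun i b => exists_position (D.f i b) m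
  let c₀ : ZMod n := ((n / a : ℕ) : ZMod n)
  have hc₀ : addOrderOf c₀ = a := by
    rw [ZMod.addOrderOf_coe _ hn.ne', Nat.gcd_eq_right (Nat.div_dvd_of_dvd ha),
      Nat.div_div_self ha hn.ne']
  refine ⟨D.skewProduct a (fun i b t v => if minimalPeriod (D.f i b) v = m then
    e (π i b v).val * t + (if π i b v = 0 then c₀ else 0) else 0) ?_ ?_ ?_⟩
  · intro i b k v hv
    have : minimalPeriod (D.f i b) v = 1 := minimalPeriod_eq_one_iff_isFixedPt.2 (D.fix i b v hv)
    rw [if_neg (by omega)]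
  · intro i b v hv
    simp only [D.period i b v hv, if_true]
    obtain ⟨u, hu⟩ := he (π i b v).val
    rw [← hu]
    exact (Equiv.addRight _).bijective.comp u.mulLeft.bijective
  · intro i b k v hv
    refine ⟨c₀, hc₀, ?_⟩
    have hp : ∀ t, minimalPeriod (D.f i b) ((D.f i b)^[t] v) = m := fun t => by
      rw [minimalPeriod_apply_iterate, D.period i b v hv]
      exact minimalPeriod_pos_iff_mem_periodicPts.1 (by rw [D.period i b v hv]; omega)
    have hpos : ∀ t : ℕ, π i b ((D.f i b)^[t] v) = π i b v + t := by
      intro t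
      induction t with
      | zero => simp
      | succ t ih => rw [iterate_succ_apply', hπ i b _ (hp t), ih]; push_cast; ring
    simp only [hp, hpos, if_true]
    rw [sum_range_add_natCast (fun j => e j.val * k + if j = 0 then c₀ else 0),
      Finset.sum_add_distrib, ← Finset.sum_mul, sum_val, hsum]
    simp

end PairedFactors

theorem Fac.blowup {c : Prop} {V : Type} {A : V → V → Prop} {m n a : ℕ} (h : Fac c A m)
    (hn : 0 < n) (hm : 2 ≤ m) (hmn : Even m ∨ Odd n) (ha : a ∣ n) :
    Fac c (fun u v : V × ZMod n => A u.1 v.1) (m * a) := by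
  obtain ⟨ι, ⟨D⟩⟩ := h
  exact ⟨_, D.blowup hn hm hmn ha⟩

theorem Fac.double {V : Type} {A : V → V → Prop} {m : ℕ} (h : Fac True A m) :
    Fac True (fun u v : V × Bool => A u.1 v.1) m := by
  obtain ⟨ι, ⟨D⟩⟩ := h
  exact ⟨_, ⟨D.double trivial⟩⟩

theorem EP.blowup {c : Prop} {m y x n a : ℕ} (h : EP c m y x)
    (hn : 0 < n) (hm : 2 ≤ m) (hmn : Even m ∨ Odd n) (ha : a ∣ n) : EP c (m * a) y (x * n) := by
  have : NeZero n := ⟨hn.ne'⟩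
  refine (Fac.blowup h hn hm hmn ha).congr ((Equiv.prodAssoc _ _ _).trans (Equiv.prodCongr
    (Equiv.refl _) ((Equiv.prodCongr (Equiv.refl _) (ZMod.finEquiv n).symm.toEquiv).trans
      finProdFinEquiv))) ?_
  simp

theorem EP.double {m y x : ℕ} (h : EP True m y x) : EP True m y (x * 2) := by
  refine (Fac.double h).congr ((Equiv.prodAssoc _ _ _).trans (Equiv.prodCongr
    (Equiv.refl _) ((Equiv.prodCongr (Equiv.refl _) finTwoEquiv.symm).trans finProdFinEquiv))) ?_
  simp

/-- Combined blow-up by an arbitrary number, for odd `a`. -/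
theorem EP.blowup' {m y x n a : ℕ} (h : EP True m y x) (hn : 0 < n) (hm : 2 ≤ m) (ha : a ∣ n)
    (ha2 : Odd a) : EP True (m * a) y (x * n) := by
  induction n using Nat.strong_induction_on with
  | _ n ih =>
    rcases Nat.even_or_odd' n with ⟨k, rfl | rfl⟩
    · rw [mul_comm 2 k, ← mul_assoc]
      refine (ih k (by omega) (by omega) ?_).double
      exact (Nat.Coprime.dvd_mul_left (Nat.coprime_two_right.2 ha2)).1 ha
    · exact h.blowup hn hm (.inr (odd_two_mul_add_one k)) ha

theorem exists_equiv_prod_bool {ι : Type} (σ : ι → ι) (hσ : ∀ i, σ (σ i) = i)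
    (hσ' : ∀ i, σ i ≠ i) :
    ∃ (κ : Type) (e : κ × Bool ≃ ι), ∀ k, e (k, true) = σ (e (k, false)) := by
  classical
  let _ : LinearOrder ι := linearOrderOfSTO WellOrderingRel
  let e : {i // i < σ i} × Bool → ι := fun p => if p.2 then σ p.1 else p.1
  refine ⟨{i // i < σ i}, Equiv.ofBijective e ⟨?_, ?_⟩, fun k => rfl⟩
  · rintro ⟨⟨i, hi⟩, b⟩ ⟨⟨j, hj⟩, d⟩ h
    cases b <;> cases d <;> simp only [e, if_true, Bool.false_eq_true, if_false] at h
    · simp [h]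
    · rw [h, hσ] at hi
      exact absurd hi hj.asymm
    · rw [← h, hσ] at hj
      exact absurd hj hi.asymm
    · have := congrArg σ h
      rw [hσ, hσ] at this
      simp [this]
  · intro i
    rcases lt_or_gt_of_ne (hσ' i).symm with h | h
    · exact ⟨(⟨i, h⟩, false), rfl⟩
    · exact ⟨(⟨σ i, by rwa [hσ]⟩, true), hσ i⟩

theorem bijective_of_cover {ι V : Type} [Finite ι] {f : ι → V} {S : V → Prop}
    (hcard : Nat.card {v // S v} = Nat.card ι) (hcov : ∀ v, S v → ∃ i, f i = v) :
    Injective f ∧ ∀ v, S v ↔ ∃ i, f i = v := by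
  choose g hg using fun v : {v // S v} => hcov v v.2
  have hinj : Injective g := fun v w h => Subtype.ext (by rw [← hg v, ← hg w, h])
  have hsurj : Surjective g := ((Nat.bijective_iff_injective_and_card g).2 ⟨hinj, hcard⟩).2
  refine ⟨fun i j h => ?_, fun v => ⟨hcov v, ?_⟩⟩
  · obtain ⟨v, rfl⟩ := hsurj i
    obtain ⟨w, rfl⟩ := hsurj j
    rw [hg, hg] at h
    rw [Subtype.ext h]
  · rintro ⟨i, rfl⟩
    obtain ⟨v, rfl⟩ := hsurj i
    rw [hg]
    exact v.2

theorem Fac.of_perms {c : Prop} {V ι : Type} [Finite ι] {A : V → V → Prop} {m : ℕ}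
    (F : ι → Perm V) (σ : ι → ι) (hσ : ∀ i, σ (σ i) = i) (hσ' : ∀ i, σ i ≠ i)
    (hm : ∀ i v, minimalPeriod (F i) v = m) (hcov : ∀ u v, A u v → ∃ i, F i u = v)
    (hcard : ∀ u, Nat.card {v // A u v} = Nat.card ι)
    (hcol : c → ∀ i, ∃ χ : V → Fin 3, ∀ v, χ (F i v) ≠ χ v ∧ χ (F (σ i) v) ≠ χ v) :
    Fac c A m := by
  obtain ⟨κ, e, he⟩ := exists_equiv_prod_bool σ hσ hσ'
  have hcol' : ∀ k, ∃ χ : V → Fin 3, c → ∀ b v, χ (F (e (k, b)) v) ≠ χ v := by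
    intro k
    by_cases hc : c
    · obtain ⟨χ, hχ⟩ := hcol hc (e (k, false))
      refine ⟨χ, fun _ b v => ?_⟩
      cases b
      · exact (hχ v).1
      · rw [he]
        exact (hχ v).2
    · exact ⟨fun _ => 0, fun h => absurd h hc⟩
  choose χ hχ using hcol'
  refine ⟨κ, ⟨⟨fun k b => F (e (k, b)), χ, by simp, fun k b v _ => hm _ v, ?_, ?_,
    fun hc k b v _ => hχ k hc b v⟩⟩⟩
  · intro i b j d v _ _ h
    simpa using (bijective_of_cover (hcard v) (hcov v)).1 h
  · intro u v
    rw [(bijective_of_cover (hcard u) (hcov u)).2, e.surjective.exists]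
    simp

theorem minimalPeriod_perm_inv {V : Type} (F : Perm V) (v : V) :
    minimalPeriod (F⁻¹ : Perm V) v = minimalPeriod F v := by
  rw [minimalPeriod_eq_minimalPeriod_iff]
  intro n
  simp only [IsPeriodicPt, IsFixedPt, ← Perm.coe_pow, inv_pow]
  rw [Perm.inv_eq_iff_eq, eq_comm]

/-- Undirected cycle factorizations give directed ones with coloured pairs. -/
theorem exists_colouring_pair {V : Type} (F : Perm V) {m : ℕ} (hm : 2 ≤ m)
    (h : ∀ v, minimalPeriod F v = m) :
    ∃ χ : V → Fin 3, ∀ v, χ (F v) ≠ χ v ∧ χ (F⁻¹ v) ≠ χ v := by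
  obtain ⟨χ, hχ⟩ := exists_colouring F hm
  refine ⟨χ, fun v => ⟨hχ v (h v), ?_⟩⟩
  have := hχ (F⁻¹ v) (h _)
  rw [← Perm.mul_apply, mul_inv_cancel] at this
  exact this.symm

theorem exists_perm_of_cycles {C V : Type} [Finite V] {m : ℕ} (hm : 0 < m) (E : C → ℕ → V)
    (hE : ∀ c, E c m = E c 0) (hsurj : ∀ v, ∃ c, ∃ k < m, E c k = v)
    [Finite C] (hcard : Nat.card C * m = Nat.card V) :
    ∃ F : Perm V, (∀ v, minimalPeriod F v = m) ∧ ∀ c, ∀ k < m, F (E c k) = E c (k + 1) := by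
  have : NeZero m := ⟨hm.ne'⟩
  let φ : C × ZMod m → V := fun p => E p.1 p.2.val
  have hφ : Bijective φ := by
    have hs : Surjective φ := fun v => by
      obtain ⟨c, k, hk, rfl⟩ := hsurj v
      exact ⟨(c, k), by simp [φ, ZMod.val_cast_of_lt hk]⟩
    refine (Nat.bijective_iff_surjective_and_card φ).2 ⟨hs, ?_⟩
    rw [Nat.card_prod, Nat.card_zmod, hcard]
  let e := Equiv.ofBijective φ hφ
  refine ⟨e.permCongr (skew 1 fun _ => 1), fun v => ?_, fun c k hk => ?_⟩
  · rw [minimalPeriod_permCongr, ← Prod.mk.eta (p := e.symm v),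
      minimalPeriod_skew (ℓ := 1) (c := 1) _ _ (by simp [minimalPeriod_id]) (by simp), one_mul,
      ZMod.addOrderOf_one]
  · have h₁ : E c k = e (c, k) := by simp [e, φ, ZMod.val_cast_of_lt hk]
    rw [permCongr_apply, h₁, symm_apply_apply, skew_apply]
    simp only [Perm.coe_one, id_eq, e, φ, ofBijective_apply]
    rcases (Nat.succ_le_of_lt hk).eq_or_lt with h | h
    · have : ((k : ZMod m) + 1) = 0 := by
        rw [← Nat.cast_succ, h, ZMod.natCast_self]
      rw [this, ZMod.val_zero, ← hE, ← h]
    · rw [← Nat.cast_succ, ZMod.val_cast_of_lt h]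

/-- The translation by `g` of `G` together with fixed points `I`. -/
def transl {G I : Type} [AddGroup G] (g : G) : Perm (G ⊕ I) :=
  Equiv.sumCongr (Equiv.addRight g) (Equiv.refl I)

@[simp]
theorem transl_inl {G I : Type} [AddGroup G] (g v : G) :
    transl g (Sum.inl v : G ⊕ I) = Sum.inl (v + g) := rfl

@[simp]
theorem transl_inr {G I : Type} [AddGroup G] (g : G) (i : I) :
    transl g (Sum.inr i : G ⊕ I) = Sum.inr i := rfl

/-- The digraph on `G ⊕ I` with all arcs between `G` and `I`, and inside `G` those with
difference in `D`. -/
def devArc {G I : Type} [AddGroup G] (D : G → Prop) : G ⊕ I → G ⊕ I → Prop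
  | .inl a, .inl b => D (b - a)
  | .inl _, .inr _ => True
  | .inr _, .inl _ => True
  | .inr _, .inr _ => False

/-- The conjugates by translations of a permutation cover a given digraph. -/
theorem exists_transl_of_devArc {G I : Type} [AddCommGroup G] {D : G → Prop} {F : Perm (G ⊕ I)}
    (hD : ∀ δ, D δ → ∃ w, F (.inl w) = .inl (w + δ)) (hI : ∀ i, ∃ w, F (.inl w) = .inr i)
    (hI' : ∀ i, ∃ w, F (.inr i) = .inl w) (u v : G ⊕ I) (h : devArc D u v) :
    ∃ g : G, (transl g).permCongr F u = v := by
  have key : ∀ g u v, F u = v → (transl g).permCongr F (transl g u) = transl g v := by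
    rintro g u v rfl
    simp
  rcases u with a | i <;> rcases v with b | j
  · obtain ⟨w, hw⟩ := hD _ h
    refine ⟨a - w, ?_⟩
    have := key (a - w) _ _ hw
    simp only [transl_inl] at this
    convert this using 3 <;> abel
  · obtain ⟨w, hw⟩ := hI j
    refine ⟨a - w, ?_⟩
    have := key (a - w) _ _ hw
    rwa [transl_inl, transl_inr, add_sub_cancel] at this
  · obtain ⟨w, hw⟩ := hI' i
    refine ⟨b - w, ?_⟩
    have := key (b - w) _ _ hw
    rwa [transl_inl, transl_inr, add_sub_cancel] at this
  · exact h.elim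

theorem card_devArc {G I : Type} [AddCommGroup G] [Finite G] [Finite I] {D : G → Prop}
    (hcard : Nat.card {δ // D δ} + Nat.card I = Nat.card G) (u : G ⊕ I) :
    Nat.card {v // devArc D u v} = Nat.card G := by
  rcases u with a | i
  · rw [← hcard, ← Nat.card_sum]
    refine Nat.card_congr (subtypeSum.trans (Equiv.sumCongr ?_ ?_))
    · exact (Equiv.subRight a).subtypeEquiv fun b => Iff.rfl
    · exact Equiv.subtypeUnivEquiv fun _ => trivial
  · refine Nat.card_congr (subtypeSum.trans ?_)
    have : IsEmpty {j : I // devArc D (.inr i : G ⊕ I) (.inr j)} := ⟨fun j => j.2⟩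
    exact (Equiv.sumEmpty _ _).trans (Equiv.subtypeUnivEquiv fun _ => trivial)

theorem card_ne_and_ne {V : Type} [Finite V] {a b : V} (h : a ≠ b) :
    Nat.card {v // a ≠ v ∧ v ≠ b} + 2 = Nat.card V := by
  have : {v | a ≠ v ∧ v ≠ b} = ({a, b} : Set V)ᶜ := by
    ext v
    simp [eq_comm, not_or]
  change Nat.card {v | a ≠ v ∧ v ≠ b} + 2 = _
  rw [this, Nat.card_coe_set_eq, ← Set.ncard_pair h, add_comm, Set.ncard_add_ncard_compl]

theorem card_ne {V : Type} [Finite V] (a : V) : Nat.card {v // v ≠ a} + 1 = Nat.card V := by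
  rw [← Set.ncard_singleton a, add_comm, ← Set.ncard_add_ncard_compl {a}]
  rfl

/-- The reflection in `i` of a group together with a point at infinity, swapped with `i`. -/
def reflectionAt {G : Type} [AddCommGroup G] [DecidableEq G] (i : G) : Perm (Option G) :=
  Function.Involutive.toPerm (fun v => v.elim (some i) fun v => if v = i then none else some (i + i - v)) <| by
    rintro (_ | v)
    · simp
    · by_cases h : v = i
      · simp [h]
      · have : i + i - v ≠ i := fun h' =>
        h (add_left_cancel (sub_eq_iff_eq_add.1 h')).symm
        simp [h, this]

theorem reflectionAt_none {G : Type} [AddCommGroup G] [DecidableEq G] (i : G) :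
    reflectionAt i none = some i := rfl

theorem reflectionAt_some {G : Type} [AddCommGroup G] [DecidableEq G] (i v : G) :
    reflectionAt i (some v) = if v = i then none else some (i + i - v) := rfl

theorem ep_two_two {y : ℕ} (hy : 2 ≤ y) : EP False 2 y 2 := by
  obtain ⟨k, rfl⟩ : ∃ k, y = k + 1 := ⟨y - 1, by omega⟩
  have hN : Odd (2 * k + 1) := odd_two_mul_add_one k
  obtain ⟨u, hu⟩ : IsUnit (2 : ZMod (2 * k + 1)) := by
    simpa using (ZMod.unitOfCoprime 2 (Nat.coprime_two_left.2 hN)).isUnit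
  have h2 : ∀ a b : ZMod (2 * k + 1), 2 * a = 2 * b → a = b := fun a b h => by
    rw [← hu] at h
    exact (Units.mul_right_inj u).1 h
  have hr : ∀ (i : ZMod (2 * k + 1)) v, reflectionAt i v ≠ v := by
    rintro i (_ | v) h
    · simp [reflectionAt_none] at h
    · rw [reflectionAt_some] at h
      split_ifs at h with h'
      simp only [Option.some.injEq] at h
      exact h' (h2 _ _ (by linear_combination -h))
  have hcard : Nat.card (Option (ZMod (2 * k + 1))) = (k + 1) * 2 := by
    rw [Finite.card_option, Nat.card_zmod]
    ring
  refine Fac.ep_of_involution (V := Option (ZMod (2 * k + 1))) (σ := reflectionAt 0) ?_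
    (fun v => ?_) (hr 0) hcard
  · refine Fac.of_perms (ι := {i : ZMod (2 * k + 1) // i ≠ 0}) (fun i => reflectionAt i.1)
      (fun i => ⟨-i.1, neg_ne_zero.2 i.2⟩) (by simp) ?_ ?_ ?_ ?_ False.elim
    · rintro ⟨i, hi⟩ h
      simp only [Subtype.mk.injEq] at h
      exact hi (h2 _ _ (by linear_combination -h))
    · intro i v
      exact minimalPeriod_eq_prime (p := 2) (Function.Involutive.toPerm_involutive _ v) (hr i.1 v)
    · rintro (_ | a) (_ | b) ⟨h, h'⟩
      · exact absurd rfl h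
      · rw [reflectionAt_none] at h'
        exact ⟨⟨b, fun h => h' (by rw [h])⟩, rfl⟩
      · rw [reflectionAt_some] at h'
        exact ⟨⟨a, fun h => h' (by rw [if_pos h])⟩, by rw [reflectionAt_some, if_pos rfl]⟩
      · have hi : 2 * ((↑u⁻¹ : ZMod (2 * k + 1)) * (a + b)) = a + b := by
          rw [← hu, Units.mul_inv_cancel_left]
        generalize (↑u⁻¹ : ZMod (2 * k + 1)) * (a + b) = i at hi
        refine ⟨⟨i, ?_⟩, ?_⟩
        · rintro rfl
          rw [reflectionAt_some] at h'
          split_ifs at h' with ha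
          · refine h ?_
            rw [ha]
            congr 1
            linear_combination hi + ha
          · refine h' ?_
            congr 1
            linear_combination -hi
        · rw [reflectionAt_some, if_neg]
          · congr 1
            linear_combination hi
          · rintro rfl
            refine h (congrArg some ?_)
            linear_combination hi
    · intro v
      have := card_ne_and_ne (hr 0 v).symm
      have h' := card_ne (0 : ZMod (2 * k + 1))
      rw [Nat.card_zmod] at h'
      omega
  · exact Function.Involutive.toPerm_involutive _ v

/-- The sequence `0, 1, -1, 2, -2, …`. -/
def zigzag (k : ℕ) : ℤ := if k % 2 = 0 then -((k / 2 : ℕ) : ℤ) else (((k + 1) / 2 : ℕ) : ℤ)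

theorem exists_zigzag {N : ℕ} {t : ℤ} (h₁ : -(N : ℤ) < 2 * t) (h₂ : 2 * t ≤ N) :
    ∃ k < N, zigzag k = t := by
  by_cases h : t ≤ 0
  · refine ⟨(-(2 * t)).toNat, by omega, ?_⟩
    rw [zigzag, if_pos (by omega)]
    omega
  · refine ⟨(2 * t - 1).toNat, by omega, ?_⟩
    rw [zigzag, if_neg (by omega)]
    omega

theorem zigzag_succ_sub (k : ℕ) :
    zigzag (k + 1) - zigzag k = if k % 2 = 0 then (k : ℤ) + 1 else -((k : ℤ) + 1) := by
  simp only [zigzag]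
  split_ifs <;> omega

/-- Every residue has a representative in a given interval. -/
theorem exists_intCast_eq {N : ℕ} (hN : 0 < N) (a : ℤ) (x : ZMod N) :
    ∃ t : ℤ, a < t ∧ t ≤ a + N ∧ (t : ZMod N) = x := by
  have : NeZero N := ⟨hN.ne'⟩
  refine ⟨toIocMod (Int.natCast_pos.2 hN) a x.val, (toIocMod_mem_Ioc _ _ _).1,
    (toIocMod_mem_Ioc _ _ _).2, ?_⟩
  rw [toIocMod]
  simp

theorem ep_two_mul {n : ℕ} (hn : 2 ≤ n) : EP False (2 * n) n 2 := by
  obtain ⟨h, rfl⟩ : ∃ h, n = h + 1 := ⟨n - 1, by omega⟩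
  have hh : 0 < h := by omega
  have : NeZero (2 * h) := ⟨by omega⟩
  let G := ZMod (2 * h)
  have hhh : ((h : ℕ) : G) + h = 0 := by
    rw [← Nat.cast_add, ← two_mul, ZMod.natCast_self]
  have hh0 : (h : G) ≠ 0 := by
    rw [Ne, ZMod.natCast_eq_zero_iff]
    intro h'
    have := Nat.le_of_dvd hh h'
    omega
  let E : Unit → ℕ → G ⊕ Bool := fun _ k =>
    if k % (2 * (h + 1)) = 0 then .inr false
    else if k ≤ h then .inl (zigzag (k - 1))
    else if k = h + 1 then .inr true
    else .inl (zigzag (2 * h + 1 - k) + h)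
  have e0 : E () 0 = .inr false := by simp [E]
  have e1 : ∀ k < h, E () (k + 1) = .inl (zigzag k) := fun k hk => by
    simp only [E]
    rw [if_neg (by rw [Nat.mod_eq_of_lt (by omega)]; omega), if_pos (by omega)]
    rfl
  have e2 : E () (h + 1) = .inr true := by
    simp only [E]
    rw [if_neg (by rw [Nat.mod_eq_of_lt (by omega)]; omega), if_neg (by omega),
      if_pos trivial]
  have e3 : ∀ k < h, E () (2 * h + 1 - k) = .inl (zigzag k + h) := fun k hk => by
    simp only [E]
    rw [if_neg (by rw [Nat.mod_eq_of_lt (by omega)]; omega), if_neg (by omega), if_neg (by omega),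
      show 2 * h + 1 - (2 * h + 1 - k) = k by omega]
  have hcardV : Nat.card (G ⊕ Bool) = (h + 1) * 2 := by
    rw [Nat.card_sum, Nat.card_zmod, Nat.card_eq_fintype_card, Fintype.card_bool]
    ring
  have hsurj : ∀ v, ∃ c, ∃ k < 2 * (h + 1), E c k = v := by
    rintro (x | (_ | _))
    · obtain ⟨t, ht, ht', rfl⟩ := exists_intCast_eq (by omega : 0 < 2 * h) (-((h + 1) / 2 : ℕ)) x
      by_cases hth : 2 * t ≤ h
      · obtain ⟨k, hk, rfl⟩ := exists_zigzag (N := h) (t := t) (by omega) hth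
        exact ⟨(), k + 1, by omega, e1 k hk⟩
      · obtain ⟨k, hk, hkt⟩ := exists_zigzag (N := h) (t := t - h) (by omega) (by omega)
        refine ⟨(), 2 * h + 1 - k, by omega, ?_⟩
        rw [e3 k hk, hkt]
        push_cast
        rw [sub_add_cancel]
    · exact ⟨(), 0, by omega, e0⟩
    · exact ⟨(), h + 1, by omega, e2⟩
  obtain ⟨F, hF, hFE⟩ := exists_perm_of_cycles (m := 2 * (h + 1)) (by omega) E
    (fun _ => by simp [E]) hsurj (by rw [hcardV]; simp; ring)
  let D : G → Prop := fun δ => 0 ≠ δ ∧ δ ≠ h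
  have hD : ∀ δ, D δ → ∃ w, F (.inl w) = .inl (w + δ) := by
    rintro δ ⟨h0, h1⟩
    obtain ⟨t, ht, ht', rfl⟩ := exists_intCast_eq (by omega : 0 < 2 * h) (-h) δ
    have hth : t ≠ h := by
      rintro rfl
      simp at h1
    have ht0 : t ≠ 0 := by
      rintro rfl
      simp at h0
    obtain ⟨k, hk, hkt⟩ : ∃ k : ℕ, k + 1 < h ∧ (t = k + 1 ∨ t = -(k + 1)) :=
      ⟨t.natAbs - 1, by omega, by omega⟩
    have hz := zigzag_succ_sub k
    by_cases hs : zigzag (k + 1) - zigzag k = t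
    · refine ⟨zigzag k, ?_⟩
      rw [← e1 k (by omega), hFE () _ (by omega), e1 (k + 1) hk, ← hs]
      push_cast
      simp
    · have hs' : zigzag k - zigzag (k + 1) = t := by
        split_ifs at hz <;> omega
      refine ⟨zigzag (k + 1) + h, ?_⟩
      rw [← e3 (k + 1) (by omega), hFE () _ (by omega),
        show 2 * h + 1 - (k + 1) + 1 = 2 * h + 1 - k by omega, e3 k (by omega), ← hs']
      push_cast
      congr 1
      ring
  have hI : ∀ i, ∃ w, F (.inl w) = .inr i := by
    rintro (_ | _)
    · refine ⟨zigzag 0 + h, ?_⟩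
      rw [← e3 0 hh, hFE () _ (by omega)]
      simp [E, mul_add]
    · refine ⟨zigzag (h - 1), ?_⟩
      rw [← e1 (h - 1) (by omega), hFE () _ (by omega), show h - 1 + 1 + 1 = h + 1 by omega, e2]
  have hI' : ∀ i, ∃ w, F (.inr i) = .inl w := by
    rintro (_ | _)
    · rw [← e0, hFE () _ (by omega), e1 0 hh]
      exact ⟨_, rfl⟩
    · rw [← e2, hFE () _ (by omega), show h + 1 + 1 = 2 * h + 1 - (h - 1) by omega,
        e3 (h - 1) (by omega)]
      exact ⟨_, rfl⟩
  have hcard : Nat.card {δ // D δ} + Nat.card Bool = Nat.card G := by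
    rw [← card_ne_and_ne hh0.symm, Nat.card_eq_fintype_card (α := Bool), Fintype.card_bool]
  let σ : G ⊕ Bool → G ⊕ Bool := Sum.map (fun v => v + h) not
  refine Fac.ep_of_involution (V := G ⊕ Bool) (σ := σ) ?_ ?_ ?_ hcardV
  · have : (fun u v => u ≠ v ∧ v ≠ σ u) = devArc D := by
      funext u v
      rcases u with a | i <;> rcases v with b | j
      · simp only [devArc, D, σ, ne_eq, Sum.inl.injEq, Sum.map_inl, eq_iff_iff, sub_eq_iff_eq_add]
        rw [add_comm a, eq_comm (a := (0 : G)), sub_eq_zero, eq_comm (a := b) (b := a)]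
      · simp [devArc, σ]
      · simp [devArc, σ]
      · revert i j
        simp [devArc, σ]
    rw [this]
    refine Fac.of_perms (fun g => (transl g).permCongr F) (fun g => g + h) ?_ ?_ ?_
      (exists_transl_of_devArc hD hI hI') (card_devArc hcard) False.elim
    · intro i
      rw [add_assoc, hhh, add_zero]
    · intro i hi
      exact hh0 (by simpa using hi)
    · intro g v
      rw [minimalPeriod_permCongr, hF]
  · rintro (v | v)
    · simp [σ, add_assoc, hhh]
    · simp [σ]
  · rintro (v | v)
    · simpa [σ] using hh0
    · simp [σ]

theorem transl_add {G I : Type} [AddCommGroup G] (g h : G) :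
    (transl (g + h) : Perm (G ⊕ I)) = transl g * transl h := by
  ext (v | i)
  · simp only [transl_inl, Perm.mul_apply]
    rw [add_assoc, add_comm g]
  · rfl

theorem mul_permCongr {V : Type} (e e' F : Perm V) :
    (e * e').permCongr F = e.permCongr (e'.permCongr F) := rfl

theorem permCongr_inv {V : Type} (e F : Perm V) : e.permCongr F⁻¹ = (e.permCongr F)⁻¹ := rfl

theorem permCongr_eq_inv {V : Type} {T F : Perm V} (h : ∀ u, F (T (F u)) = T u) :
    T.permCongr F = F⁻¹ := by
  ext u
  obtain ⟨u, rfl⟩ := T.surjective u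
  rw [permCongr_apply, symm_apply_apply, eq_comm, Perm.inv_eq_iff_eq, h]

/-- The complete digraph of odd order `n` decomposes into pairs of opposite directed Hamiltonian
cycles. -/
theorem ep_hamiltonian {n : ℕ} (hn : 3 ≤ n) (hodd : Odd n) : EP True n n 1 := by
  obtain ⟨h, rfl⟩ := hodd
  have hh : 0 < h := by omega
  have : NeZero (2 * h) := ⟨by omega⟩
  let G := ZMod (2 * h)
  have hhh : ((h : ℕ) : G) + h = 0 := by
    rw [← Nat.cast_add, ← two_mul, ZMod.natCast_self]
  have hh0 : (h : G) ≠ 0 := by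
    rw [Ne, ZMod.natCast_eq_zero_iff]
    intro h'
    have := Nat.le_of_dvd hh h'
    omega
  let E : Unit → ℕ → G ⊕ Unit := fun _ k =>
    if k % (2 * h + 1) = 0 then .inr () else .inl (zigzag (k - 1))
  have e0 : E () 0 = .inr () := by simp [E]
  have e0' : E () (2 * h + 1) = .inr () := by simp [E]
  have e1 : ∀ k < 2 * h, E () (k + 1) = .inl (zigzag k) := fun k hk => by
    simp only [E]
    rw [if_neg (by rw [Nat.mod_eq_of_lt (by omega)]; omega)]
    rfl
  have hcardV : Nat.card (G ⊕ Unit) = (2 * h + 1) * 1 := by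
    rw [Nat.card_sum, Nat.card_zmod, Nat.card_unique, mul_one]
  have hsurj : ∀ v, ∃ c, ∃ k < 2 * h + 1, E c k = v := by
    rintro (x | _)
    · obtain ⟨t, ht, ht', rfl⟩ := exists_intCast_eq (by omega : 0 < 2 * h) (-h) x
      obtain ⟨k, hk, rfl⟩ := exists_zigzag (N := 2 * h) (t := t) (by push_cast; omega)
        (by push_cast; push_cast at ht'; omega)
      exact ⟨(), k + 1, by omega, e1 k hk⟩
    · exact ⟨(), 0, by omega, e0⟩
  obtain ⟨F, hF, hFE⟩ := exists_perm_of_cycles (m := 2 * h + 1) (by omega) E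
    (fun _ => by simp [E]) hsurj (by rw [hcardV]; simp)
  have hT : ∀ k ≤ 2 * h + 1, transl (h : G) (E () k) = E () (2 * h + 1 - k) := by
    intro k hk
    rcases Nat.eq_zero_or_pos k with rfl | hk0
    · rw [e0, tsub_zero, e0', transl_inr]
    · obtain ⟨k, rfl⟩ : ∃ i, k = i + 1 := ⟨k - 1, by omega⟩
      rcases hk.eq_or_lt with h' | h'
      · rw [h', e0', tsub_self, e0, transl_inr]
      · rw [show 2 * h + 1 - (k + 1) = (2 * h - 1 - k) + 1 by omega, e1 _ (by omega),
          e1 _ (by omega), transl_inl]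
        congr 1
        have : zigzag (2 * h - 1 - k) = zigzag k + h ∨
            zigzag (2 * h - 1 - k) + (h + h) = zigzag k + h := by
          simp only [zigzag]
          split_ifs <;> omega
        rcases this with h' | h'
        · rw [h']
          push_cast
          rfl
        · have h'' := congrArg (Int.cast : ℤ → G) h'
          push_cast at h''
          rw [hhh, add_zero] at h''
          exact h''.symm
  have hinv : (transl (h : G)).permCongr F = F⁻¹ := by
    apply permCongr_eq_inv
    intro u
    obtain ⟨⟨⟩, k, hk, rfl⟩ := hsurj u
    rw [hFE () k hk, hT (k + 1) (by omega), hT k (by omega), hFE () _ (by omega),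
      show 2 * h + 1 - (k + 1) + 1 = 2 * h + 1 - k by omega]
  let D : G → Prop := fun δ => δ ≠ 0
  have hD : ∀ δ, D δ → ∃ w, F (.inl w) = .inl (w + δ) := by
    intro δ h0
    obtain ⟨k, hk, hkδ⟩ : ∃ k : ℕ, k + 1 < 2 * h ∧
        ((if k % 2 = 0 then (k : ℤ) + 1 else -((k : ℤ) + 1) : ℤ) : G) = δ := by
      have hδ := ZMod.val_lt δ
      have hv : ((δ.val : ℕ) : G) = δ := ZMod.natCast_zmod_val δ
      have hδ0 : δ.val ≠ 0 := by rwa [Ne, ZMod.val_eq_zero]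
      rcases Nat.even_or_odd' δ.val with ⟨j, hj | hj⟩
      · refine ⟨2 * h - 2 * j - 1, by omega, ?_⟩
        rw [if_neg (by omega), show ((2 * h - 2 * j - 1 : ℕ) : ℤ) + 1 = (h + h : ℕ) - δ.val by omega]
        push_cast
        rw [hhh, hv, zero_sub]
        exact neg_neg δ
      · refine ⟨2 * j, by omega, ?_⟩
        rw [if_pos (by omega), show ((2 * j : ℕ) : ℤ) + 1 = δ.val by omega, Int.cast_natCast,
          hv]
    refine ⟨zigzag k, ?_⟩
    rw [← zigzag_succ_sub] at hkδ
    rw [← e1 k (by omega), hFE () _ (by omega), e1 (k + 1) hk, ← hkδ]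
    push_cast
    simp
  have hI : ∀ i, ∃ w, F (.inl w) = .inr i := by
    intro i
    refine ⟨zigzag (2 * h - 1), ?_⟩
    rw [← e1 _ (by omega), hFE () _ (by omega), show 2 * h - 1 + 1 + 1 = 2 * h + 1 by omega, e0']
  have hI' : ∀ i, ∃ w, F (.inr i) = .inl w := by
    intro i
    rw [← e0, hFE () _ (by omega), e1 0 (by omega)]
    exact ⟨_, rfl⟩
  have hcard : Nat.card {δ // D δ} + Nat.card Unit = Nat.card G := by
    rw [← card_ne (0 : G), Nat.card_unique (α := Unit)]
  refine Fac.ep (V := G ⊕ Unit) (p := id) ?_ one_pos (by simp) hcardV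
  have : (fun u v : G ⊕ Unit => id u ≠ id v) = devArc D := by
    funext u v
    rcases u with a | i <;> rcases v with b | j
    · simp [devArc, D, sub_eq_zero, eq_comm]
    all_goals simp [devArc]
  rw [this]
  refine Fac.of_perms (fun g => (transl g).permCongr F) (fun g => g + h) ?_ ?_ ?_
    (exists_transl_of_devArc hD hI hI') (card_devArc hcard) fun _ g => ?_
  · intro i
    rw [add_assoc, hhh, add_zero]
  · intro i hi
    exact hh0 (by simpa using hi)
  · intro g v
    rw [minimalPeriod_permCongr, hF]
  · rw [transl_add, mul_permCongr, hinv, permCongr_inv]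
    exact exists_colouring_pair _ (by omega : 2 ≤ 2 * h + 1) fun v => by
      rw [minimalPeriod_permCongr, hF]

/-- A near-path `P` and a cycle `B` covering the residues modulo `2 * n - 1`, whose differences
cover everything once with each parity, yield a factorization of the digraph with `2 * n` parts
of size two. -/
theorem ep_two_of_base {n : ℕ} (hn : 3 ≤ n) (P B : ℕ → ℤ) (β : ℕ → ℕ)
    (hB : B n = B 0) (hβ : β n = β 0)
    (hcov : ∀ z : ZMod (2 * n - 1), (∃ k < n - 1, (P k : ZMod (2 * n - 1)) = z) ∨
      ∃ k < n, (B k : ZMod (2 * n - 1)) = z)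
    (hdiff : ∀ d : ℕ, 0 < d → d < n → ∀ b < 2,
      (b = 0 ∧ ∃ k, k + 1 < n - 1 ∧ (P (k + 1) - P k = d ∨ P (k + 1) - P k = -d)) ∨
      ∃ k < n, β (k + 1) % 2 = (β k + b) % 2 ∧ ∃ c : ℤ, B (k + 1) - B k = d + (2 * n - 1) * c ∨
        B (k + 1) - B k = -d + (2 * n - 1) * c) :
    EP True n (2 * n) 2 := by
  obtain ⟨h, hh⟩ : ∃ h, h = 2 * n - 1 := ⟨_, rfl⟩
  rw [← hh] at hcov
  have hZ : ((2 * n - 1 : ℤ) : ZMod h) = 0 := by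
    rw [show (2 * n - 1 : ℤ) = (h : ℕ) by omega, Int.cast_natCast, ZMod.natCast_self]
  have : NeZero h := ⟨by omega⟩
  have two (b : ZMod 2) : b + b = 0 := CharTwo.add_self_eq_zero b
  let E₀ : Bool → ℕ → ((ZMod h × ZMod 2) ⊕ ZMod 2) := fun s k => if s then .inl (B k, β k) else
    if k % n = 0 then .inr 0 else .inl (P (k - 1), 0)
  let S : Perm ((ZMod h × ZMod 2) ⊕ ZMod 2) := Equiv.sumCongr (Equiv.refl (ZMod h × ZMod 2)) (Equiv.addRight 1)
  let T : Perm ((ZMod h × ZMod 2) ⊕ ZMod 2) := S * transl (0, 1)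
  have hS : ∀ v : ZMod h × ZMod 2, S (.inl v) = .inl v := fun _ => rfl
  have hS' : ∀ i : ZMod 2, S (.inr i) = .inr (i + 1) := fun _ => rfl
  have hTl : ∀ v : ZMod h × ZMod 2, T (.inl v) = .inl (v + (0, 1)) := fun _ => rfl
  have hTr : ∀ i : ZMod 2, T (.inr i) = .inr (i + 1) := fun _ => rfl
  have hTT : ∀ v, T (T v) = v := by
    rintro (⟨z, b⟩ | b)
    · simp [hTl, add_assoc, two]
    · simp [hTr, add_assoc, two]
  have hE₀ : ∀ s, E₀ s n = E₀ s 0 := by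
    rintro (_ | _)
    · simp [E₀]
    · simp [E₀, hB, hβ]
  let E : Bool × Bool → ℕ → ((ZMod h × ZMod 2) ⊕ ZMod 2) := fun c k => if c.2 then T (E₀ c.1 (n - k)) else E₀ c.1 k
  let π : ((ZMod h × ZMod 2) ⊕ ZMod 2) → ZMod h ⊕ Unit := Sum.map Prod.fst fun _ => ()
  have hπS : ∀ v, π (S v) = π v := by
    rintro (v | v) <;> rfl
  have hπT : ∀ v, π (T v) = π v := by
    rintro (v | v)
    · simp [hTl, π]
    · rfl
  have hπ : ∀ u v, π u = π v → u = v ∨ u = T v := by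
    have hb : ∀ b c : ZMod 2, b = c ∨ b = c + 1 := by decide
    rintro (⟨y, b⟩ | b) (⟨z, c⟩ | c) huv
    · obtain rfl : y = z := by simpa [π] using huv
      rcases hb b c with rfl | rfl
      · exact Or.inl rfl
      · right
        simp [hTl]
    · simp [π] at huv
    · simp [π] at huv
    · rcases hb b c with rfl | rfl
      · exact Or.inl rfl
      · right
        rfl
  have hsurj₀ : ∀ v, ∃ s, ∃ k < n, π (E₀ s k) = v := by
    rintro (z | _)
    · rcases hcov z with ⟨k, hk, rfl⟩ | ⟨k, hk, rfl⟩
      · refine ⟨false, k + 1, by omega, ?_⟩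
        simp [E₀, π, Nat.mod_eq_of_lt (by omega : k + 1 < n)]
      · exact ⟨true, k, hk, rfl⟩
    · exact ⟨false, 0, by omega, by simp [E₀, π]⟩
  have hsurj : ∀ v, ∃ c, ∃ k < n, E c k = v := by
    intro v
    obtain ⟨s, k, hk, hv⟩ := hsurj₀ (π v)
    rcases hπ _ _ hv.symm with rfl | rfl
    · exact ⟨(s, false), k, hk, rfl⟩
    · rcases Nat.eq_zero_or_pos k with rfl | hk'
      · exact ⟨(s, true), 0, by omega, by simp [E, hE₀]⟩
      · exact ⟨(s, true), n - k, by omega, by simp [E, Nat.sub_sub_self hk.le]⟩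
  have hcardV : Nat.card ((ZMod h × ZMod 2) ⊕ ZMod 2) = 2 * n * 2 := by
    simp only [Nat.card_sum, Nat.card_prod, Nat.card_zmod]
    omega
  obtain ⟨F₀, hF₀, hFE₀⟩ := exists_perm_of_cycles (m := n) (by omega) (fun s k => π (E₀ s k))
    (fun s => by rw [hE₀]) hsurj₀ (by simp; omega)
  obtain ⟨χ, hχ⟩ := exists_colouring_pair F₀ (by omega) hF₀
  obtain ⟨F, hF, hFE⟩ := exists_perm_of_cycles (m := n) (by omega) E
    (fun c => by
      rcases c with ⟨s, _ | _⟩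
      · simp [E, hE₀]
      · simp [E, hE₀]) hsurj (by rw [hcardV]; simp; ring)
  have hf : ∀ s, ∀ k < n, F (E₀ s k) = E₀ s (k + 1) := fun s => hFE (s, false)
  have ht : ∀ s, ∀ k < n, F (T (E₀ s (k + 1))) = T (E₀ s k) := by
    intro s k hk
    have := hFE (s, true) (n - (k + 1)) (by omega)
    simp only [E, if_true] at this
    rwa [Nat.sub_sub_self (by omega), show n - (n - (k + 1) + 1) = k by omega] at this
  have hFT : T.permCongr F = F⁻¹ := by
    refine permCongr_eq_inv fun u => ?_
    obtain ⟨s, k, hk, hu⟩ := hsurj₀ (π u)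
    rcases hπ _ _ hu.symm with rfl | rfl
    · rw [hf s k hk, ht s k hk]
    · obtain ⟨j, hj, hjk⟩ : ∃ j < n, E₀ s k = E₀ s (j + 1) := by
        rcases Nat.eq_zero_or_pos k with rfl | hk'
        · exact ⟨n - 1, by omega, by rw [show n - 1 + 1 = n by omega, hE₀]⟩
        · exact ⟨k - 1, by omega, by rw [show k - 1 + 1 = k by omega]⟩
      rw [hjk, ht s j hj, hTT, hTT, hf s j hj]
  have hχF : ∀ u, χ (π (F u)) ≠ χ (π u) := by
    intro u
    have key : ∀ s, ∀ k < n, χ (π (E₀ s (k + 1))) ≠ χ (π (E₀ s k)) := by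
      intro s k hk
      rw [← hFE₀ s k hk]
      exact (hχ _).1
    obtain ⟨s, k, hk, hu⟩ := hsurj₀ (π u)
    rcases hπ _ _ hu.symm with rfl | rfl
    · rw [hf s k hk]
      exact key s k hk
    · obtain ⟨j, hj, hjk⟩ : ∃ j < n, E₀ s k = E₀ s (j + 1) := by
        rcases Nat.eq_zero_or_pos k with rfl | hk'
        · exact ⟨n - 1, by omega, by rw [show n - 1 + 1 = n by omega, hE₀]⟩
        · exact ⟨k - 1, by omega, by rw [show k - 1 + 1 = k by omega]⟩
      rw [hjk, ht s j hj, hπT, hπT]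
      exact (key s j hj).symm
  have hχF' : ∀ u, χ (π (F⁻¹ u)) ≠ χ (π u) := by
    intro u
    obtain ⟨u, rfl⟩ := F.surjective u
    simpa using (hχF u).symm
  have hconj : (transl (0, 1) : Perm ((ZMod h × ZMod 2) ⊕ ZMod 2)).permCongr F = S⁻¹.permCongr F⁻¹ := by
    rw [← hFT, ← mul_permCongr]
    simp [T]
  let D : (ZMod h × ZMod 2) → Prop := fun δ => δ.1 ≠ 0
  have hstep : ∀ s, ∀ k < n, ∀ w w', E₀ s k = .inl w → E₀ s (k + 1) = .inl w' →
      ∀ b, w'.2 = w.2 + b →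
        (∃ v, F (.inl v) = .inl (v + (w'.1 - w.1, b))) ∧
        ∃ v, F (.inl v) = .inl (v + (w.1 - w'.1, b)) := by
    intro s k hk w w' hw hw' b hb
    constructor
    · refine ⟨w, ?_⟩
      rw [← hw, hf s k hk, hw']
      congr 1
      ext <;> simp [hb]
    · refine ⟨w' + (0, 1), ?_⟩
      have h1 : ∀ w : ZMod h × ZMod 2, (.inl (w + (0, 1)) : ((ZMod h × ZMod 2) ⊕ ZMod 2)) = T (.inl w) := fun w => rfl
      rw [h1, ← hw', ht s k hk, hw, ← h1]
      congr 1
      ext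
      · simp
      · simp [hb]
        rw [add_right_comm, add_assoc w.2, two, add_zero]
  have hD : ∀ δ, D δ → ∃ w, F (.inl w) = .inl (w + δ) := by
    rintro ⟨z, b⟩ hz
    obtain ⟨t, ht, ht', rfl⟩ := exists_intCast_eq (by omega : 0 < h) (-n) z
    have ht0 : t ≠ 0 := by
      rintro rfl
      simp [D] at hz
    have key : ∀ e : ZMod h, (e = (t.natAbs : ℕ) ∨ e = -(t.natAbs : ℕ)) →
        (t : ZMod h) = e ∨ (t : ZMod h) = -e := by
      intro e he
      rcases Int.natAbs_eq t with h' | h' <;> rcases he with rfl | rfl <;> rw [h'] <;> simp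
    have hcases : ∀ s, ∀ k < n, ∀ w w', E₀ s k = .inl w → E₀ s (k + 1) = .inl w' →
        w'.2 = w.2 + b → (w'.1 - w.1 = (t.natAbs : ℕ) ∨ w'.1 - w.1 = -(t.natAbs : ℕ)) →
        ∃ w, F (.inl w) = .inl (w + ((t : ZMod h), b)) := by
      intro s k hk w w' hw hw' hb he
      have := hstep s k hk w w' hw hw' b hb
      rcases key _ he with h' | h'
      · rw [h']
        exact this.1
      · rw [h', neg_sub]
        exact this.2
    rcases hdiff t.natAbs (by omega) (by omega) b.val (ZMod.val_lt b) with
      ⟨hb, k, hk, hP⟩ | ⟨k, hk, hb, c, hP⟩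
    · refine hcases false (k + 1) (by omega) (P k, 0) (P (k + 1), 0) ?_ ?_ ?_ ?_
      · simp [E₀, Nat.mod_eq_of_lt (by omega : k + 1 < n)]
      · simp [E₀, Nat.mod_eq_of_lt (by omega : k + 1 + 1 < n)]
      · rw [ZMod.val_eq_zero] at hb
        simp [hb]
      · rcases hP with h' | h' <;> [left; right] <;>
        · have := congrArg (Int.cast (R := ZMod h)) h'
          push_cast at this
          simpa using this
    · refine hcases true k hk (B k, β k) (B (k + 1), β (k + 1)) rfl rfl ?_ ?_
      · have := (ZMod.natCast_eq_natCast_iff' _ _ 2).2 hb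
        push_cast at this
        simpa using this
      · rcases hP with h' | h' <;> [left; right] <;>
        · have := congrArg (Int.cast (R := ZMod h)) h'
          rw [Int.cast_add, Int.cast_mul, hZ, zero_mul, add_zero] at this
          push_cast at this
          simpa using this
  have hI : ∀ i, ∃ w, F (.inl w) = .inr i := by
    have h1 := hf false (n - 1) (by omega)
    have h2 := ht false 0 (by omega)
    rw [show n - 1 + 1 = n by omega] at h1
    have hi : ∀ i : ZMod 2, i = 0 ∨ i = 1 := by decide
    intro i
    rcases hi i with rfl | rfl
    · refine ⟨(P (n - 1 - 1), 0), ?_⟩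
      convert h1
      · simp [E₀, Nat.mod_eq_of_lt (by omega : n - 1 < n), show n - 1 ≠ 0 by omega]
      · simp [E₀]
    · refine ⟨((P 0 : ZMod h), 0) + (0, 1), ?_⟩
      convert h2
      · simp [E₀, Nat.mod_eq_of_lt (by omega : 1 < n), hTl]
      · simp [E₀, hTr]
  have hI' : ∀ i, ∃ w, F (.inr i) = .inl w := by
    have h1 := hf false 0 (by omega)
    have h2 := ht false (n - 1) (by omega)
    rw [show n - 1 + 1 = n by omega] at h2
    have hi : ∀ i : ZMod 2, i = 0 ∨ i = 1 := by decide
    intro i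
    rcases hi i with rfl | rfl
    · refine ⟨(P 0, 0), ?_⟩
      convert h1
      · simp [E₀]
      · simp [E₀, Nat.mod_eq_of_lt (by omega : 1 < n)]
    · refine ⟨((P (n - 1 - 1) : ZMod h), 0) + (0, 1), ?_⟩
      convert h2
      · simp [E₀, hTr]
      · simp [E₀, Nat.mod_eq_of_lt (by omega : n - 1 < n), show n - 1 ≠ 0 by omega, hTl]
  have hcard : Nat.card {δ // D δ} + Nat.card (ZMod 2) = Nat.card (ZMod h × ZMod 2) := by
    have e : {δ : (ZMod h × ZMod 2) // D δ} ≃ {z : ZMod h // z ≠ 0} × ZMod 2 :=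
      prodSubtypeFstEquivSubtypeProd (p := fun z : ZMod h => z ≠ 0)
    have := card_ne (0 : ZMod h)
    rw [Nat.card_congr e, Nat.card_prod, Nat.card_prod, ← this, add_mul, one_mul]
  refine Fac.ep_of_involution (V := (ZMod h × ZMod 2) ⊕ ZMod 2) (σ := T) ?_ hTT ?_ hcardV
  · have : (fun u v => u ≠ v ∧ v ≠ T u) = devArc D := by
      have hb : ∀ b c : ZMod 2, b = c ∨ c = b + 1 := by decide
      funext u v
      rcases u with ⟨z, b⟩ | i <;> rcases v with ⟨w, c⟩ | j
      · rw [eq_iff_iff]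
        simp only [devArc, D, Prod.fst_sub, sub_ne_zero]
        constructor
        · rintro ⟨h1, h2⟩ rfl
          rcases hb b c with rfl | rfl
          · exact h1 rfl
          · exact h2 (by simp [hTl])
        · intro h'
          constructor
          · rintro h''
            simp at h''
            exact h' h''.1.symm
          · intro h''
            simp [hTl] at h''
            exact h' h''.1
      · simp [devArc, hTl]
      · simp [devArc, hTr]
      · simp [devArc, hTr]
        intro h'
        exact (hb i j).resolve_left h'
    rw [this]
    refine Fac.of_perms (fun g => (transl g).permCongr F) (fun g => g + (0, 1)) ?_ ?_ ?_
      (exists_transl_of_devArc hD hI hI') (card_devArc hcard) ?_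
    · intro i
      ext <;> simp [add_assoc, two]
    · intro i hi
      simp at hi
    · intro g v
      rw [minimalPeriod_permCongr, hF]
    · intro _ g
      refine ⟨fun v => χ (π ((transl g).symm v)), fun v => ?_⟩
      rw [transl_add, mul_permCongr, hconj]
      constructor
      · simpa using hχF ((transl g).symm v)
      · have h1 : ∀ v, π (S⁻¹ v) = π v := fun v => by
          rw [← hπS, ← Perm.mul_apply, mul_inv_cancel, Perm.one_apply]
        have h2 := hχF' (S ((transl g).symm v))
        rw [hπS] at h2
        simp only [permCongr_apply, symm_apply_apply]
        rw [h1]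
        exact h2
  · rintro (v | v)
    · simp [hTl]
    · simp [hTr]

theorem zigzag_two_mul (k : ℕ) : zigzag (2 * k) = -k := by
  rw [zigzag, if_pos (by omega)]
  omega

theorem zigzag_two_mul_add_one (k : ℕ) : zigzag (2 * k + 1) = k + 1 := by
  rw [zigzag, if_neg (by omega)]
  omega

theorem ep_two_four_mul_add_one {k : ℕ} (hk : 0 < k) :
    EP True (4 * k + 1) (2 * (4 * k + 1)) 2 := by
  let B : ℕ → ℤ := fun i => if i < 4 * k then zigzag i else if i = 4 * k then 4 * k + 1 else 0
  let P : ℕ → ℤ := fun i =>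
    if i < 2 * k then
      if i % 2 = 0 then 2 * k + 1 + (i / 2 : ℕ) else 6 * k + 1 - (i / 2 : ℕ)
    else
      if i % 2 = 0 then 6 * k + 1 - (i / 2 : ℕ) else 2 * k + 1 + (i / 2 : ℕ)
  let β : ℕ → ℕ := fun i => if i < 4 * k then i % 2 else if i = 4 * k then 1 else 0
  refine ep_two_of_base (by omega) P B β ?_ ?_ ?_ ?_
  · simp [B, zigzag, hk]
  · simp [β, hk.ne']
  · intro z
    obtain ⟨t, ht, ht', rfl⟩ := exists_intCast_eq (by omega) (-(2 * k : ℕ)) z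
    have hcast : ∀ e : ℤ, e = t → (e : ZMod (2 * (4 * k + 1) - 1)) = t := fun e he => by rw [he]
    by_cases h1 : t ≤ 2 * k
    · obtain ⟨i, hi, hit⟩ := exists_zigzag (N := 4 * k) (t := t) (by omega) (by omega)
      exact Or.inr ⟨i, by omega, hcast _ (by simp only [B]; rw [if_pos hi, hit])⟩
    by_cases h2 : t = 4 * k + 1
    · exact Or.inr ⟨4 * k, by omega, hcast _ (by simp [B, h2])⟩
    left
    obtain ⟨i, hi, hit⟩ : ∃ i < 4 * k, P i = t := by
      simp only [P]
      rcases lt_or_ge t (3 * k + 1) with h3 | h3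
      · exact ⟨2 * (t - 2 * k - 1).toNat, by omega, by rw [if_pos (by omega)]; omega⟩
      rcases lt_or_ge t (4 * k + 1) with h4 | h4
      · exact ⟨2 * (t - 2 * k - 1).toNat + 1, by omega, by rw [if_neg (by omega)]; omega⟩
      rcases lt_or_ge t (5 * k + 2) with h5 | h5
      · exact ⟨2 * (6 * k + 1 - t).toNat, by omega, by rw [if_neg (by omega)]; omega⟩
      · exact ⟨2 * (6 * k + 1 - t).toNat + 1, by omega, by rw [if_pos (by omega)]; omega⟩
    exact ⟨i, by omega, hcast _ hit⟩
  · intro d hd hdn b hb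
    obtain rfl | rfl : b = 0 ∨ b = 1 := by omega
    · by_cases h1 : d = 2 * k + 1
      · right
        refine ⟨4 * k - 1, by omega, ?_, 0, ?_⟩
        · simp only [β]
          split_ifs <;> omega
        · have := zigzag_two_mul_add_one (2 * k - 1)
          rw [show 2 * (2 * k - 1) + 1 = 4 * k - 1 by omega] at this
          simp only [B]
          rw [if_neg (by omega), if_pos (by omega), if_pos (by omega), this]
          omega
      · left
        obtain ⟨i, hi⟩ : ∃ i, i = if d = 1 then 2 * k - 1 else 4 * k - d := ⟨_, rfl⟩
        refine ⟨rfl, i, by split_ifs at hi <;> omega, ?_⟩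
        simp only [P]
        split_ifs at hi ⊢ <;> omega
    · right
      by_cases h1 : d = 4 * k
      · refine ⟨4 * k, by omega, ?_, -1, ?_⟩
        · simp only [β]
          split_ifs <;> omega
        · simp [B]
          omega
      · refine ⟨d - 1, by omega, ?_, 0, ?_⟩
        · simp only [β]
          split_ifs <;> omega
        · have := zigzag_succ_sub (d - 1)
          simp only [B]
          rw [if_pos (by omega), if_pos (by omega), this]
          split_ifs <;> omega

theorem ep_two_four_mul_add_three {k : ℕ} (hk : 0 < k) :
    EP True (4 * k + 3) (2 * (4 * k + 3)) 2 := by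
  let B : ℕ → ℤ := fun i => if i < 2 * k + 2 then zigzag i else if i < 4 * k + 2 then 1 - zigzag i
    else if i = 4 * k + 2 then 4 * k + 3 else 0
  let P : ℕ → ℤ := fun i =>
    if i % 2 = 0 then 2 * k + 2 + (i / 2 : ℕ) else 6 * k + 4 - (i / 2 : ℕ)
  let β : ℕ → ℕ := fun i => if i = 0 then 0 else if i ≤ 4 * k + 2 then (i + 1) % 2 else 0
  refine ep_two_of_base (by omega) P B β ?_ ?_ ?_ ?_
  · simp only [B]
    rw [if_neg (by omega), if_neg (by omega), if_neg (by omega), if_pos (by omega)]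
    rfl
  · simp [β]
  · intro z
    obtain ⟨t, ht, ht', rfl⟩ := exists_intCast_eq (by omega) (-(2 * k + 1 : ℕ)) z
    have hcast : ∀ e : ℤ, e = t → (e : ZMod (2 * (4 * k + 3) - 1)) = t := fun e he => by rw [he]
    by_cases h0 : t = 4 * k + 3
    · exact Or.inr ⟨4 * k + 2, by omega, hcast _ (by simp only [B]; split_ifs <;> omega)⟩
    by_cases h1 : t < 2 * k + 2
    · right
      by_cases h2 : -(2 * k + 2 : ℕ) < 2 * t ∧ 2 * t ≤ (2 * k + 2 : ℕ)
      · obtain ⟨i, hi, hit⟩ := exists_zigzag h2.1 h2.2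
        exact ⟨i, by omega, hcast _ (by simp only [B]; rw [if_pos hi, hit])⟩
      · obtain ⟨i, hi, hit⟩ := exists_zigzag (N := 4 * k + 2) (t := 1 - t) (by omega) (by omega)
        have h3 : 2 * k + 2 ≤ i := by
          rw [zigzag] at hit
          split_ifs at hit <;> omega
        exact ⟨i, by omega, hcast _ (by simp only [B]; rw [if_neg (by omega), if_pos hi, hit]; ring)⟩
    · left
      obtain ⟨i, hi, hit⟩ : ∃ i < 4 * k + 2, P i = t := by
        simp only [P]
        rcases lt_or_ge t (4 * k + 3) with h2 | h2
        · exact ⟨2 * (t - 2 * k - 2).toNat, by omega, by rw [if_pos (by omega)]; omega⟩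
        · exact ⟨2 * (6 * k + 4 - t).toNat + 1, by omega, by rw [if_neg (by omega)]; omega⟩
      exact ⟨i, by omega, hcast _ hit⟩
  · intro d hd hdn b hb
    have hz := zigzag_succ_sub (d - 1)
    rw [show d - 1 + 1 = d by omega] at hz
    obtain rfl | rfl : b = 0 ∨ b = 1 := by omega
    · by_cases h1 : d = 1
      · subst h1
        refine Or.inr ⟨0, by omega, by simp [β], 0, ?_⟩
        simp only [B]
        rw [if_pos (by omega), if_pos (by omega)]
        exact Or.inl (by simpa using hz)
      · refine Or.inl ⟨rfl, 4 * k + 2 - d, by omega, ?_⟩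
        simp only [P]
        split_ifs <;> omega
    · right
      have hβ : ∀ i, 0 < i → i < 4 * k + 3 → β (i + 1) % 2 = (β i + 1) % 2 := by
        intro i hi hi'
        simp only [β]
        rcases eq_or_ne i (4 * k + 2) with rfl | h
        · rw [if_neg (by omega), if_neg (by omega), if_neg (by omega), if_pos le_rfl]
          omega
        · rw [if_neg (by omega), if_pos (by omega), if_neg (by omega), if_pos (by omega)]
          omega
      have hz1 := zigzag_two_mul_add_one k
      have hz2 := zigzag_two_mul (k + 1)
      have hz3 := zigzag_two_mul_add_one (2 * k)
      rw [show 2 * (2 * k) + 1 = 4 * k + 1 by omega] at hz3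
      rcases eq_or_ne d 1 with rfl | h1
      · refine ⟨2 * k + 1, by omega, hβ _ (by omega) (by omega), 0, ?_⟩
        simp only [B]
        rw [if_neg (by omega), if_pos (by omega), if_pos (by omega), hz1,
          show 2 * k + 1 + 1 = 2 * (k + 1) by omega, hz2]
        omega
      rcases eq_or_ne d (2 * k + 2) with rfl | h2
      · refine ⟨4 * k + 1, by omega, hβ _ (by omega) (by omega), 1, ?_⟩
        simp only [B]
        split_ifs <;> omega
      rcases eq_or_ne d (4 * k + 2) with rfl | h3
      · refine ⟨4 * k + 2, by omega, hβ _ (by omega) (by omega), -1, ?_⟩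
        simp only [B]
        split_ifs <;> omega
      · refine ⟨d - 1, by omega, hβ _ (by omega) (by omega), 0, ?_⟩
        rw [show d - 1 + 1 = d by omega]
        simp only [B]
        split_ifs at hz ⊢ <;> omega

theorem ep_two_two_mul {n : ℕ} (hn : 5 ≤ n) (hodd : Odd n) : EP True n (2 * n) 2 := by
  obtain ⟨k, rfl | rfl⟩ : ∃ k, n = 4 * k + 1 ∨ n = 4 * k + 3 := by
    obtain ⟨h, rfl⟩ := hodd
    exact ⟨h / 2, by omega⟩
  · exact ep_two_four_mul_add_one (by omega)
  · exact ep_two_four_mul_add_three (by omega)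

/-- Cyclic shifts with slopes: a Latin array whose rows sum to zero yields a factorization of a
Cayley digraph blown up by a prime. -/
theorem fac_slope {G κ : Type} [AddCommGroup G] [Finite G] [Finite κ] {q : ℕ} (hq : q.Prime)
    (e : κ × Bool → G) (he : Injective e) (c : G → ZMod q) (hc : ∀ v s, c (v + e s) ≠ c v)
    (δ : κ × Bool → ZMod q → κ × Bool) (hδ : ∀ j, Injective fun i => δ i j)
    (hsum : ∀ i, ∑ t ∈ Finset.range q, e (δ i t) = 0) :
    Fac True (fun u v : G × ZMod q => ∃ s, v.1 - u.1 = e s) q := by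
  have := Fact.mk hq
  have hper : ∀ j : ZMod q, minimalPeriod (Equiv.addRight (1 : ZMod q)) j = q := by
    intro j
    have h := minimalPeriod_of_semiconj (φ := fun z : ZMod q => j + z) (F := fun z => 1 + z)
      (G := Equiv.addRight (1 : ZMod q)) (add_right_injective j) (fun v => by simp; ring) 0
    rw [add_zero] at h
    exact h.trans (ZMod.addOrderOf_one q)
  let φ : ZMod q → (ZMod q × G ≃ G × ZMod q) := fun r =>
    (Equiv.prodComm _ _).trans (Equiv.prodShear (Equiv.refl G) fun v => Equiv.addRight (c v * r))
  let F : (κ × Bool) × ZMod q → Perm (G × ZMod q) := fun i =>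
    (φ i.2).permCongr (skew (Equiv.addRight 1) fun j => e (δ i.1 j))
  have hF : ∀ i v, F i v = (v.1 + e (δ i.1 (v.2 - c v.1 * i.2)),
      v.2 - c v.1 * i.2 + 1 + c (v.1 + e (δ i.1 (v.2 - c v.1 * i.2))) * i.2) := by
    rintro i ⟨v, a⟩
    simp [F, φ, sub_eq_add_neg]
  refine Fac.of_perms F (fun i => ((i.1.1, !i.1.2), i.2)) ?_ ?_ ?_ ?_ ?_ ?_
  · rintro ⟨⟨a, b⟩, r⟩
    simp
  · rintro ⟨⟨a, b⟩, r⟩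
    simp
  · intro i v
    rw [minimalPeriod_permCongr]
    set z := (φ i.2).symm v
    rw [← Prod.mk.eta (p := z), minimalPeriod_skew _ _ (hper _) (c := 0) ?_, addOrderOf_zero,
      mul_one]
    have hit : ∀ t, (Equiv.addRight (1 : ZMod q))^[t] z.1 = z.1 + t := by
      intro t
      induction t with
      | zero => simp
      | succ t ih => rw [iterate_succ_apply', ih]; simp [add_assoc]
    simp only [hit]
    rw [sum_range_add_natCast fun j => e (δ i.1 j), ← hsum i.1,
      ← sum_range_add_natCast (fun j => e (δ i.1 j)) 0]
    simp
  · rintro ⟨v, a⟩ ⟨w, b⟩ ⟨s, hs⟩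
    obtain rfl : w = v + e s := by rw [← hs]; abel
    have hne := sub_ne_zero.2 (hc v s)
    obtain ⟨r, hr⟩ : ∃ r, r = (b - a - 1) / (c (v + e s) - c v) := ⟨_, rfl⟩
    obtain ⟨i, hi⟩ := Finite.surjective_of_injective (hδ (a - c v * r)) s
    refine ⟨(i, r), ?_⟩
    simp only at hi
    rw [hF]
    simp only [hi]
    congr 1
    rw [eq_div_iff hne] at hr
    linear_combination hr
  · rintro ⟨v, a⟩
    have e1 : {w : G × ZMod q // ∃ s, w.1 - v = e s} ≃ {w : G // ∃ s, w - v = e s} × ZMod q :=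
      prodSubtypeFstEquivSubtypeProd (p := fun w : G => ∃ s, w - v = e s)
    have e2 : κ × Bool ≃ {w : G // ∃ s, w - v = e s} :=
      Equiv.ofBijective (fun s => ⟨v + e s, s, by abel⟩)
        ⟨fun s t h => he (by simpa using h), fun ⟨w, s, h⟩ => ⟨s, by simp [← h]⟩⟩
    rw [Nat.card_congr e1, Nat.card_prod, Nat.card_prod, Nat.card_congr e2]
  · rintro - i
    obtain ⟨χ, hχ⟩ := exists_colouring (Equiv.addRight (1 : ZMod q)) hq.two_le
    refine ⟨fun v => χ (v.2 - c v.1 * i.2), fun v => ?_⟩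
    rw [hF, hF]
    simp only [add_sub_cancel_right]
    exact ⟨hχ _ (hper _), hχ _ (hper _)⟩

/-- The values `± g a`. -/
def signed {G κ : Type} [AddCommGroup G] (g : κ → G) (i : κ × Bool) : G :=
  if i.2 then -g i.1 else g i.1

/-- The signed index stored in a table at row `i` and column `j`. -/
def ofTable {k : ℕ} [NeZero k] (t : List (List ℕ)) (i : Fin k × Bool) (j : ℕ) : Fin k × Bool :=
  let n := (t.getD (2 * i.1 + if i.2 then 1 else 0) []).getD j 0
  (⟨n / 2 % k, Nat.mod_lt _ (NeZero.pos k)⟩, n % 2 == 1)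

theorem fac_slope_table {G : Type} [AddCommGroup G] [Finite G] {k : ℕ} [NeZero k] {q w r : ℕ}
    (hq : q.Prime) (hq' : Odd q) (hw : Odd w) (hwq : w ≤ q) (hrq : r ≤ q) (t : List (List ℕ))
    (g : Fin k → G) (hg : Injective (signed g)) (col : G → Fin r)
    (hcol : ∀ a v, col (v + g a) ≠ col v)
    (ht : ∀ j < w, Injective fun i : Fin k × Bool => ofTable t i j)
    (hsum : ∀ i, ∑ j ∈ Finset.range w, signed g (ofTable t i j) = 0) :
    Fac True (fun u v : G × ZMod q => ∃ i, v.1 - u.1 = signed g i) q := by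
  have : NeZero q := ⟨hq.ne_zero⟩
  let δ₀ : Fin k × Bool → ℕ → Fin k × Bool := fun i j =>
    if j < w then ofTable t i j else if j % 2 = 0 then i else (i.1, !i.2)
  refine fac_slope hq (signed g) hg (fun v => ((col v).val : ZMod q)) ?_ (fun i j => δ₀ i j.val)
    ?_ ?_
  · have hne : ∀ a b : Fin r, ((a.val : ℕ) : ZMod q) = (b.val : ℕ) → a = b := by
      intro a b h
      rw [ZMod.natCast_eq_natCast_iff', Nat.mod_eq_of_lt (by omega), Nat.mod_eq_of_lt (by omega)]
        at h
      exact Fin.ext h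
    rintro v ⟨a, _ | _⟩ h
    · exact hcol a v (hne _ _ h)
    · refine hcol a (v - g a) ?_
      rw [sub_add_cancel, sub_eq_add_neg]
      exact (hne _ _ h).symm
  · intro j
    by_cases h1 : j.val < w
    · simpa only [δ₀, if_pos h1] using ht _ h1
    · by_cases h2 : j.val % 2 = 0
      · simp only [δ₀, if_neg h1, if_pos h2]
        exact fun _ _ h => h
      · simp only [δ₀, if_neg h1, if_neg h2]
        rintro ⟨a, b⟩ ⟨c, d⟩ h
        simpa using h
  · intro i
    have key : ∀ n, ∑ j ∈ Finset.range (w + 2 * n), signed g (δ₀ i j) = 0 := by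
      intro n
      induction n with
      | zero =>
        rw [mul_zero, add_zero, ← hsum i]
        refine Finset.sum_congr rfl fun j hj => ?_
        simp only [δ₀]
        rw [if_pos (Finset.mem_range.1 hj)]
      | succ n ih =>
        rw [show w + 2 * (n + 1) = w + 2 * n + 1 + 1 by ring, Finset.sum_range_succ,
          Finset.sum_range_succ, ih, zero_add]
        obtain ⟨h, rfl⟩ := hw
        simp only [δ₀]
        rw [if_neg (by omega), if_neg (by omega), if_neg (by omega), if_pos (by omega)]
        rcases i with ⟨a, _ | _⟩ <;> simp [signed]
    obtain ⟨n, hn⟩ : ∃ n, q = w + 2 * n := by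
      obtain ⟨h, rfl⟩ := hw
      obtain ⟨h', rfl⟩ := hq'
      exact ⟨h' - h, by omega⟩
    rw [← key n, ← hn]
    refine Finset.sum_congr rfl fun j hj => ?_
    rw [ZMod.val_cast_of_lt (Finset.mem_range.1 hj)]

theorem fac_slope_two {G : Type} [AddCommGroup G] [Finite G] {q : ℕ} (hq : q.Prime)
    (hq' : 5 ≤ q) (s : G) (hg : Injective (signed ![s, 2 • s])) (col : G → Fin 5)
    (hcol : ∀ a v, col (v + ![s, 2 • s] a) ≠ col v) :
    Fac True (fun u v : G × ZMod q => ∃ i, v.1 - u.1 = signed ![s, 2 • s] i) q := by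
  refine fac_slope_table hq (hq.odd_of_ne_two (by omega)) (w := 5) (by decide) hq' hq'
    [[3, 0, 1, 0, 0], [0, 3, 0, 3, 2], [2, 2, 3, 1, 1], [1, 1, 2, 2, 3]] _ hg col hcol
    (by decide) ?_
  rintro ⟨a, b⟩
  fin_cases a <;> cases b <;> simp [Finset.sum_range_succ, ofTable, signed] <;> abel

theorem fac_slope_three {G : Type} [AddCommGroup G] [Finite G] {q : ℕ} (hq : q.Prime)
    (hq' : 5 ≤ q) (s : G) (hg : Injective (signed ![s, 2 • s, 4 • s])) {r : ℕ} (hr : r ≤ q) (col : G → Fin r)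
    (hcol : ∀ a v, col (v + ![s, 2 • s, 4 • s] a) ≠ col v) :
    Fac True (fun u v : G × ZMod q => ∃ i, v.1 - u.1 = signed ![s, 2 • s, 4 • s] i) q := by
  refine fac_slope_table hq (hq.odd_of_ne_two (by omega)) (w := 5) (by decide) hq' hr
    [[1, 0, 3, 0, 0], [0, 2, 1, 1, 1], [5, 1, 0, 2, 2], [2, 5, 2, 5, 4], [4, 4, 5, 3, 3],
      [3, 3, 4, 4, 5]] _ hg col hcol
    (by decide) ?_
  rintro ⟨a, b⟩
  fin_cases a <;> cases b <;> simp [Finset.sum_range_succ, ofTable, signed] <;> abel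

theorem fac_slope_add {G : Type} [AddCommGroup G] [Finite G] {q : ℕ} (hq : q.Prime)
    (hq' : 5 ≤ q) (s t : G) (hg : Injective (signed ![s, t, s + t])) (col : G → Fin 5)
    (hcol : ∀ a v, col (v + ![s, t, s + t] a) ≠ col v) :
    Fac True (fun u v : G × ZMod q => ∃ i, v.1 - u.1 = signed ![s, t, s + t] i) q := by
  refine fac_slope_table hq (hq.odd_of_ne_two (by omega)) (w := 5) (by decide) hq' hq'
    [[5, 4, 0, 2, 5], [4, 5, 5, 0, 2], [2, 0, 2, 5, 3], [0, 3, 4, 1, 1], [3, 1, 1, 4, 0],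
      [1, 2, 3, 3, 4]] _ hg col hcol
    (by decide) ?_
  rintro ⟨a, b⟩
  fin_cases a <;> cases b <;> simp [Finset.sum_range_succ, ofTable, signed] <;> abel

theorem fac_slope_four {p q : ℕ} [NeZero p] (hq : q.Prime) (hq' : 5 ≤ q) (u : ZMod p)
    (hg : Injective (signed ![((1 : ZMod 4), u), (1, -u), (2, 2 * u), (0, 2 * u)]))
    (col : ZMod 4 × ZMod p → Fin 5)
    (hcol : ∀ a v, col (v + ![((1 : ZMod 4), u), (1, -u), (2, 2 * u), (0, 2 * u)] a) ≠ col v) :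
    Fac True (fun v w : (ZMod 4 × ZMod p) × ZMod q =>
      ∃ i, w.1 - v.1 = signed ![((1 : ZMod 4), u), (1, -u), (2, 2 * u), (0, 2 * u)] i) q := by
  have h4 : (4 : ZMod 4) = 0 := by decide
  refine fac_slope_table hq (hq.odd_of_ne_two (by omega)) (w := 5) (by decide) hq' hq'
    [[7, 4, 7, 0, 0], [4, 0, 0, 7, 7], [0, 2, 1, 4, 2], [1, 7, 3, 3, 3], [6, 5, 6, 1, 1],
      [2, 1, 5, 6, 4], [5, 6, 2, 2, 6], [3, 3, 4, 5, 5]] _ hg col hcol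
    (by decide) ?_
  rintro ⟨a, b⟩
  fin_cases a <;> cases b <;> simp [Finset.sum_range_succ, ofTable, signed] <;>
    first | exact ⟨by decide, by ring⟩ | decide | ring

theorem fac_slope_five {p q : ℕ} [NeZero p] (hq : q.Prime) (hq' : 5 ≤ q) (u : ZMod p)
    (hg : Injective (signed ![((1 : ZMod 4), u), (1, -u), (2, 2 * u), (0, 2 * u), (1, 0)]))
    (col : ZMod 4 × ZMod p → Fin 5)
    (hcol : ∀ a v,
      col (v + ![((1 : ZMod 4), u), (1, -u), (2, 2 * u), (0, 2 * u), (1, 0)] a) ≠ col v) :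
    Fac True (fun v w : (ZMod 4 × ZMod p) × ZMod q =>
      ∃ i, w.1 - v.1 = signed ![((1 : ZMod 4), u), (1, -u), (2, 2 * u), (0, 2 * u), (1, 0)] i)
      q := by
  refine fac_slope_table hq (hq.odd_of_ne_two (by omega)) (w := 5) (by decide) hq' hq'
    [[7, 0, 8, 8, 0], [8, 7, 0, 0, 8], [0, 8, 3, 9, 7], [2, 9, 1, 4, 9], [9, 1, 9, 2, 4],
      [1, 4, 6, 7, 1], [6, 6, 7, 1, 2], [5, 2, 2, 6, 6], [4, 5, 5, 3, 3],
      [3, 3, 4, 5, 5]] _ hg col hcol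
    (by decide) ?_
  rintro ⟨a, b⟩
  fin_cases a <;> cases b <;> simp [Finset.sum_range_succ, ofTable, signed] <;>
    first | exact ⟨by decide, by ring⟩ | decide | ring

theorem ep_of_fac_prod {c : Prop} {G P : Type} [Finite G] {p : G → P} {y x q m : ℕ} (hq : 0 < q)
    (hx : 0 < x) (h : Fac c (fun u v : G × ZMod q => p u.1 ≠ p v.1) m)
    (hp : ∀ a, Nat.card {b // p b = p a} = x) (hG : Nat.card G = y * x) : EP c m y (x * q) := by
  have : NeZero q := ⟨hq.ne'⟩
  refine Fac.ep (p := fun u : G × ZMod q => p u.1) h (Nat.mul_pos hx hq) (fun u => ?_) ?_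
  · have e : {v : G × ZMod q // p v.1 = p u.1} ≃ {b // p b = p u.1} × ZMod q :=
      prodSubtypeFstEquivSubtypeProd (p := fun b => p b = p u.1)
    rw [Nat.card_congr e, Nat.card_prod, hp, Nat.card_zmod]
  · rw [Nat.card_prod, hG, Nat.card_zmod, mul_assoc]

theorem ep_three {q : ℕ} (hq : q.Prime) (hq' : 3 ≤ q) : EP True q 3 q := by
  have key := fac_slope_table hq (hq.odd_of_ne_two (by omega)) (w := 3) (by decide) hq' hq'
    [[0, 0, 0], [1, 1, 1]] ![(1 : ZMod 3)] (by decide) (r := 3) (fun v : ZMod 3 => v)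
    (show ∀ (a : Fin 1) (v : ZMod 3), v + ![(1 : ZMod 3)] a ≠ v by decide) (by decide) (by decide)
  have := ep_of_fac_prod (p := fun v : ZMod 3 => v) (y := 3) (x := 1) hq.pos one_pos
    (key.congr (Equiv.refl _) ?_) (by simp) (by simp)
  · rwa [one_mul] at this
  · rintro ⟨u, a⟩ ⟨v, b⟩
    simp only [Equiv.refl_apply]
    revert u v
    decide

/-- A colouring stored in a list. -/
def listColour (l : List ℕ) {n : ℕ} (v : ZMod n) : Fin 5 := Fin.ofNat 5 (l.getD v.val 0)

theorem ep_four {q : ℕ} (hq : q.Prime) (hq' : 5 ≤ q) : EP True q 4 (2 * q) := by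
  have h := fac_slope_add hq hq' (1 : ZMod 8) 2 (by decide)
    (listColour [0, 1, 2, 3, 0, 1, 2, 3]) (by decide)
  refine ep_of_fac_prod (p := fun v : ZMod 8 => v.val % 4) hq.pos two_pos
    (h.congr (Equiv.refl _) ?_) (fun a => ?_) (by simp)
  · rintro ⟨u, a⟩ ⟨v, b⟩
    simp only [Equiv.refl_apply]
    revert u v
    decide +kernel
  · rw [Nat.card_eq_fintype_card]
    revert a
    decide +kernel

theorem ep_six {q : ℕ} (hq : q.Prime) (hq' : 5 ≤ q) : EP True q 6 (2 * q) := by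
  have h₁ := fac_slope_two hq hq' (5 : ZMod 12) (by decide +kernel)
    (listColour [0, 0, 1, 1, 0, 2, 1, 3, 2, 2, 3, 3]) (by decide +kernel)
  have h₂ := fac_slope_add hq hq' (1 : ZMod 12) 3 (by decide +kernel)
    (listColour [0, 1, 0, 1, 2, 3, 2, 0, 1, 4, 3, 2]) (by decide +kernel)
  refine ep_of_fac_prod (p := fun v : ZMod 12 => v.val % 6) hq.pos two_pos
    ((h₁.sup h₂ ?_).congr (Equiv.refl _) ?_) (fun a => ?_) (by simp)
  · rintro ⟨u, a⟩ ⟨v, b⟩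
    simp only
    revert u v
    decide +kernel
  · rintro ⟨u, a⟩ ⟨v, b⟩
    simp only [Equiv.refl_apply]
    revert u v
    decide +kernel
  · rw [Nat.card_eq_fintype_card]
    revert a
    decide +kernel

theorem ep_eight {q : ℕ} (hq : q.Prime) (hq' : 5 ≤ q) : EP True q 8 (2 * q) := by
  have h₁ := fac_slope_two hq hq' (1 : ZMod 16) (by decide +kernel)
    (listColour [0, 1, 2, 0, 1, 2, 0, 1, 2, 0, 1, 2, 0, 1, 2, 3]) (by decide +kernel)
  have h₂ := fac_slope_two hq hq' (3 : ZMod 16) (by decide +kernel)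
    (listColour [0, 0, 0, 1, 1, 1, 2, 2, 2, 0, 3, 3, 1, 4, 4, 2]) (by decide +kernel)
  have h₃ := fac_slope_add hq hq' (5 : ZMod 16) 7 (by decide +kernel)
    (listColour [0, 0, 0, 0, 1, 1, 1, 1, 2, 2, 2, 2, 3, 3, 3, 3]) (by decide +kernel)
  refine ep_of_fac_prod (p := fun v : ZMod 16 => v.val % 8) hq.pos two_pos
    (((h₁.sup h₂ ?_).sup h₃ ?_).congr (Equiv.refl _) ?_) (fun a => ?_) (by simp)
  · rintro ⟨u, a⟩ ⟨v, b⟩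
    simp only
    revert u v
    decide +kernel
  · rintro ⟨u, a⟩ ⟨v, b⟩
    simp only
    revert u v
    decide +kernel
  · rintro ⟨u, a⟩ ⟨v, b⟩
    simp only [Equiv.refl_apply]
    revert u v
    decide +kernel
  · rw [Nat.card_eq_fintype_card]
    revert a
    decide +kernel

theorem ep_seven {q : ℕ} (hq : q.Prime) (hq' : 7 ≤ q) : EP True q 7 q := by
  have key := fac_slope_three hq (by omega) (1 : ZMod 7) (by decide) hq' (fun v : ZMod 7 => v)
    (show ∀ (a : Fin 3) (v : ZMod 7), v + ![(1 : ZMod 7), 2 • 1, 4 • 1] a ≠ v by decide)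
  have := ep_of_fac_prod (p := fun v : ZMod 7 => v) (y := 7) (x := 1) hq.pos one_pos
    (key.congr (Equiv.refl _) ?_) (by simp) (by simp)
  · rwa [one_mul] at this
  · rintro ⟨u, a⟩ ⟨v, b⟩
    simp only [Equiv.refl_apply]
    revert u v
    decide +kernel

theorem exists_colouring_one_two_four {N : ℕ} (hN : 5 ≤ N) (hN' : N ≠ 7) :
    ∃ col : ZMod N → Fin 5, ∀ (d : ℕ) (v : ZMod N), d = 1 ∨ d = 2 ∨ d = 4 →
      col (v + d) ≠ col v := by
  have : NeZero N := ⟨by omega⟩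
  obtain ⟨t, ht⟩ : ∃ t, t = 2 * N % 3 := ⟨_, rfl⟩
  let col : ℕ → ℕ := fun k => if k < 5 * t then k % 5 else (k - 5 * t) % 3
  have hcol : ∀ k, col k < 5 := fun k => by
    simp only [col]
    split_ifs <;> omega
  refine ⟨fun v => ⟨col v.val, hcol _⟩, fun d v hd => ?_⟩
  rw [Ne, Fin.mk.injEq]
  have hd' : d < N := by omega
  have hv := v.val_lt
  have hval : (v + d).val = if v.val + d < N then v.val + d else v.val + d - N := by
    rw [ZMod.val_add, ZMod.val_cast_of_lt hd']
    split_ifs with h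
    · exact Nat.mod_eq_of_lt h
    · rw [Nat.mod_eq_sub_mod (by omega), Nat.mod_eq_of_lt (by omega)]
  rw [hval]
  generalize v.val = k at *
  have hle : 5 * t ≤ N := by
    rcases Nat.lt_or_ge N 10 with h | h
    · subst ht
      interval_cases N <;> simp at *
    · omega
  obtain ⟨s, hs⟩ : ∃ s, N = 3 * s + 5 * t := ⟨(N - 5 * t) / 3, by omega⟩
  have ht3 : t < 3 := by omega
  simp only [col]
  clear hval col hcol ht
  interval_cases t <;> rcases hd with rfl | rfl | rfl <;> split_ifs <;> omega

theorem signed_injective {G κ : Type} [AddCommGroup G] {g : κ → G}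
    (h : ∀ a b, a ≠ b → g a ≠ g b ∧ g a ≠ -g b) (h' : ∀ a, g a ≠ -g a) :
    Injective (signed g) := by
  have h1 : ∀ a b, g a = g b → a = b := fun a b hab => by
    by_contra hne
    exact (h a b hne).1 hab
  have h2 : ∀ a b, g a ≠ -g b := fun a b hab => by
    by_cases hne : a = b
    · subst hne
      exact h' a hab
    · exact (h a b hne).2 hab
  rintro ⟨a, _ | _⟩ ⟨b, _ | _⟩ hab <;> simp only [signed, if_true, Bool.false_eq_true, if_false] at hab
  · rw [h1 a b hab]
  · exact absurd hab (h2 a b)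
  · exact absurd hab.symm (h2 b a)
  · rw [h1 a b (neg_injective hab)]

/-- The elements `± 2 ^ i * a` with `i < L`. -/
def doublingSegment {y : ℕ} (L : ℕ) (a d : ZMod y) : Prop :=
  ∃ i < L, d = 2 ^ i * a ∨ d = -(2 ^ i * a)

theorem fac_doublingSegment {y q : ℕ} (hy : y.Prime) (hy' : 5 ≤ y) (hy7 : y ≠ 7) (hq : q.Prime)
    (hq' : 5 ≤ q) {a : ZMod y} (ha : a ≠ 0) {L : ℕ} (hL : 2 ≤ L)
    (hinj : ∀ i < L, ∀ j < L, i ≠ j → 2 ^ i * a ≠ 2 ^ j * a ∧ 2 ^ i * a ≠ -(2 ^ j * a)) :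
    Fac True (fun u v : ZMod y × ZMod q => doublingSegment L a (v.1 - u.1)) q := by
  have := Fact.mk hy
  have h2 : (2 : ZMod y) ≠ 0 := by
    have := (ZMod.natCast_eq_zero_iff 2 y).not.2 fun h => by
      have := Nat.le_of_dvd two_pos h
      omega
    exact_mod_cast this
  have hne : ∀ i, 2 ^ i * a ≠ 0 := fun i => mul_ne_zero (pow_ne_zero _ h2) ha
  have hself : ∀ i, 2 ^ i * a ≠ -(2 ^ i * a) := fun i h => by
    rw [eq_neg_iff_add_eq_zero, ← two_mul] at h
    exact mul_ne_zero h2 (hne i) h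
  obtain ⟨col, hcol⟩ := exists_colouring_one_two_four hy' hy7
  have hcol' : ∀ (s v : ZMod y) (d : ℕ), s ≠ 0 → d = 1 ∨ d = 2 ∨ d = 4 →
      col (s⁻¹ * (v + d • s)) ≠ col (s⁻¹ * v) := by
    intro s v d hs hd
    have : s⁻¹ * (v + d • s) = s⁻¹ * v + d := by
      rw [nsmul_eq_mul]
      field_simp
    rw [this]
    exact hcol d _ hd
  have two : ∀ i, (2 ^ i * a ≠ 2 ^ (i + 1) * a ∧ 2 ^ i * a ≠ -(2 ^ (i + 1) * a)) →
      Fac True (fun u v : ZMod y × ZMod q =>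
        ∃ j, v.1 - u.1 = signed ![2 ^ i * a, 2 • (2 ^ i * a)] j) q := by
    intro i hi
    have e : 2 • (2 ^ i * a) = 2 ^ (i + 1) * a := by rw [nsmul_eq_mul]; push_cast; ring
    refine fac_slope_two hq hq' _ ?_ (fun v => col ((2 ^ i * a)⁻¹ * v)) ?_
    · rw [e]
      refine signed_injective ?_ ?_
      · simp only [Fin.forall_fin_two]
        simp [hi.1, hi.1.symm, hi.2]
        exact fun h => hi.2 (by rw [h, neg_neg])
      · simp only [Fin.forall_fin_two]
        simpa using ⟨hself i, hself (i + 1)⟩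
    · simp only [Fin.forall_fin_two]
      exact ⟨fun v => by simpa using hcol' _ v 1 (hne i) (by simp),
        fun v => by simpa using hcol' _ v 2 (hne i) (by simp)⟩
  have hsigned : ∀ i d, (∃ j, d = signed ![2 ^ i * a, 2 • (2 ^ i * a)] j) ↔
      (d = 2 ^ i * a ∨ d = -(2 ^ i * a)) ∨ (d = 2 ^ (i + 1) * a ∨ d = -(2 ^ (i + 1) * a)) := by
    intro i d
    have e : 2 • (2 ^ i * a) = 2 ^ (i + 1) * a := by rw [nsmul_eq_mul]; push_cast; ring
    rw [e]
    simp [Prod.exists, Fin.exists_fin_two, signed]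
  have hsucc : ∀ L d, doublingSegment (L + 1) a d ↔
      doublingSegment L a d ∨ (d = 2 ^ L * a ∨ d = -(2 ^ L * a)) := by
    intro L d
    simp only [doublingSegment, Nat.lt_succ_iff_lt_or_eq, or_and_right, exists_or, exists_eq_left]
  induction L using Nat.strong_induction_on with
  | _ L ih =>
    obtain rfl | rfl | ⟨L, rfl, hL'⟩ : L = 2 ∨ L = 3 ∨ ∃ M, L = M + 2 ∧ 2 ≤ M := by
      rcases Nat.lt_or_ge L 4 with h | h
      · omega
      · exact Or.inr (Or.inr ⟨L - 2, by omega, by omega⟩)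
    · refine (two 0 (hinj 0 (by omega) 1 (by omega) (by omega))).congr (Equiv.refl _) fun u v => ?_
      rw [hsigned, hsucc, hsucc]
      simp [doublingSegment]
    · have e2 : 2 • a = 2 ^ 1 * a := by rw [nsmul_eq_mul]; push_cast; ring
      have e4 : 4 • a = 2 ^ 2 * a := by rw [nsmul_eq_mul]; push_cast; ring
      have h := fac_slope_three hq hq' a ?_ hq' (fun v => col (a⁻¹ * v)) ?_
      · refine h.congr (Equiv.refl _) fun u v => ?_
        rw [e2, e4, hsucc, hsucc, hsucc]
        simp [doublingSegment, Prod.exists, Fin.exists_fin_succ, signed]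
        tauto
      · rw [e2, e4]
        have h01 := hinj 0 (by omega) 1 (by omega) (by omega)
        have h02 := hinj 0 (by omega) 2 (by omega) (by omega)
        have h12 := hinj 1 (by omega) 2 (by omega) (by omega)
        have h10 := hinj 1 (by omega) 0 (by omega) (by omega)
        have h20 := hinj 2 (by omega) 0 (by omega) (by omega)
        have h21 := hinj 2 (by omega) 1 (by omega) (by omega)
        rw [pow_zero, one_mul] at *
        refine signed_injective ?_ ?_
        · intro i j hij
          fin_cases i <;> fin_cases j <;> first | exact absurd rfl hij | assumption
        · have h0 := hself 0
          rw [pow_zero, one_mul] at h0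
          intro i
          fin_cases i <;> [exact h0; exact hself 1; exact hself 2]
      · intro i v
        fin_cases i
        · simpa using hcol' a v 1 ha (by simp)
        · exact hcol' a v 2 ha (by simp)
        · exact hcol' a v 4 ha (by simp)
    · refine ((ih L (by omega) hL' fun i hi j hj => hinj i (by omega) j (by omega)).sup
        (two L (hinj L (by omega) (L + 1) (by omega) (by omega))) ?_).congr (Equiv.refl _) ?_
      · rintro u v ⟨i, hi, hd⟩ h
        rw [hsigned] at h
        have h1 := hinj i (by omega) L (by omega) (by omega)
        have h2 := hinj i (by omega) (L + 1) (by omega) (by omega)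
        rcases hd with hd | hd <;> rw [hd] at h <;> rcases h with (h | h) | (h | h)
        · exact h1.1 h
        · exact h1.2 h
        · exact h2.1 h
        · exact h2.2 h
        · exact h1.2 (by rw [← h, neg_neg])
        · exact h1.1 (neg_injective h)
        · exact h2.2 (by rw [← h, neg_neg])
        · exact h2.1 (neg_injective h)
      · intro u v
        rw [hsigned, show L + 2 = L + 1 + 1 from rfl, hsucc, hsucc]
        exact or_assoc

theorem ep_prime {y q : ℕ} (hy : y.Prime) (hy' : 5 ≤ y) (hy7 : y ≠ 7) (hq : q.Prime)
    (hq' : 5 ≤ q) : EP True q y q := by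
  classical
  have := Fact.mk hy
  have hlt : ∀ n : ℕ, 0 < n → n < 5 → (n : ZMod y) ≠ 0 := fun n h0 h5 h => by
    have := Nat.le_of_dvd h0 ((ZMod.natCast_eq_zero_iff n y).1 h)
    omega
  have h2 : (2 : ZMod y) ≠ 0 := by exact_mod_cast hlt 2 (by omega) (by omega)
  have hex : ∃ L, 0 < L ∧ ((2 : ZMod y) ^ L = 1 ∨ (2 : ZMod y) ^ L = -1) :=
    ⟨y - 1, by omega, Or.inl (ZMod.pow_card_sub_one_eq_one h2)⟩
  obtain ⟨L, hL⟩ : ∃ L, L = Nat.find hex := ⟨_, rfl⟩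
  obtain ⟨hL0, hLpow⟩ := hL ▸ Nat.find_spec hex
  have hmin : ∀ i, 0 < i → i < L → (2 : ZMod y) ^ i ≠ 1 ∧ (2 : ZMod y) ^ i ≠ -1 := fun i hi hiL => by
    have := Nat.find_min hex (hL ▸ hiL)
    tauto
  have hL2 : 2 ≤ L := by
    by_contra h
    obtain rfl : L = 1 := by omega
    rw [pow_one] at hLpow
    rcases hLpow with h | h
    · exact hlt 1 (by omega) (by omega) (by push_cast; linear_combination h)
    · exact hlt 3 (by omega) (by omega) (by push_cast; linear_combination h)
  have hred : ∀ n, ∃ i < L, (2 : ZMod y) ^ n = 2 ^ i ∨ (2 : ZMod y) ^ n = -2 ^ i := by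
    intro n
    induction n with
    | zero => exact ⟨0, hL0, Or.inl rfl⟩
    | succ n ih =>
      obtain ⟨i, hi, h⟩ := ih
      rcases Nat.lt_or_ge (i + 1) L with hi' | hi'
      · refine ⟨i + 1, hi', h.imp (fun h => ?_) fun h => ?_⟩ <;> rw [pow_succ, h] <;> ring
      · obtain rfl : L = i + 1 := by omega
        refine ⟨0, by omega, ?_⟩
        rw [pow_succ] at hLpow ⊢
        rcases h with h | h <;> rcases hLpow with h' | h' <;> simp [h, h']
  have hseg : ∀ a d : ZMod y, doublingSegment L a d ↔ ∃ n, d = 2 ^ n * a ∨ d = -(2 ^ n * a) := by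
    intro a d
    refine ⟨fun ⟨i, _, h⟩ => ⟨i, h⟩, fun ⟨n, h⟩ => ?_⟩
    obtain ⟨i, hi, hi'⟩ := hred n
    refine ⟨i, hi, ?_⟩
    rcases hi' with e | e <;> rw [e] at h <;> [exact h; (rw [neg_mul, neg_neg] at h; exact h.symm)]
  have hinj : ∀ a : ZMod y, a ≠ 0 → ∀ i < L, ∀ j < L, i ≠ j →
      2 ^ i * a ≠ 2 ^ j * a ∧ 2 ^ i * a ≠ -(2 ^ j * a) := by
    have key : ∀ a : ZMod y, a ≠ 0 → ∀ i j, j < L → i < j →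
        2 ^ i * a ≠ 2 ^ j * a ∧ 2 ^ i * a ≠ -(2 ^ j * a) := by
      intro a ha i j hj hij
      obtain ⟨k, rfl⟩ := Nat.exists_eq_add_of_lt hij
      have hne : (2 : ZMod y) ^ i * a ≠ 0 := mul_ne_zero (pow_ne_zero _ h2) ha
      have hk := hmin (k + 1) (by omega) (by omega)
      refine ⟨fun h => hk.1 (mul_left_cancel₀ hne ?_), fun h => hk.2 (mul_left_cancel₀ hne ?_)⟩
      · rw [mul_one]
        nth_rw 2 [h]
        ring
      · rw [mul_neg, mul_one]
        nth_rw 2 [h]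
        ring
    intro a ha i hi j hj hij
    rcases lt_or_gt_of_ne hij with h | h
    · exact key a ha i j hj h
    · have := key a ha j i hi h
      exact ⟨this.1.symm, fun e => this.2 (by rw [e, neg_neg])⟩
  let s : Setoid {a : ZMod y // a ≠ 0} :=
    { r := fun a b => doublingSegment L a.1 b.1
      iseqv :=
        { refl := fun a => (hseg _ _).2 ⟨0, Or.inl (by simp)⟩
          symm := fun {a b} h => by
            obtain ⟨i, hi, h⟩ := h
            refine (hseg _ _).2 ⟨L - i, ?_⟩
            have e : (2 : ZMod y) ^ (L - i) * (2 ^ i * a.1) = 2 ^ L * a.1 := by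
              rw [← mul_assoc, ← pow_add, Nat.sub_add_cancel hi.le]
            rcases h with h | h <;> rcases hLpow with h' | h' <;> rw [h'] at e <;> rw [h]
            · exact Or.inl (by rw [e, one_mul])
            · exact Or.inr (by rw [e]; ring)
            · exact Or.inr (by rw [mul_neg, e]; ring)
            · exact Or.inl (by rw [mul_neg, e]; ring)
          trans := fun {a b c} hab hbc => by
            obtain ⟨i, h⟩ := (hseg _ _).1 hab
            obtain ⟨j, h'⟩ := (hseg _ _).1 hbc
            refine (hseg _ _).2 ⟨j + i, ?_⟩
            rcases h with h | h <;> rcases h' with h' | h' <;> rw [h', h, pow_add]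
            · exact Or.inl (by ring)
            · exact Or.inr (by ring)
            · exact Or.inr (by ring)
            · exact Or.inl (by ring) } }
  have hmain : Fac True (fun u v : ZMod y × ZMod q =>
      ∃ c : Quotient s, doublingSegment L c.out.1 (v.1 - u.1)) q := by
    refine Fac.iUnion (A := fun (c : Quotient s) (u v : ZMod y × ZMod q) =>
      doublingSegment L c.out.1 (v.1 - u.1)) (fun c c' u v h h' => ?_) fun c => ?_
    · have hne : v.1 - u.1 ≠ 0 := by
        obtain ⟨i, _, h⟩ := h
        have := mul_ne_zero (pow_ne_zero i h2) c.out.2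
        rcases h with h | h <;> rw [h]
        · exact this
        · exact neg_ne_zero.2 this
      rw [← Quotient.out_eq c, ← Quotient.out_eq c']
      exact Quotient.sound (s.trans (b := ⟨v.1 - u.1, hne⟩) h (s.symm h'))
    · exact fac_doublingSegment hy hy' hy7 hq hq' c.out.2 hL2 (hinj _ c.out.2)
  have := ep_of_fac_prod (p := fun v : ZMod y => v) (y := y) (x := 1) hq.pos one_pos
    (hmain.congr (Equiv.refl _) fun u v => ?_) (by simp) (by simp)
  · rwa [one_mul] at this
  · simp only [Equiv.refl_apply]
    constructor
    · intro h
      exact ⟨_, Quotient.mk_out (s := s) ⟨v.1 - u.1, sub_ne_zero.2 (Ne.symm h)⟩⟩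
    · rintro ⟨c, i, _, h⟩ e
      have hne := mul_ne_zero (pow_ne_zero i h2) c.out.2
      rw [e, sub_self] at h
      rcases h with h | h
      · exact hne h.symm
      · exact hne (neg_eq_zero.1 h.symm)

theorem val_add_one_of_ne {p : ℕ} [NeZero p] {z : ZMod p} (h : z + 1 ≠ 0) :
    (z + 1).val = z.val + 1 := by
  have hz := z.val_lt
  have hlt : z.val + 1 < p := by
    by_contra h'
    refine h ?_
    have e : z.val + 1 = p := by omega
    have := congrArg (Nat.cast : ℕ → ZMod p) e
    rwa [Nat.cast_add, ZMod.natCast_zmod_val, Nat.cast_one, ZMod.natCast_self] at this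
  have : z + 1 = ((z.val + 1 : ℕ) : ZMod p) := by rw [Nat.cast_add, ZMod.natCast_zmod_val, Nat.cast_one]
  rw [this, ZMod.val_cast_of_lt hlt]

theorem exists_colouring_four_mul {p : ℕ} (hp : p.Prime) (hp' : 5 ≤ p) {u : ZMod p} (hu : u ≠ 0) :
    ∃ col : ZMod 4 × ZMod p → Fin 5, ∀ a v,
      col (v + ![((1 : ZMod 4), u), (1, -u), (2, 2 * u), (0, 2 * u), (1, 0)] a) ≠ col v := by
  have := Fact.mk hp
  have hlt : ∀ n : ℕ, 0 < n → n < 5 → (n : ZMod p) ≠ 0 := fun n h0 h5 h => by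
    have := Nat.le_of_dvd h0 ((ZMod.natCast_eq_zero_iff n p).1 h)
    omega
  have h2 : (2 : ZMod p) ≠ 0 := by exact_mod_cast hlt 2 (by omega) (by omega)
  have h3 : (3 : ZMod p) ≠ 0 := by exact_mod_cast hlt 3 (by omega) (by omega)
  let f : ZMod p → Fin 5 := fun z => if z = 0 then 4 else if z.val % 2 = 0 then 0 else 1
  let g : ZMod p → Fin 5 := fun z => if z - 1 = 0 then 4 else if (z - 1).val % 2 = 0 then 2 else 3
  have hf : ∀ z, f (z + 1) ≠ f z := by
    intro z
    simp only [f]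
    by_cases h : z + 1 = 0
    · have : z ≠ 0 := fun h' => by simp [h'] at h
      rw [if_pos h, if_neg this]
      split_ifs <;> decide
    · rw [if_neg h, val_add_one_of_ne h]
      split_ifs <;> first | decide | omega
  have hg : ∀ z, g (z + 1) ≠ g z := by
    intro z
    have e : z + 1 - 1 = z - 1 + 1 := by ring
    simp only [g]
    rw [e]
    generalize z - 1 = z
    by_cases h : z + 1 = 0
    · have : z ≠ 0 := fun h' => by simp [h'] at h
      rw [if_pos h, if_neg this]
      split_ifs <;> decide
    · rw [if_neg h, val_add_one_of_ne h]
      split_ifs <;> first | decide | omega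
  have hfg : ∀ z z', z' - z ≠ 1 → f z ≠ g z' := by
    intro z z' h
    simp only [f, g]
    split_ifs with h1 h2 <;> first | decide | skip
    exact absurd (by rw [h1, sub_zero]; exact sub_eq_zero.1 h2) h
  refine ⟨fun v => if v.1.val % 2 = 0 then f ((2 * u)⁻¹ * v.2) else g ((2 * u)⁻¹ * v.2), ?_⟩
  have hodd : ∀ w : ZMod 4, (w + 1).val % 2 = 0 ↔ ¬ w.val % 2 = 0 := by decide
  have heven : ∀ w : ZMod 4, (w + 2).val % 2 = 0 ↔ w.val % 2 = 0 := by decide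
  have hhalf : (2 * u)⁻¹ * u = 2⁻¹ := by field_simp
  have hone : (2 * u)⁻¹ * (2 * u) = 1 := inv_mul_cancel₀ (mul_ne_zero h2 hu)
  have one_ne_half : (2⁻¹ : ZMod p) ≠ 1 := fun h => by
    field_simp at h
    exact one_ne_zero (by linear_combination -h)
  have neg_half : -(2⁻¹ : ZMod p) ≠ 1 := fun h => by
    field_simp at h
    exact h3 (by linear_combination -h)
  generalize (2 * u)⁻¹ = c at *
  rintro a ⟨w, z⟩
  fin_cases a
  all_goals
    by_cases h : w.val % 2 = 0 <;>
    simp [hodd, heven, h, mul_add, hone, hhalf, hf, hg]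
  all_goals first | apply hfg | (apply Ne.symm; apply hfg)
  all_goals simp [one_ne_half, neg_half]

/-- The differences covered by the slopes attached to `u`. -/
def slopeDiff {p : ℕ} (u : ZMod p) (d : ZMod 4 × ZMod p) : Prop :=
  if d.1.val % 2 = 0 then d.2 = 2 * u ∨ d.2 = -(2 * u) else d.2 = u ∨ d.2 = -u

theorem exists_eq_signed_slopeDiff {p : ℕ} (u : ZMod p) (d : ZMod 4 × ZMod p) :
    (∃ i, d = signed ![((1 : ZMod 4), u), (1, -u), (2, 2 * u), (0, 2 * u)] i) ↔
      slopeDiff u d := by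
  obtain ⟨w, z⟩ := d
  have hw : (w.val % 2 = 0 ∧ (w = 0 ∨ w = 2) ∧ w ≠ 1 ∧ w ≠ -1) ∨
      (w.val % 2 ≠ 0 ∧ (w = 1 ∨ w = -1) ∧ w ≠ 0 ∧ w ≠ 2) := by
    revert w
    decide
  have h2 : (-2 : ZMod 4) = 2 := by decide
  simp only [Prod.exists, Fin.exists_fin_succ, signed, slopeDiff]
  rcases hw with ⟨h, hw, h', h''⟩ | ⟨h, hw, h', h''⟩ <;>
    rcases hw with rfl | rfl <;> simp [*] <;> tauto

theorem exists_eq_signed_slopeDiff_or {p : ℕ} (u : ZMod p) (d : ZMod 4 × ZMod p) :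
    (∃ i, d = signed ![((1 : ZMod 4), u), (1, -u), (2, 2 * u), (0, 2 * u), (1, 0)] i) ↔
      slopeDiff u d ∨ (d.2 = 0 ∧ d.1.val % 2 ≠ 0) := by
  rw [← exists_eq_signed_slopeDiff]
  have h3 : ∀ w : ZMod 4, w.val % 2 = 1 ↔ w = 1 ∨ w = -1 := by decide
  obtain ⟨w, z⟩ := d
  have h4 : z = 0 ∧ (w = 1 ∨ w = -1) ↔ (w = 1 ∧ z = 0) ∨ (w = -1 ∧ z = 0) := by tauto
  simp [Prod.exists, Fin.exists_fin_succ, signed, h3, h4, or_assoc]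

theorem ep_two_mul_prime {p q : ℕ} (hp : p.Prime) (hp' : 5 ≤ p) (hq : q.Prime) (hq' : 5 ≤ q) :
    EP True q (2 * p) (2 * q) := by
  have := Fact.mk hp
  have hlt : ∀ n : ℕ, 0 < n → n < 5 → (n : ZMod p) ≠ 0 := fun n h0 h5 h => by
    have := Nat.le_of_dvd h0 ((ZMod.natCast_eq_zero_iff n p).1 h)
    omega
  have h2 : (2 : ZMod p) ≠ 0 := by exact_mod_cast hlt 2 (by omega) (by omega)
  have hself : ∀ u : ZMod p, u ≠ 0 → u ≠ -u := fun u hu h =>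
    mul_ne_zero h2 hu (by linear_combination h)
  have hinj : ∀ u : ZMod p, u ≠ 0 →
      Injective (signed ![((1 : ZMod 4), u), (1, -u), (2, 2 * u), (0, 2 * u), (1, 0)]) := by
    intro u hu
    have h1 := hself u hu
    have h3 := hself (2 * u) (mul_ne_zero h2 hu)
    have h4 : (1 : ZMod 4) ≠ -1 := by decide
    have h5 : (1 : ZMod 4) ≠ 2 := by decide
    have h6 : (1 : ZMod 4) ≠ -2 := by decide
    have h7 : (2 : ZMod 4) ≠ 0 := by decide
    have h8 : (-1 : ZMod 4) ≠ 2 := by decide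
    have h9 : (1 : ZMod 4) ≠ 0 := by decide
    refine signed_injective ?_ ?_
    · intro a b hab
      fin_cases a <;> fin_cases b <;> first | exact absurd rfl hab | skip
      all_goals simp [*, h5.symm, h7.symm, h8.symm, h9.symm, h1.symm, hu.symm]
    · intro a
      fin_cases a
      all_goals simp [*, h1.symm]
  have hS : ∀ u : ZMod p, u ≠ 0 →
      Fac True (fun v w : (ZMod 4 × ZMod p) × ZMod q => slopeDiff u (w.1 - v.1)) q := by
    intro u hu
    obtain ⟨col, hcol⟩ := exists_colouring_four_mul hp hp' hu
    have hsub : ∀ a : Fin 4, ![((1 : ZMod 4), u), (1, -u), (2, 2 * u), (0, 2 * u)] a =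
        ![((1 : ZMod 4), u), (1, -u), (2, 2 * u), (0, 2 * u), (1, 0)] a.castSucc := by
      intro a
      fin_cases a <;> rfl
    refine (fac_slope_four hq hq' u ?_ col fun a v => ?_).congr (Equiv.refl _) fun v w => ?_
    · intro a b hab
      have := @hinj u hu (a.1.castSucc, a.2) (b.1.castSucc, b.2)
      simp only [signed, ← hsub] at this
      have := this hab
      simp only [Prod.mk.injEq, Fin.castSucc_inj] at this
      exact Prod.ext this.1 this.2
    · rw [hsub]
      exact hcol _ v
    · exact (exists_eq_signed_slopeDiff u _).symm
  have hS1 : Fac True (fun v w : (ZMod 4 × ZMod p) × ZMod q => slopeDiff 1 (w.1 - v.1) ∨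
      ((w.1 - v.1).2 = 0 ∧ (w.1 - v.1).1.val % 2 ≠ 0)) q := by
    obtain ⟨col, hcol⟩ := exists_colouring_four_mul hp hp' one_ne_zero
    refine (fac_slope_five hq hq' 1 (hinj 1 one_ne_zero) col hcol).congr (Equiv.refl _)
      fun v w => ?_
    exact (exists_eq_signed_slopeDiff_or 1 _).symm
  let I := {u : ZMod p // u ≠ 0 ∧ 2 * u.val < p}
  have huniq : ∀ (a b : I), a.1 = b.1 ∨ a.1 = -b.1 → a = b := by
    rintro ⟨a, ha, ha'⟩ ⟨b, hb, hb'⟩ (h | h)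
    · exact Subtype.ext h
    · have : NeZero b := ⟨hb⟩
      simp only at h
      rw [h, ZMod.val_neg_of_ne_zero] at ha'
      omega
  have hex : ∀ z : ZMod p, z ≠ 0 → ∃ u : I, z = u.1 ∨ z = -u.1 := by
    intro z hz
    rcases Nat.lt_or_ge (2 * z.val) p with h | h
    · exact ⟨⟨z, hz, h⟩, Or.inl rfl⟩
    · have : NeZero z := ⟨hz⟩
      refine ⟨⟨-z, neg_ne_zero.2 hz, ?_⟩, Or.inr (neg_neg z).symm⟩
      have hodd := hp.eq_two_or_odd
      rw [ZMod.val_neg_of_ne_zero]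
      omega
  let o : I := ⟨1, one_ne_zero, by
    have : Fact (1 < p) := ⟨by omega⟩
    rw [ZMod.val_one]
    omega⟩
  have hmain : Fac True (fun v w : (ZMod 4 × ZMod p) × ZMod q => ∃ u : I,
      slopeDiff u.1 (w.1 - v.1) ∨ (u = o ∧ ((w.1 - v.1).2 = 0 ∧ (w.1 - v.1).1.val % 2 ≠ 0))) q := by
    refine Fac.iUnion (A := fun (u : I) (v w : (ZMod 4 × ZMod p) × ZMod q) =>
      slopeDiff u.1 (w.1 - v.1) ∨ (u = o ∧ ((w.1 - v.1).2 = 0 ∧ (w.1 - v.1).1.val % 2 ≠ 0)))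
      (fun a b v w ha hb => ?_) fun u => ?_
    · have hne : ∀ u : I, ∀ d : ZMod 4 × ZMod p, slopeDiff u.1 d → d.2 ≠ 0 := by
        intro u d h
        have h0 := u.2.1
        have h2' := mul_ne_zero h2 u.2.1
        unfold slopeDiff at h
        split_ifs at h <;> rcases h with h | h <;> rw [h] <;> simpa [h2] using h0
      rcases ha with ha | ⟨rfl, ha⟩ <;> rcases hb with hb | ⟨rfl, hb⟩
      · apply huniq
        unfold slopeDiff at ha hb
        split_ifs at ha hb
        · rcases ha with ha | ha <;> rw [ha] at hb <;> rcases hb with hb | hb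
          · exact Or.inl (mul_left_cancel₀ h2 hb)
          · exact Or.inr (mul_left_cancel₀ h2 (by rw [hb, mul_neg]))
          · exact Or.inr (mul_left_cancel₀ h2 (by rw [mul_neg, ← hb, neg_neg]))
          · exact Or.inl (mul_left_cancel₀ h2 (neg_injective hb))
        · rcases ha with ha | ha <;> rw [ha] at hb <;> rcases hb with hb | hb
          · exact Or.inl hb
          · exact Or.inr hb
          · exact Or.inr (by rw [← hb, neg_neg])
          · exact Or.inl (neg_injective hb)
      · exact absurd hb.1 (hne _ _ ha)
      · exact absurd ha.1 (hne _ _ hb)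
      · rfl
    · by_cases hu : u = o
      · subst hu
        simpa using hS1
      · simpa [hu] using hS u.1 u.2.1
  have hcard : ∀ w : ZMod 4, Nat.card {b : ZMod 4 // b.val % 2 = w.val % 2} = 2 := by
    intro w
    rw [Nat.card_eq_fintype_card]
    revert w
    decide
  refine ep_of_fac_prod (p := fun v : ZMod 4 × ZMod p => (v.1.val % 2, v.2)) hq.pos two_pos
    (hmain.congr (Equiv.refl _) fun v w => ?_) (fun a => ?_) ?_
  · have hpar : ∀ a b : ZMod 4, a.val % 2 = b.val % 2 ↔ (b - a).val % 2 = 0 := by decide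
    obtain ⟨v, v'⟩ := v
    obtain ⟨w, w'⟩ := w
    simp only [Equiv.refl_apply, Ne, Prod.mk.injEq, hpar, not_and]
    have e : v.2 = w.2 ↔ (w - v).2 = 0 := by rw [Prod.snd_sub, sub_eq_zero, eq_comm]
    rw [e, ← Prod.fst_sub]
    generalize w - v = d
    by_cases hd : d.1.val % 2 = 0
    · simp only [slopeDiff, hd, if_true, not_true, and_false, or_false, true_imp_iff]
      constructor
      · intro hd
        obtain ⟨u, hu⟩ := hex (2⁻¹ * d.2) (mul_ne_zero (inv_ne_zero h2) hd)
        refine ⟨u, hu.imp (fun hu => ?_) fun hu => ?_⟩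
        · rw [← hu, mul_inv_cancel_left₀ h2]
        · rw [← mul_neg, ← hu, mul_inv_cancel_left₀ h2]
      · rintro ⟨u, hu⟩
        have h0 := u.2.1
        rcases hu with h | h <;> rw [h] <;> simpa [h2] using h0
    · simp only [slopeDiff, hd, if_false, false_imp_iff, not_false_iff, and_true, true_iff]
      by_cases hd' : d.2 = 0
      · exact ⟨o, Or.inr ⟨rfl, hd'⟩⟩
      · obtain ⟨u, hu⟩ := hex d.2 hd'
        exact ⟨u, Or.inl hu⟩
  · have e : {b : ZMod 4 × ZMod p // (b.1.val % 2, b.2) = (a.1.val % 2, a.2)} ≃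
        {b : ZMod 4 // b.val % 2 = a.1.val % 2} :=
      { toFun := fun b => ⟨b.1.1, (Prod.ext_iff.1 b.2).1⟩
        invFun := fun b => ⟨(b.1, a.2), Prod.ext b.2 rfl⟩
        left_inv := fun b => Subtype.ext (Prod.ext rfl (Prod.ext_iff.1 b.2).2.symm)
        right_inv := fun b => rfl }
    rw [Nat.card_congr e, hcard]
  · rw [Nat.card_prod, Nat.card_zmod, Nat.card_zmod]
    ring

/-- The entry of index `v` in a table of numbers below `128` packed into a number. -/
def entry (T v : ℕ) : ℕ := T / 128 ^ v % 128

/-- The set of out- and in-neighbours of `u`, as a bit mask. -/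
def neighbourMask (m : ℕ) (hole : ℕ → ℕ → Bool) (u : ℕ) (ts : List (ℕ × ℕ)) : ℕ :=
  ts.foldr (fun T M => if hole T.2 u then M else
    M ||| 2 ^ entry T.1 u ||| 2 ^ (entry T.1)^[m - 1] u) 0

/-- A test that successor tables form a factorization of a complete multipartite graph
into `m`-cycle factors with prescribed holes. -/
def checkFactors (m N : ℕ) (hole : ℕ → ℕ → Bool) (part : ℕ → ℕ) (ts : List ℕ) : Bool :=
  (ts.zipIdx.all fun T => (List.range N).all fun v => hole T.2 v ||
    (decide (entry T.1 v < N) && (entry T.1 v != v) && !hole T.2 (entry T.1 v) &&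
      ((entry T.1)^[m] v == v))) &&
  (List.range N).all fun u => (List.range N).all fun v =>
    part v == part u || (neighbourMask m hole u ts.zipIdx).testBit v

theorem exists_of_testBit_neighbourMask {m : ℕ} {hole : ℕ → ℕ → Bool} {u v : ℕ}
    {ts : List (ℕ × ℕ)} (h : (neighbourMask m hole u ts).testBit v = true) :
    ∃ T ∈ ts, hole T.2 u = false ∧ (entry T.1 u = v ∨ (entry T.1)^[m - 1] u = v) := by
  induction ts with
  | nil => simp [neighbourMask] at h
  | cons T ts ih =>
    simp only [neighbourMask, List.foldr_cons] at h ih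
    by_cases hT : hole T.2 u = true
    · rw [if_pos hT] at h
      obtain ⟨T', h', h''⟩ := ih h
      exact ⟨T', List.mem_cons_of_mem _ h', h''⟩
    · rw [if_neg hT, Nat.testBit_or, Nat.testBit_or, Bool.or_eq_true, Bool.or_eq_true,
        Nat.testBit_two_pow, Nat.testBit_two_pow, decide_eq_true_eq, decide_eq_true_eq,
        or_assoc] at h
      rcases h with h | h
      · obtain ⟨T', h', h''⟩ := ih h
        exact ⟨T', List.mem_cons_of_mem _ h', h''⟩
      · exact ⟨T, List.mem_cons_self, by simpa using hT, h⟩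

theorem exists_pairedFactors_of_check {m N k : ℕ} (hm : m.Prime) {hole : ℕ → ℕ → Bool}
    {part : ℕ → ℕ} {ts : List ℕ} (hlen : ts.length = k)
    (hcheck : checkFactors m N hole part ts = true)
    (hcard : ∀ u : Fin N, Nat.card {v : Fin N // part v ≠ part u} =
      2 * Nat.card {i : Fin k // hole i u = false}) :
    Nonempty (PairedFactors True (fun (i : Fin k) (v : Fin N) => hole i v = true)
      (fun u v : Fin N => part u ≠ part v) m) := by
  subst hlen
  simp only [checkFactors, Bool.and_eq_true, List.all_eq_true, List.mem_range, Bool.or_eq_true,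
    decide_eq_true_eq, bne_iff_ne, Bool.not_eq_true', beq_iff_eq] at hcheck
  obtain ⟨hval, hcov⟩ := hcheck
  have hval' : ∀ (i : Fin ts.length) (v : Fin N), hole i v = false →
      entry ts[i] v < N ∧ entry ts[i] v ≠ v ∧ hole i (entry ts[i] v) = false ∧
        (entry ts[i])^[m] v = v := by
    intro i v h
    have := hval (ts[i], i) (List.mk_mem_zipIdx_iff_getElem?.2 (by simp)) v v.2
    simp only [h, Bool.false_eq_true, false_or] at this
    tauto
  let F : Fin ts.length → Fin N → Fin N := fun i v =>
    if h : hole i v = true then v else ⟨entry ts[i] v, (hval' i v (by simpa using h)).1⟩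
  have hFhole : ∀ (i : Fin ts.length) (v : Fin N), hole i v = true → F i v = v := fun i v h => dif_pos h
  have hFval : ∀ (i : Fin ts.length) (v : Fin N), hole i v = false → (F i v : ℕ) = entry ts[i] v := fun i v h => by
    simp only [F]
    rw [dif_neg (by simp [h])]
  have hFn : ∀ (i : Fin ts.length) (v : Fin N), hole i v = false → ∀ n, hole i ((F i)^[n] v) = false ∧
      ((F i)^[n] v : ℕ) = (entry ts[i])^[n] v := by
    intro i v h n
    induction n with
    | zero => exact ⟨h, rfl⟩
    | succ n ih =>
      rw [iterate_succ_apply', iterate_succ_apply', hFval _ _ ih.1, ih.2]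
      refine ⟨?_, rfl⟩
      rw [← ih.2]
      exact (hval' i _ ih.1).2.2.1
  have hFm : ∀ (i : Fin ts.length) (v : Fin N), (F i)^[m] v = v := by
    intro i v
    by_cases h : hole i v = true
    · exact iterate_fixed (hFhole i v h) m
    · have h : hole i v = false := by simpa using h
      exact Fin.ext (((hFn i v h m).2).trans (hval' i v h).2.2.2)
  have hm1 : m - 1 + 1 = m := Nat.sub_add_cancel hm.one_le
  let D : Fin ts.length → Perm (Fin N) := fun i =>
    { toFun := F i
      invFun := (F i)^[m - 1]
      left_inv := fun v => by rw [← iterate_succ_apply, Nat.succ_eq_add_one, hm1, hFm]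
      right_inv := fun v => by rw [← iterate_succ_apply' (F i), Nat.succ_eq_add_one, hm1, hFm] }
  have hperiod : ∀ (i : Fin ts.length) (v : Fin N), hole i v = false → minimalPeriod (D i) v = m := by
    intro i v h
    have := Fact.mk hm
    refine minimalPeriod_eq_prime (hFm i v) fun h' => (hval' i v h).2.1 ?_
    rw [← hFval i v h]
    exact congrArg Fin.val h'
  choose χ hχ using fun i => exists_colouring (D i) hm.two_le
  have hinv : ∀ (i : Fin ts.length) (v : Fin N), (D i)⁻¹ v = (F i)^[m - 1] v := fun i v => rfl
  have hholeinv : ∀ (i : Fin ts.length) (v : Fin N), hole i v = false → hole i ((D i)⁻¹ v : Fin N) = false :=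
    fun i v h => by rw [hinv]; exact (hFn i v h _).1
  have hbij := fun u : Fin N => bijective_of_cover
    (f := fun j : {i : Fin ts.length // hole i u = false} × Bool =>
      if j.2 = true then (D j.1)⁻¹ u else D j.1 u) (S := fun v => part v ≠ part u) (by
        rw [Nat.card_prod, hcard, Nat.card_eq_fintype_card (α := Bool), Fintype.card_bool,
          mul_comm]) (fun v hv => by
        obtain ⟨⟨T, i⟩, hT, hh, h⟩ := exists_of_testBit_neighbourMask
          ((hcov u u.2 v v.2).resolve_left hv)
        obtain ⟨hi, rfl⟩ := List.getElem?_eq_some_iff.1 (List.mk_mem_zipIdx_iff_getElem?.1 hT)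
        rcases h with h | h
        · exact ⟨(⟨⟨i, hi⟩, hh⟩, false), Fin.ext ((hFval ⟨i, hi⟩ u hh).trans h)⟩
        · exact ⟨(⟨⟨i, hi⟩, hh⟩, true), Fin.ext ((hFn ⟨i, hi⟩ u hh _).2.trans h)⟩)
  refine ⟨⟨fun i b => if b = true then (D i)⁻¹ else D i, χ, ?_, ?_, ?_, ?_, ?_⟩⟩
  · intro i b v h
    cases b
    · exact hFhole i v h
    · exact Perm.inv_eq_iff_eq.2 (hFhole i v h).symm
  · intro i b v h
    rw [Bool.not_eq_true] at h
    cases b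
    · exact hperiod i v h
    · exact (minimalPeriod_perm_inv _ _).trans (hperiod i v h)
  · intro i b j d v hi hj h
    rw [Bool.not_eq_true] at hi hj
    have := @(hbij v).1 (⟨i, hi⟩, b) (⟨j, hj⟩, d) (by cases b <;> cases d <;> exact h)
    simpa using this
  · intro u v
    rw [ne_comm, (hbij u).2]
    constructor
    · rintro ⟨⟨⟨i, hi⟩, b⟩, h⟩
      exact ⟨i, b, by simp [hi], by cases b <;> exact h⟩
    · rintro ⟨i, b, hi, h⟩
      exact ⟨(⟨i, by simpa using hi⟩, b), by cases b <;> exact h⟩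
  · intro _ i b v h
    rw [Bool.not_eq_true] at h
    cases b
    · exact hχ i v (hperiod i v h)
    · have := hχ i _ (hperiod i _ (hholeinv i v h))
      rw [← Perm.mul_apply, mul_inv_cancel] at this
      exact this.symm

/-- The successor table of a list of disjoint cycles. -/
def cycleTable (cs : List (List ℕ)) : ℕ :=
  (cs.map fun c => ((c.zip (c.rotate 1)).map fun e => e.2 * 128 ^ e.1).sum).sum

/-- On the first `q` groups of `L` points, move groups by `d` and levels by `r`; on the other
groups move levels by `r'`. -/
def move (q L d r r' v : ℕ) : ℕ :=
  if v / L < q then (v / L + d) % q * L + (v % L + r) % L else v / L * L + (v % L + r') % L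

/-- The images of a factor under a list of maps. -/
def develop (gs : List (ℕ → ℕ)) (cs : List (List ℕ)) : List ℕ :=
  gs.map fun g => cycleTable (cs.map (List.map g))

/-- Translations by `q` group shifts and `k` level shifts. -/
def moves (q L k r : ℕ) : List (ℕ → ℕ) :=
  (List.range q).flatMap fun x => (List.range k).map fun l => move q L x (r * l) (r * l)

/-- The factor consisting of the translates of a cycle. -/
def translates (q L : ℕ) (c : List ℕ) : ℕ :=
  cycleTable ((List.range q).map fun x => c.map (move q L x 0 0))

theorem card_div_ne {y x : ℕ} (a : Fin y) :
    Nat.card {v : Fin (y * x) // (v : ℕ) / x ≠ a} = (y - 1) * x := by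
  have e : {v : Fin (y * x) // (v : ℕ) / x ≠ a} ≃ {b : Fin y // b ≠ a} × Fin x :=
    (finProdFinEquiv.symm.subtypeEquiv fun v => by simp [finProdFinEquiv, Fin.ext_iff]).trans
      (prodSubtypeFstEquivSubtypeProd (p := fun b => b ≠ a))
  have := card_ne a
  rw [Nat.card_fin] at this
  rw [Nat.card_congr e, Nat.card_prod, Nat.card_fin, Nat.eq_sub_of_add_eq this]

theorem ep_of_check {m y x k : ℕ} (hm : m.Prime) {ts : List ℕ} (hlen : ts.length = k)
    (hcheck : checkFactors m (y * x) (fun _ _ => false) (· / x) ts = true)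
    (hk : (y - 1) * x = 2 * k) : EP True m y x := by
  obtain ⟨D⟩ := exists_pairedFactors_of_check hm hlen hcheck fun u => by
    have := card_div_ne (x := x) (finProdFinEquiv.symm u).1
    simp [finProdFinEquiv] at this ⊢
    rw [this, hk]
  refine ⟨Fin k, ⟨D.congr finProdFinEquiv.symm (Equiv.refl _) ?_ ?_⟩⟩
  · simp
  · intro u v
    simp [finProdFinEquiv, Fin.ext_iff]

/-- A frame of type `6 ^ s` for triangles, with all factors paired with their reversals. -/
def Frame (s : ℕ) : Prop :=
  Nonempty (PairedFactors True (fun (i : Fin s × Fin 3) (v : Fin s × Fin 6) => v.1 = i.1)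
    (fun u v => u.1 ≠ v.1) 3)

theorem frame_of_check {s : ℕ} {ts : List ℕ} (hlen : ts.length = s * 3)
    (hcheck : checkFactors 3 (s * 6) (fun i v => i / 3 == v / 6) (· / 6) ts = true) :
    Frame s := by
  obtain ⟨D⟩ := exists_pairedFactors_of_check Nat.prime_three hlen hcheck fun u => by
    have h6 := card_div_ne (x := 6) (finProdFinEquiv.symm u).1
    have h3 := card_div_ne (x := 3) (finProdFinEquiv.symm u).1
    simp [finProdFinEquiv] at h3 h6 ⊢
    rw [h3, h6]
    ring
  refine ⟨D.congr finProdFinEquiv.symm finProdFinEquiv ?_ ?_⟩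
  · intro i v
    have e : ((i.2 : ℕ) + 3 * i.1) / 3 = i.1 := by omega
    simp only [finProdFinEquiv, Fin.ext_iff, Equiv.coe_fn_symm_mk, Equiv.coe_fn_mk, beq_iff_eq, e,
      Fin.coe_divNat]
    exact eq_comm
  · intro u v
    simp [finProdFinEquiv, Fin.ext_iff]

theorem ep_three_five : EP True 3 5 3 :=
  ep_of_check (ts :=
    [cycleTable [[0, 3, 9], [1, 8, 14], [2, 4, 6], [5, 11, 12], [7, 10, 13]], cycleTable [[0, 8,
    10], [1, 5, 7], [2, 9, 12], [3, 6, 14], [4, 11, 13]], cycleTable [[0, 5, 13], [1, 6, 11],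
    [2, 3, 10], [4, 8, 12], [7, 9, 14]], cycleTable [[0, 6, 12], [1, 3, 13], [2, 7, 11], [4, 10,
    14], [5, 8, 9]], cycleTable [[0, 11, 14], [1, 4, 9], [2, 8, 13], [3, 7, 12], [5, 6, 10]],
    cycleTable [[0, 4, 7], [1, 10, 12], [2, 5, 14], [3, 8, 11], [6, 9, 13]]]) (by decide) rfl (by decide +kernel) rfl

theorem ep_three_seven : EP True 3 7 3 :=
  ep_of_check (ts :=
    develop (moves 7 3 1 0) [[0, 4, 14], [1, 3, 8], [2, 7, 12], [5, 6, 13], [9, 15, 18], [10,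
    16, 19], [11, 17, 20]] ++ [[0, 13, 17], [0, 8, 10]].map (translates 7 3)) (by decide) rfl (by decide +kernel) rfl

theorem ep_three_thirteen : EP True 3 13 3 :=
  ep_of_check (ts :=
    develop (moves 13 3 1 0) [[0, 3, 7], [1, 10, 20], [2, 15, 29], [4, 6, 12], [11, 19, 37],
    [17, 27, 32], [5, 35, 38], [9, 21, 30], [13, 25, 28], [8, 26, 31], [14, 18, 33], [16, 22,
    36], [23, 24, 34]] ++ [[0, 11, 28], [1, 27, 5], [2, 4, 9], [0, 8, 22], [0, 16, 23]].map
    (translates 13 3)) (by decide) rfl (by decide +kernel) rfl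

theorem ep_three_nineteen : EP True 3 19 3 :=
  ep_of_check (ts :=
    develop (moves 19 3 1 0) [[0, 3, 7], [1, 22, 44], [2, 9, 35], [4, 6, 12], [11, 20, 33], [23,
    28, 43], [5, 8, 16], [10, 34, 51], [21, 42, 50], [13, 38, 48], [17, 18, 55], [24, 29, 52],
    [14, 41, 53], [15, 27, 45], [19, 31, 49], [25, 36, 56], [26, 32, 47], [30, 39, 54], [37, 40,
    46]] ++ [[0, 13, 23], [1, 29, 33], [2, 18, 4], [0, 31, 38], [1, 41, 24], [2, 45, 55], [0,
    11, 52], [0, 19, 32]].map (translates 19 3)) (by decide) rfl (by decide +kernel) rfl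

theorem ep_six_four : EP True 3 4 6 :=
  ep_of_check (ts :=
    develop ((List.range 3).map fun x => move 3 6 x 0 (2 * x)) [[0, 7, 18], [1, 8, 19], [2, 6,
    15], [3, 16, 23], [4, 12, 21], [5, 10, 13], [9, 17, 20], [11, 14, 22]] ++ develop
    ((List.range 3).map fun x => move 3 6 x 0 (2 * x)) [[0, 13, 22], [1, 10, 14], [2, 12, 19],
    [3, 6, 17], [4, 11, 20], [5, 7, 23], [8, 15, 18], [9, 16, 21]] ++ [cycleTable [[0, 16, 20],
    [4, 6, 22], [10, 12, 18], [1, 9, 23], [3, 13, 21], [7, 15, 19], [2, 8, 14], [5, 11, 17]],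
    cycleTable [[0, 17, 19], [5, 6, 21], [11, 12, 23], [1, 7, 13], [2, 10, 20], [4, 14, 18], [8,
    16, 22], [3, 9, 15]], cycleTable [[0, 6, 12], [1, 15, 20], [3, 7, 22], [9, 13, 18], [2, 11,
    21], [5, 14, 19], [8, 17, 23], [4, 10, 16]]]) (by decide) rfl (by decide +kernel) rfl

theorem ep_six_six : EP True 3 6 6 :=
  ep_of_check (ts :=
    develop (moves 5 6 3 2) [[0, 25, 35], [1, 9, 33], [2, 15, 19], [3, 21, 28], [4, 11, 14], [5,
    20, 34], [6, 23, 30], [7, 13, 27], [8, 17, 26], [10, 29, 32], [12, 22, 31], [16, 18, 24]]) (by decide) rfl (by decide +kernel) rfl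

theorem ep_six_eight : EP True 3 8 6 :=
  ep_of_check (ts :=
    develop (moves 7 6 3 2) [[0, 13, 18], [1, 8, 33], [2, 23, 46], [3, 14, 40], [4, 37, 45], [5,
    24, 42], [6, 26, 38], [7, 22, 30], [9, 21, 36], [10, 16, 39], [11, 27, 35], [12, 20, 29],
    [15, 19, 43], [17, 25, 31], [28, 32, 47], [34, 41, 44]]) (by decide) rfl (by decide +kernel) rfl

theorem ep_six_ten : EP True 3 10 6 :=
  ep_of_check (ts :=
    develop (moves 9 6 3 2) [[0, 8, 28], [1, 35, 54], [2, 17, 31], [3, 40, 45], [4, 25, 46], [5,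
    43, 49], [6, 27, 32], [7, 26, 37], [9, 16, 47], [10, 18, 34], [11, 20, 29], [12, 22, 59],
    [13, 41, 48], [14, 39, 50], [15, 23, 55], [19, 33, 36], [21, 42, 57], [24, 53, 56], [30, 52,
    58], [38, 44, 51]]) (by decide) rfl (by decide +kernel) rfl

theorem ep_six_fourteen : EP True 3 14 6 :=
  ep_of_check (ts :=
    [[[0, 33, 57], [2, 11, 17], [4, 19, 37], [1, 47, 58], [3, 6, 49], [5, 20, 69], [7, 35, 65],
    [13, 21, 25], [39, 59, 75], [8, 22, 54], [9, 31, 36], [15, 23, 32], [16, 41, 55], [10, 66,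
    79], [18, 44, 81], [52, 56, 83], [12, 30, 50], [14, 38, 70], [34, 40, 42], [24, 71, 73],
    [29, 51, 64], [43, 63, 74], [26, 60, 76], [27, 61, 77], [28, 62, 72], [45, 68, 82], [46, 53,
    78], [48, 67, 80]], [[0, 23, 56], [2, 10, 55], [4, 9, 18], [1, 52, 72], [3, 62, 66], [5, 28,
    44], [6, 41, 42], [15, 58, 70], [20, 31, 50], [7, 16, 54], [8, 21, 36], [22, 32, 59], [11,
    30, 38], [12, 40, 57], [14, 19, 34], [13, 35, 39], [17, 27, 76], [26, 33, 61], [37, 60, 77],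
    [24, 51, 83], [43, 64, 81], [71, 74, 79], [25, 67, 73], [29, 53, 65], [45, 63, 75], [46, 49,
    82], [47, 68, 80], [48, 69, 78]], [[0, 14, 39], [2, 35, 40], [4, 13, 30], [1, 38, 54], [3,
    8, 34], [5, 12, 22], [6, 15, 59], [7, 20, 41], [21, 31, 58], [9, 56, 73], [10, 23, 63], [18,
    29, 55], [11, 19, 57], [16, 64, 75], [24, 36, 65], [25, 32, 74], [17, 46, 77], [27, 33, 68],
    [37, 48, 61], [26, 49, 78], [47, 60, 82], [69, 76, 80], [28, 52, 70], [42, 66, 72], [44, 50,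
    62], [43, 53, 83], [45, 71, 81], [51, 67, 79]]].flatMap (develop (moves 13 6 1 0))) (by decide) rfl (by decide +kernel) rfl

theorem frame_four : Frame 4 :=
  frame_of_check (ts :=
    [cycleTable [[6, 13, 23], [7, 14, 21], [8, 16, 19], [9, 12, 22], [10, 15, 18], [11, 17,
    20]], cycleTable [[6, 15, 20], [7, 17, 22], [8, 13, 21], [9, 14, 19], [10, 12, 23], [11, 16,
    18]], cycleTable [[6, 14, 22], [7, 15, 23], [8, 12, 18], [9, 17, 21], [10, 16, 20], [11, 13,
    19]], cycleTable [[0, 16, 23], [1, 12, 20], [2, 13, 22], [3, 15, 21], [4, 14, 18], [5, 17,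
    19]], cycleTable [[0, 12, 21], [1, 14, 23], [2, 17, 18], [3, 13, 20], [4, 15, 19], [5, 16,
    22]], cycleTable [[0, 15, 22], [1, 13, 18], [2, 16, 21], [3, 12, 19], [4, 17, 23], [5, 14,
    20]], cycleTable [[0, 9, 20], [1, 8, 22], [2, 6, 19], [3, 11, 23], [4, 10, 21], [5, 7, 18]],
    cycleTable [[0, 10, 19], [1, 6, 21], [2, 7, 20], [3, 9, 18], [4, 11, 22], [5, 8, 23]],
    cycleTable [[0, 6, 18], [1, 7, 19], [2, 9, 23], [3, 10, 22], [4, 8, 20], [5, 11, 21]],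
    cycleTable [[0, 8, 17], [1, 11, 15], [2, 10, 14], [3, 7, 16], [4, 9, 13], [5, 6, 12]],
    cycleTable [[0, 11, 14], [1, 9, 16], [2, 8, 15], [3, 6, 17], [4, 7, 12], [5, 10, 13]],
    cycleTable [[0, 7, 13], [1, 10, 17], [2, 11, 12], [3, 8, 14], [4, 6, 16], [5, 9, 15]]]) rfl (by decide +kernel)

theorem frame_five : Frame 5 :=
  frame_of_check (ts :=
    develop (moves 5 6 3 2) [[6, 12, 19], [7, 15, 27], [8, 16, 28], [9, 22, 25], [10, 21, 26],
    [11, 17, 20], [13, 23, 24], [14, 18, 29]]) rfl (by decide +kernel)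

theorem frame_seven : Frame 7 :=
  frame_of_check (ts :=
    develop (moves 7 6 3 2) [[6, 27, 41], [7, 18, 36], [8, 16, 25], [9, 12, 31], [10, 13, 30],
    [11, 35, 37], [14, 19, 24], [15, 22, 34], [17, 21, 33], [20, 26, 40], [23, 29, 38], [28, 32,
    39]]) rfl (by decide +kernel)

theorem frame_eleven : Frame 11 :=
  frame_of_check (ts :=
    develop (moves 11 6 3 2) [[6, 37, 62], [7, 56, 60], [8, 36, 50], [9, 33, 61], [10, 22, 55],
    [11, 14, 58], [12, 23, 48], [13, 25, 30], [15, 38, 49], [16, 39, 45], [17, 26, 53], [18, 43,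
    63], [19, 32, 65], [20, 41, 57], [21, 28, 31], [24, 42, 64], [27, 35, 46], [29, 47, 51],
    [34, 40, 54], [44, 52, 59]]) rfl (by decide +kernel)

theorem frame_thirteen : Frame 13 :=
  frame_of_check (ts :=
    develop (moves 13 6 3 2) [[6, 12, 19], [7, 30, 54], [18, 36, 55], [8, 13, 22], [10, 31, 56],
    [20, 37, 58], [9, 14, 23], [11, 32, 57], [21, 38, 59], [15, 41, 48], [17, 33, 42], [35, 39,
    66], [16, 43, 72], [24, 34, 67], [40, 49, 60], [25, 53, 65], [29, 71, 73], [47, 61, 77],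
    [26, 68, 76], [28, 50, 62], [44, 64, 74], [27, 51, 70], [45, 52, 63], [46, 69, 75]]) rfl (by decide +kernel)

theorem ep_five_seven : EP True 5 7 5 :=
  ep_of_check (ts :=
    develop (moves 7 5 1 0) [[22, 31, 14, 34, 17], [13, 18, 9, 4, 16], [23, 2, 12, 32, 0], [10,
    20, 7, 25, 30], [11, 26, 3, 27, 21], [19, 6, 1, 5, 29], [28, 8, 33, 15, 24]] ++ [[0, 6, 17,
    13, 29], [0, 16, 2, 34, 28], [0, 21, 8, 27, 19], [0, 26, 18, 27, 14], [0, 11, 19, 33, 27],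
    [0, 7, 26, 24, 13], [0, 12, 19, 26, 8], [0, 33, 26, 22, 34]].map (translates 7 5)) (by decide) rfl (by decide +kernel) rfl

theorem ep_six_two : EP True 3 6 2 := by
  let T : Bool → Fin 12 → Fin 12 := fun b => if b
    then ![4, 2, 5, 0, 3, 1, 8, 11, 10, 7, 6, 9]
    else ![7, 3, 0, 6, 11, 9, 1, 2, 4, 10, 5, 8]
  let S : Bool → Fin 12 → Fin 12 := fun b v => T b (T b v)
  let C : Fin 12 → Fin 3 := ![2, 2, 0, 0, 1, 1, 1, 1, 2, 2, 0, 0]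
  let sh : Fin 5 → Fin 12 → Fin 12 := fun i v => if v < 10 then ⟨(v + 2 * i) % 10, by omega⟩ else v
  let F : Fin 5 × Bool → Fin 12 → Fin 12 := fun i v => sh i.1 (T i.2 (sh (-i.1) v))
  have hF : ∀ i v, (F i)^[3] v = v ∧ F i v ≠ v := by decide +kernel
  refine Fac.ep (p := fun v : Fin 12 => (v : ℕ) / 2) (Fac.of_perms (ι := Fin 5 × Bool)
    (fun i => ⟨F i, (F i)^[2], fun v => (hF i v).1, fun v => (hF i v).1⟩) (fun i => (i.1, !i.2))
    (by decide) (by decide) (fun i v => ?_) ?_ ?_ ?_) two_pos ?_ (by simp)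
  · have := Fact.mk Nat.prime_three
    exact minimalPeriod_eq_prime (hF i v).1 (hF i v).2
  · have : ∀ u v : Fin 12, (u : ℕ) / 2 ≠ v / 2 → ∃ i, F i u = v := by decide +kernel
    exact this
  · simp only [Nat.card_eq_fintype_card]
    decide +kernel
  · have : ∀ i v, C (sh (-i.1) (F i v)) ≠ C (sh (-i.1) v) ∧
      C (sh (-i.1) (F (i.1, !i.2) v)) ≠ C (sh (-i.1) v) := by decide +kernel
    exact fun _ i => ⟨fun v => C (sh (-i.1) v), this i⟩
  · simp only [Nat.card_eq_fintype_card]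
    decide +kernel

namespace PairedFactors

variable {c : Prop} {V W ι κ : Type} {H : ι → V → Prop} {A : V → V → Prop} {m : ℕ}

theorem not_hole_apply (D : PairedFactors c H A m) {i : ι} {v : V} (b : Bool) (h : ¬ H i v) :
    ¬ H i (D.f i b v) := fun h' => by
  have := (D.f i b).injective (D.fix i b _ h')
  rw [this] at h'
  exact h h'

theorem not_hole_iterate (D : PairedFactors c H A m) {i : ι} {v : V} (b : Bool) (h : ¬ H i v)
    (n : ℕ) : ¬ H i ((D.f i b)^[n] v) := by
  induction n with
  | zero => exact h
  | succ n ih =>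
    rw [iterate_succ_apply']
    exact D.not_hole_apply b ih

open Classical in
/-- Transport along injections of the vertices and of the indices. -/
noncomputable def extend (D : PairedFactors c H A m) (φ : V ↪ W) (r : ι ↪ κ) :
    PairedFactors c (fun k w => ∀ i v, r i = k → φ v = w → H i v)
      (fun u w => ∃ u' w', φ u' = u ∧ φ w' = w ∧ A u' w') m := by
  let F : κ → Bool → Perm W := fun k b =>
    if h : ∃ i, r i = k then (D.f h.choose b).viaEmbedding φ else 1
  have hr : ∀ i (h : ∃ j, r j = r i), h.choose = i := fun i h => r.injective h.choose_spec
  have hF : ∀ i b v, F (r i) b (φ v) = φ (D.f i b v) := by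
    intro i b v
    have h : ∃ j, r j = r i := ⟨i, rfl⟩
    simp only [F]
    rw [dif_pos h, hr i h, Perm.viaEmbedding_apply]
  have hex : ∀ k w, (¬ ∀ i v, r i = k → φ v = w → H i v) → ∃ i v, r i = k ∧ φ v = w ∧ ¬ H i v := by
    intro k w h
    push Not at h
    exact h
  exact
    { f := F
      χ := fun k w => if h : ∃ i v, r i = k ∧ φ v = w then D.χ h.choose h.choose_spec.choose else 0
      fix := by
        intro k b w h
        by_cases hk : ∃ i, r i = k
        · obtain ⟨i, rfl⟩ := hk
          by_cases hw : w ∈ Set.range φ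
          · obtain ⟨v, rfl⟩ := hw
            rw [hF, D.fix i b v (h i v rfl rfl)]
          · have h : ∃ j, r j = r i := ⟨i, rfl⟩
            simp only [F]
            rw [dif_pos h, Perm.viaEmbedding_apply_of_notMem _ _ _ hw]
        · simp only [F]
          rw [dif_neg hk, Perm.one_apply]
      period := by
        intro k b w hk
        obtain ⟨i, v, rfl, rfl, h⟩ := hex k w hk
        exact (minimalPeriod_of_semiconj φ.injective (hF i b) v).trans (D.period i b v h)
      inj := by
        intro k b l d w hk hl hw
        obtain ⟨i, v, rfl, rfl, h⟩ := hex _ _ hk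
        obtain ⟨j, v', rfl, hv, h'⟩ := hex _ _ hl
        obtain rfl := φ.injective hv
        rw [hF, hF] at hw
        obtain ⟨rfl, rfl⟩ := D.inj i b j d v' h h' (φ.injective hw)
        exact ⟨rfl, rfl⟩
      arc := by
        intro u w
        constructor
        · rintro ⟨u, w, rfl, rfl, h⟩
          obtain ⟨i, b, hi, rfl⟩ := (D.arc u w).1 h
          exact ⟨r i, b, fun h' => hi (h' i u rfl rfl), hF i b u⟩
        · rintro ⟨k, b, hk, rfl⟩
          obtain ⟨i, v, rfl, rfl, h⟩ := hex _ _ hk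
          exact ⟨v, D.f i b v, rfl, (hF i b v).symm, (D.arc _ _).2 ⟨i, b, h, rfl⟩⟩
      colour := by
        intro hc k b w hk
        obtain ⟨i, v, rfl, rfl, h⟩ := hex k w hk
        have hχ : ∀ v (h : ∃ i' v', r i' = r i ∧ φ v' = φ v),
            D.χ h.choose h.choose_spec.choose = D.χ i v := by
          intro v h
          have := h.choose_spec.choose_spec
          rw [φ.injective this.2, r.injective this.1]
        have h₁ : ∃ i' v', r i' = r i ∧ φ v' = φ v := ⟨i, v, rfl, rfl⟩
        have h₂ : ∃ i' v', r i' = r i ∧ φ v' = φ (D.f i b v) := ⟨i, _, rfl, rfl⟩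
        simp only [hF]
        rw [dif_pos h₁, dif_pos h₂, hχ, hχ]
        exact D.colour hc i b v h }

open Classical in
/-- Glue systems whose `i`-th factors live on disjoint sets of vertices. -/
noncomputable def glue {β : Type} {H : β → ι → V → Prop} {A : β → V → V → Prop}
    (D : ∀ a, PairedFactors c (H a) (A a) m)
    (hH : ∀ a a' i v, ¬ H a i v → ¬ H a' i v → a = a')
    (hA : ∀ a a' u v, A a u v → A a' u v → a = a') :
    PairedFactors c (fun i v => ∀ a, H a i v) (fun u v => ∃ a, A a u v) m := by
  let F : (∀ a, ι → Perm V) → ι → V → V := fun G i v =>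
    if h : ∃ a, ¬ H a i v then G h.choose i v else v
  have hF : ∀ G a i v, ¬ H a i v → F G i v = G a i v := by
    intro G a i v h
    have h' : ∃ a, ¬ H a i v := ⟨a, h⟩
    simp only [F]
    rw [dif_pos h', hH _ _ _ _ h'.choose_spec h]
  have hF' : ∀ G i v, (∀ a, H a i v) → F G i v = v := by
    intro G i v h
    simp only [F]
    rw [dif_neg (by push Not; exact h)]
  have hF_inv : ∀ G : β → ι → Perm V, (∀ a i v, ¬ H a i v → ¬ H a i (G a i v)) →
      ∀ i v, F (fun a i => (G a i)⁻¹) i (F G i v) = v := by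
    intro G hG i v
    by_cases h : ∃ a, ¬ H a i v
    · obtain ⟨a, h⟩ := h
      rw [hF G a i v h, hF (fun a i => (G a i)⁻¹) a i _ (hG a i v h)]
      exact (G a i).symm_apply_apply v
    · push Not at h
      rw [hF' G i v h, hF' (fun a i => (G a i)⁻¹) i v h]
  let P : ι → Bool → Perm V := fun i b =>
    { toFun := F (fun a i => (D a).f i b) i
      invFun := F (fun a i => ((D a).f i b)⁻¹) i
      left_inv := hF_inv (fun a i => (D a).f i b) (fun a i v => (D a).not_hole_apply b) i
      right_inv := hF_inv (fun a i => ((D a).f i b)⁻¹) (fun a i v h h' => by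
        have e := (D a).fix i b _ h'
        rw [Perm.eq_inv_iff_eq.1 rfl] at e
        exact h (e ▸ h')) i }
  have hP : ∀ a i b v, ¬ H a i v → P i b v = (D a).f i b v := fun a i b v h => hF (fun a i => (D a).f i b) a i v h
  have hex : ∀ i v, (¬ ∀ a, H a i v) → ∃ a, ¬ H a i v := fun i v h => not_forall.1 h
  exact
    { f := P
      χ := fun i v => if h : ∃ a, ¬ H a i v then (D h.choose).χ i v else 0
      fix := fun i b v h => hF' (fun a i => (D a).f i b) i v h
      period := by
        intro i b v h
        obtain ⟨a, h⟩ := hex i v h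
        refine (minimalPeriod_eq_of_iterate (φ := id) injective_id fun n => ?_).trans
          ((D a).period i b v h)
        rw [id, id, iterate_succ_apply', hP a i b _ ((D a).not_hole_iterate b h n)]
      inj := by
        intro i b j d v h h' hv
        obtain ⟨a, h⟩ := hex i v h
        obtain ⟨a', h'⟩ := hex j v h'
        rw [hP a i b v h, hP a' j d v h'] at hv
        obtain rfl := hA a a' v _ (((D a).arc _ _).2 ⟨i, b, h, rfl⟩)
          (((D a').arc _ _).2 ⟨j, d, h', hv.symm⟩)
        exact (D a).inj i b j d v h h' hv
      arc := by
        intro u v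
        constructor
        · rintro ⟨a, h⟩
          obtain ⟨i, b, hi, rfl⟩ := ((D a).arc u v).1 h
          exact ⟨i, b, fun h' => hi (h' a), hP a i b u hi⟩
        · rintro ⟨i, b, h, rfl⟩
          obtain ⟨a, h⟩ := hex i u h
          exact ⟨a, ((D a).arc _ _).2 ⟨i, b, h, (hP a i b u h).symm⟩⟩
      colour := by
        intro hc i b v h
        obtain ⟨a, h⟩ := hex i v h
        have hχ : ∀ v (h : ∃ a', ¬ H a' i v), ¬ H a i v → (D h.choose).χ i v = (D a).χ i v := by
          intro v h' h
          rw [hH _ _ _ _ h'.choose_spec h]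
        have h' := (D a).not_hole_apply b h
        have h₁ : ∃ a', ¬ H a' i v := ⟨a, h⟩
        have h₂ : ∃ a', ¬ H a' i ((D a).f i b v) := ⟨a, h'⟩
        rw [hP a i b v h]
        rw [dif_pos h₁, dif_pos h₂, hχ v h₁ h, hχ _ h₂ h']
        exact (D a).colour hc i b v h }

end PairedFactors

/-- A frame for triangles with `6 * s a` points in group `a`, in coloured pairs of factors. -/
def GroupFrame (G : Type) (s : G → ℕ) : Prop :=
  ∃ (K W : Type) (_ : Finite K) (_ : Finite W) (g : W → G) (γ : K → G),
    Nonempty (PairedFactors True (fun k w => g w = γ k) (fun u v => g u ≠ g v) 3) ∧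
    (∀ a, Nat.card {w // g w = a} = 6 * s a) ∧ ∀ a, Nat.card {k // γ k = a} = 3 * s a

theorem card_subtype_fst {Q : Type} (p : Q → Prop) (n : ℕ) :
    Nat.card {w : Q × Fin n // p w.1} = n * Nat.card {q // p q} := by
  rw [Nat.card_congr (prodSubtypeFstEquivSubtypeProd (p := p)), Nat.card_prod, Nat.card_fin,
    mul_comm]

theorem Frame.groupFrame {s : ℕ} (h : Frame s) : GroupFrame (Fin s) fun _ => 1 := by
  refine ⟨Fin s × Fin 3, Fin s × Fin 6, inferInstance, inferInstance, Prod.fst, Prod.fst, h,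
    fun a => ?_, fun a => ?_⟩
  all_goals
    rw [card_subtype_fst (fun b => b = a)]
    simp

theorem card_comp_fst {W B G : Type} (g : W → G) (a : G) {n : ℕ} (hB : Nat.card B = n) :
    Nat.card {w : W × B // g w.1 = a} = Nat.card {w // g w = a} * n := by
  rw [Nat.card_congr (prodSubtypeFstEquivSubtypeProd (p := fun w => g w = a)), Nat.card_prod, hB]

theorem Frame.groupFrame_two {s : ℕ} (h : Frame s) : GroupFrame (Fin s) fun _ => 2 := by
  obtain ⟨K, W, _, _, g, γ, ⟨D⟩, hW, hK⟩ := h.groupFrame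
  refine ⟨K × Bool, W × Bool, inferInstance, inferInstance, fun w => g w.1, fun k => γ k.1,
    ⟨(D.double trivial).congr (Equiv.refl _) (Equiv.refl _) (by simp) (by simp)⟩,
    fun a => ?_, fun a => ?_⟩
  · exact (card_comp_fst g a (n := 2) (by simp)).trans (congrArg (· * 2) (hW a))
  · exact (card_comp_fst γ a (n := 2) (by simp)).trans (congrArg (· * 2) (hK a))

theorem Frame.groupFrame_three {s : ℕ} (h : Frame s) : GroupFrame (Fin s) fun _ => 3 := by
  obtain ⟨K, W, _, _, g, γ, ⟨D⟩, hW, hK⟩ := h.groupFrame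
  obtain ⟨D'⟩ := D.blowup (n := 3) (a := 1) (by simp) (by simp) (Or.inr (by decide)) (by simp)
  refine ⟨K × ZMod 3, W × ZMod 3, inferInstance, inferInstance, fun w => g w.1, fun k => γ k.1,
    ⟨D'.congr (Equiv.refl _) (Equiv.refl _) (by simp) (by simp)⟩,
    fun a => ?_, fun a => ?_⟩
  · exact (card_comp_fst g a (n := 3) (by simp)).trans (congrArg (· * 3) (hW a))
  · exact (card_comp_fst γ a (n := 3) (by simp)).trans (congrArg (· * 3) (hK a))

theorem PairedFactors.card_eq {c : Prop} {V ι : Type} [Finite V] {A : V → V → Prop} {m : ℕ}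
    (D : PairedFactors c (fun (_ : ι) (_ : V) => False) A m) (u : V) :
    Finite ι ∧ Nat.card {v // A u v} = 2 * Nat.card ι := by
  have hinj : Injective fun i : ι × Bool => D.f i.1 i.2 u := fun i j h => by
    have := D.inj i.1 i.2 j.1 j.2 u id id h
    exact Prod.ext this.1 this.2
  refine ⟨Finite.of_injective _ (hinj.comp (Prod.mk_left_injective true)), ?_⟩
  have : {v | A u v} = Set.range fun i : ι × Bool => D.f i.1 i.2 u := by
    ext v
    simp [D.arc]
  rw [← Set.coe_ofPred, this, Nat.card_range_of_injective hinj, Nat.card_prod,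
    Nat.card_eq_fintype_card (α := Bool), Fintype.card_bool, mul_comm]

theorem GroupFrame.fill {G : Type} [Fintype G] {s n : G → ℕ} {x : ℕ} (h : GroupFrame G s)
    (hx : 0 < x) (hn : ∀ a, n a * x = 6 * s a) (hE : ∀ a, EP True 3 (n a + 1) x) :
    EP True 3 (∑ a, n a + 1) x := by
  obtain ⟨K, W, _, _, g, γ, ⟨D⟩, hW, hK⟩ := h
  have hfib : ∀ a, Nonempty ({w // g w = a} ≃ Fin (n a) × Fin x) := fun a =>
    Finite.card_eq.1 (by rw [hW, Nat.card_prod, Nat.card_fin, Nat.card_fin, hn])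
  let e : W ≃ (Σ a, Fin (n a)) × Fin x :=
    ((sigmaFiberEquiv g).symm.trans (sigmaCongrRight fun a => (hfib a).some)).trans
      (sigmaProdDistrib _ _).symm
  have he : ∀ w, (e w).1.1 = g w := fun w => rfl
  let P := Option (Σ a, Fin (n a))
  let H : Option G → K → P × Fin x → Prop
    | none => fun k w => ∀ q, w.1 = some q → q.1 = γ k
    | some a => fun k w => ¬ (γ k = a ∧ ∀ q, w.1 = some q → q.1 = a)
  let A : Option G → P × Fin x → P × Fin x → Prop
    | none => fun u v => ∃ p q, u.1 = some p ∧ v.1 = some q ∧ p.1 ≠ q.1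
    | some a => fun u v => u.1 ≠ v.1 ∧ (∀ q, u.1 = some q → q.1 = a) ∧
        ∀ q, v.1 = some q → q.1 = a
  have hlift : ∀ (a : G) (w : P × Fin x), (∀ q, w.1 = some q → q.1 = a) ↔
      ∃ v : Option (Fin (n a)) × Fin x, Prod.map (Option.map (Sigma.mk a)) id v = w := by
    rintro a ⟨_ | ⟨b, i⟩, l⟩
    · simp [Prod.ext_iff]
    · constructor
      · intro h
        obtain rfl : b = a := h _ rfl
        exact ⟨(some i, l), rfl⟩
      · rintro ⟨⟨_ | j, l'⟩, h⟩ q hq <;> cases h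
        cases hq
        rfl
  have hD : ∀ a, Nonempty (PairedFactors True (H a) (A a) 3) := by
    rintro (_ | a)
    · refine ⟨(D.extend (e.toEmbedding.trans ⟨Prod.map some id,
        (Option.some_injective _).prodMap injective_id⟩) (Embedding.refl K)).congr
          (Equiv.refl _) (Equiv.refl _) ?_ ?_⟩
      · intro k w
        simp only [H, Embedding.refl_apply, Embedding.trans_apply,
          Embedding.coeFn_mk, Equiv.refl_apply, ← he]
        constructor
        · rintro h _ w rfl rfl
          exact h _ rfl
        · intro h q hq
          have := h k (e.symm (q, w.2)) rfl (by
            rw [e.apply_symm_apply]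
            exact Prod.ext hq.symm rfl)
          rwa [e.apply_symm_apply] at this
      · intro u v
        simp only [A, Embedding.trans_apply,
          Embedding.coeFn_mk, Equiv.refl_apply, ← he]
        constructor
        · rintro ⟨p, q, hp, hq, h⟩
          refine ⟨e.symm (p, u.2), e.symm (q, v.2), ?_, ?_, ?_⟩
          · rw [e.apply_symm_apply]
            exact Prod.ext hp.symm rfl
          · rw [e.apply_symm_apply]
            exact Prod.ext hq.symm rfl
          · rwa [e.apply_symm_apply, e.apply_symm_apply]
        · rintro ⟨u, v, rfl, rfl, h⟩
          exact ⟨_, _, rfl, rfl, h⟩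
    · obtain ⟨ι, ⟨E⟩⟩ := (hE a).congr (prodCongr (finSuccEquiv (n a)) (Equiv.refl (Fin x)))
        (A' := fun u v => u.1 ≠ v.1) (by simp)
      obtain ⟨hι, hcard⟩ := E.card_eq (none, ⟨0, hx⟩)
      obtain ⟨r⟩ : Nonempty (ι ≃ {k // γ k = a}) := Finite.card_eq.1 <| by
        have : Nat.card {v : Option (Fin (n a)) × Fin x // none ≠ v.1} = n a * x := by
          rw [card_subtype_fst (fun q => none ≠ q)]
          have h : Nat.card {q : Option (Fin (n a)) // none ≠ q} + 1 = n a + 1 := by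
            refine (Eq.trans ?_ (card_ne (none : Option (Fin (n a))))).trans (by simp)
            simp only [ne_eq, eq_comm]
          rw [Nat.succ.inj h, mul_comm]
        have h' := hcard.symm.trans this
        rw [hn] at h'
        rw [hK]
        omega
      refine ⟨(E.extend ⟨Prod.map (Option.map (Sigma.mk (β := fun a => Fin (n a)) a)) id,
        (Option.map_injective sigma_mk_injective).prodMap injective_id⟩
          (r.toEmbedding.trans (Embedding.subtype _))).congr
          (Equiv.refl _) (Equiv.refl _) ?_ ?_⟩
      · intro k w
        simp only [H, Embedding.trans_apply, Embedding.coeFn_mk,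
          Equiv.refl_apply, Embedding.subtype_apply, imp_false]
        rw [not_iff_comm]
        push Not
        rw [hlift]
        constructor
        · rintro ⟨i, v, h, h'⟩
          exact ⟨h ▸ (r i).2, v, h'⟩
        · rintro ⟨h, v, h'⟩
          exact ⟨r.symm ⟨k, h⟩, v, by rw [r.apply_symm_apply], h'⟩
      · intro u v
        simp only [A, Embedding.coeFn_mk, Equiv.refl_apply, hlift]
        constructor
        · rintro ⟨h, ⟨u, rfl⟩, v, rfl⟩
          exact ⟨u, v, rfl, rfl, fun h' => h (congrArg (Option.map _) h')⟩
        · rintro ⟨u, v, rfl, rfl, h⟩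
          exact ⟨fun h' => h (Option.map_injective (sigma_mk_injective (β := fun a => Fin (n a))) h'), ⟨u, rfl⟩, v, rfl⟩
  have hfac : Fac True (fun u v : P × Fin x => u.1 ≠ v.1) 3 := by
    refine ⟨K, ⟨(PairedFactors.glue (fun a => (hD a).some) ?_ ?_).congr (Equiv.refl _)
      (Equiv.refl _) ?_ ?_⟩⟩
    · rintro (_ | a) (_ | a') k w h h' <;> simp only [H, not_not] at h h'
      · rfl
      · exact absurd (fun q hq => (h'.2 q hq).trans h'.1.symm) h
      · exact absurd (fun q hq => (h.2 q hq).trans h.1.symm) h'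
      · rw [← h.1, h'.1]
    · rintro (_ | a) (_ | a') u v h h'
      · rfl
      · obtain ⟨p, q, hp, hq, h⟩ := h
        exact absurd ((h'.2.1 p hp).trans (h'.2.2 q hq).symm) h
      · obtain ⟨p, q, hp, hq, h'⟩ := h'
        exact absurd ((h.2.1 p hp).trans (h.2.2 q hq).symm) h'
      · obtain ⟨h, hu, hv⟩ := h
        obtain ⟨-, hu', hv'⟩ := h'
        rcases hp : u.1 with _ | p
        · rcases hq : v.1 with _ | q
          · exact absurd (hp.trans hq.symm) h
          · rw [← hv q hq, ← hv' q hq]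
        · rw [← hu p hp, ← hu' p hp]
    · intro k w
      refine iff_of_false id fun h => ?_
      refine h (some (γ k)) ⟨rfl, fun q hq => ?_⟩
      exact h none q hq
    · intro u v
      constructor
      · intro h
        have hnone : ∀ {w : P} {a : G}, w = none → ∀ q, w = some q → q.1 = a := by
          rintro w a rfl q hq
          cases hq
        have hsome : ∀ {w : P} {a : G} {p}, w = some p → p.1 = a → ∀ q, w = some q → q.1 = a := by
          rintro w a p rfl h q hq
          cases hq
          exact h
        rcases hp : u.1 with _ | p <;> rcases hq : v.1 with _ | q
        · exact absurd (hp.trans hq.symm) h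
        · exact ⟨some q.1, h, hnone hp, hsome hq rfl⟩
        · exact ⟨some p.1, h, hsome hp rfl, hnone hq⟩
        · by_cases hpq : p.1 = q.1
          · exact ⟨some p.1, h, hsome hp rfl, hsome hq hpq.symm⟩
          · exact ⟨none, p, q, hp, hq, hpq⟩
      · rintro ⟨_ | a, h⟩ e
        · obtain ⟨p, q, hp, hq, h⟩ := h
          exact h (congrArg Sigma.fst (Option.some.inj (hp.symm.trans (e.trans hq))))
        · exact h.1 e
  refine hfac.congr (prodCongr (Finite.equivFinOfCardEq ?_) (Equiv.refl _)) (by simp)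
  simp [P]

theorem groupFrame_of_blocks {Q G Λ : Type} [Finite Q] (g : Q → G) (B : Λ → Set Q)
    (hB : ∀ L, ∀ p ∈ B L, ∀ q ∈ B L, g p = g q → p = q)
    (hex : ∀ p q, g p ≠ g q → ∃ L, p ∈ B L ∧ q ∈ B L)
    (hun : ∀ L L' p q, p ≠ q → p ∈ B L → q ∈ B L → p ∈ B L' → q ∈ B L' → L = L')
    (hF : ∀ L, Frame (Nat.card (B L))) : GroupFrame G fun a => Nat.card {q // g q = a} := by
  let H : Λ → Q × Fin 3 → Q × Fin 6 → Prop := fun L k w =>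
    ¬ (k.1 ∈ B L ∧ w.1 ∈ B L ∧ w.1 ≠ k.1)
  let A : Λ → Q × Fin 6 → Q × Fin 6 → Prop := fun L u v =>
    u.1 ∈ B L ∧ v.1 ∈ B L ∧ u.1 ≠ v.1
  have hD : ∀ L, Nonempty (PairedFactors True (H L) (A L) 3) := by
    intro L
    obtain ⟨D⟩ := hF L
    let e := (Finite.equivFin (B L)).symm
    let φ : ∀ n, Fin (Nat.card (B L)) × Fin n ↪ Q × Fin n := fun n =>
      ⟨Prod.map (fun i => e i) id, (Subtype.val_injective.comp e.injective).prodMap injective_id⟩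
    have hsur : ∀ {n} (w : Q × Fin n) (h : w.1 ∈ B L), φ n (e.symm ⟨w.1, h⟩, w.2) = w :=
      fun w h =>
      Prod.ext (congrArg Subtype.val (e.apply_symm_apply _)) rfl
    refine ⟨(D.extend (φ 6) (φ 3)).congr (Equiv.refl _) (Equiv.refl _) ?_ ?_⟩
    · intro k w
      simp only [H, Equiv.refl_apply]
      rw [not_iff_comm]
      push Not
      constructor
      · rintro ⟨i, v, rfl, rfl, h⟩
        exact ⟨(e i.1).2, (e v.1).2, fun h' => h (e.injective (Subtype.ext h'))⟩
      · rintro ⟨hk, hw, h⟩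
        exact ⟨_, _, hsur k hk, hsur w hw, fun h' => h
          (congrArg Subtype.val (e.symm.injective h'))⟩
    · intro u v
      simp only [A, Equiv.refl_apply]
      constructor
      · rintro ⟨hu, hv, h⟩
        exact ⟨_, _, hsur u hu, hsur v hv, fun h' => h
          (congrArg Subtype.val (e.symm.injective h'))⟩
      · rintro ⟨u, v, rfl, rfl, h⟩
        exact ⟨(e u.1).2, (e v.1).2, fun h' => h (e.injective (Subtype.ext h'))⟩
  refine ⟨Q × Fin 3, Q × Fin 6, inferInstance, inferInstance, fun w => g w.1, fun k => g k.1,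
    ⟨(PairedFactors.glue (fun L => (hD L).some) ?_ ?_).congr (Equiv.refl _) (Equiv.refl _) ?_ ?_⟩,
    fun a => card_subtype_fst (fun q => g q = a) 6, fun a => card_subtype_fst (fun q => g q = a) 3⟩
  · intro L L' k w h h'
    simp only [H, not_not] at h h'
    exact hun L L' _ _ h.2.2 h.2.1 h.1 h'.2.1 h'.1
  · intro L L' u v h h'
    exact hun L L' _ _ h.2.2 h.1 h.2.1 h'.1 h'.2.1
  · intro k w
    constructor
    · rintro h L ⟨hk, hw, h'⟩
      exact h' (hB L _ hw _ hk h)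
    · intro h
      by_contra h'
      obtain ⟨L, hL, hL'⟩ := hex _ _ h'
      exact h L ⟨hL', hL, fun e => h' (congrArg g e)⟩
  · intro u v
    constructor
    · intro h
      obtain ⟨L, hL, hL'⟩ := hex _ _ h
      exact ⟨L, hL, hL', fun e => h (congrArg g e)⟩
    · rintro ⟨L, hL, hL', h⟩ e
      exact h (hB L _ hL _ hL' e)

/-- There is a commutative ring of order `n` with four elements whose differences are units. -/
def HasSlopes (n : ℕ) : Prop :=
  ∃ (R : Type) (_ : CommRing R) (_ : Finite R) (s : Fin 4 → R),
    Nat.card R = n ∧ ∀ c d, c ≠ d → IsUnit (s c - s d)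

theorem hasSlopes_of_coprime {n : ℕ} (h : n.Coprime 6) : HasSlopes n := by
  have hn : n ≠ 0 := by
    rintro rfl
    simp at h
  have := NeZero.mk hn
  refine ⟨ZMod n, inferInstance, inferInstance, fun c => (c : ℕ), by simp, fun c d hcd => ?_⟩
  have h6 : IsUnit ((6 : ℕ) : ZMod n) := (ZMod.isUnit_iff_coprime 6 n).2 h.symm
  have h3 : IsUnit (2 : ZMod n) ∧ IsUnit (3 : ZMod n) :=
    IsUnit.mul_iff.1 (by convert h6 using 1; norm_num)
  fin_cases c <;> fin_cases d <;> simp at hcd ⊢ <;>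
    first
      | exact h3.1
      | exact h3.2
      | (convert isUnit_one (M := ZMod n) using 1; norm_num; done)
      | (convert h3.1 using 1; norm_num; done)
      | (convert isUnit_one.neg (α := ZMod n) using 1; norm_num; done)
      | (convert h3.1.neg using 1; norm_num)

theorem hasSlopes_prime_pow {p k : ℕ} (hp : p.Prime) (hk : k ≠ 0) (h : 4 ≤ p ^ k) :
    HasSlopes (p ^ k) := by
  have := Fact.mk hp
  have hc := GaloisField.card p k hk
  have hfin : Finite (GaloisField p k) := inferInstance
  let e := Finite.equivFinOfCardEq hc
  refine ⟨GaloisField p k, inferInstance, hfin, fun c => e.symm (Fin.castLE h c), hc,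
    fun c d hcd => (sub_ne_zero.2 fun h' => hcd ?_).isUnit⟩
  simpa using h'

theorem card_subtype_sum {α β : Type} [Finite α] [Finite β] (p : α ⊕ β → Prop) :
    Nat.card {q // p q} = Nat.card {a // p (Sum.inl a)} + Nat.card {b // p (Sum.inr b)} := by
  rw [Nat.card_congr subtypeSum, Nat.card_sum]

theorem HasSlopes.groupFrame {n u : ℕ} (h : HasSlopes n) (hu : u ≤ n) :
    GroupFrame (Option (Fin 4)) fun a => a.elim u fun _ => n := by
  obtain ⟨R, _, _, s, rfl, hs⟩ := h
  obtain ⟨U, hU⟩ : ∃ U : Set R, Nat.card U = u := by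
    have := Fintype.ofFinite R
    rw [Nat.card_eq_fintype_card] at hu
    obtain ⟨U, -, hU⟩ := Finset.exists_subset_card_eq (s := Finset.univ) (n := u) hu
    exact ⟨U, by simpa using hU⟩
  let Q := (Fin 4 × R) ⊕ U
  let g : Q → Option (Fin 4) := Sum.elim (fun q => some q.1) fun _ => none
  let B : R × R → Set Q := fun L =>
    {q : Q | Sum.elim (fun p => p.2 = L.1 + s p.1 * L.2) (fun r : U => r.1 = L.2) q}
  have hsolve : ∀ c d, c ≠ d → ∀ p q, ∃ j, p - q = (s c - s d) * j := fun c d h p q =>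
    (hs c d h).dvd
  have := groupFrame_of_blocks g B ?_ ?_ ?_ ?_
  · convert this using 2 with a
    refine Eq.symm ((card_subtype_sum _).trans ?_)
    rcases a with _ | c
    · simp [g, hU]
    · simp only [g, Sum.elim_inl, Sum.elim_inr, Option.some.injEq, reduceCtorEq, Nat.card_of_isEmpty,
        add_zero, Option.elim_some]
      rw [Nat.card_congr (prodSubtypeFstEquivSubtypeProd (p := fun d => d = c)), Nat.card_prod,
        Nat.card_unique, one_mul]
  · rintro L (⟨c, p⟩ | p) hp (⟨d, q⟩ | q) hq h <;> simp [g, B] at h hp hq ⊢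
    · subst h
      exact congrArg (fun r => Sum.inl (c, r)) (hp.trans hq.symm)
    · exact congrArg Sum.inr (Subtype.ext (hp.trans hq.symm))
  · rintro (⟨c, p⟩ | p) (⟨d, q⟩ | q) h <;> simp [g] at h
    · obtain ⟨j, hj⟩ := hsolve c d h p q
      exact ⟨(p - s c * j, j), by simp [B], by simp [B]; linear_combination -hj⟩
    · exact ⟨(p - s c * q, q), by simp [B], by simp [B]⟩
    · exact ⟨(q - s d * p, p), by simp [B], by simp [B]⟩
  · rintro ⟨i, j⟩ ⟨i', j'⟩ (⟨c, p⟩ | p) (⟨d, q⟩ | q) h hp hq hp' hq' <;>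
      simp [B] at h hp hq hp' hq' ⊢
    · have hcd : c ≠ d := by
        rintro rfl
        exact h (congrArg (fun r => Sum.inl (c, r)) (hp.trans hq.symm))
      have hj : j = j' := (hs c d hcd).mul_left_cancel (by linear_combination hq - hp + hp' - hq')
      subst hj
      exact ⟨by linear_combination hp' - hp, rfl⟩
    · obtain rfl := hq.symm.trans hq'
      exact ⟨by linear_combination hp' - hp, rfl⟩
    · obtain rfl := hp.symm.trans hp'
      exact ⟨by linear_combination hq' - hq, rfl⟩
    · exact absurd (congrArg Sum.inr (Subtype.ext (hp.trans hq.symm))) h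
  · rintro ⟨i, j⟩
    have : Nat.card (B (i, j)) = 4 + Nat.card {r : U // (r : R) = j} := by
      refine (card_subtype_sum _).trans (congrArg (· + _) ?_)
      refine (Nat.card_congr ⟨fun q => q.1.1, fun c => ⟨(c, i + s c * j), rfl⟩, ?_, fun _ => rfl⟩).trans
        (Nat.card_fin 4)
      exact fun q => Subtype.ext (Prod.ext rfl q.2.symm)
    rw [this]
    have hsub : Subsingleton {r : U // (r : R) = j} :=
      ⟨fun a b => Subtype.ext (Subtype.ext (a.2.trans b.2.symm))⟩
    have := Finite.card_le_one_iff_subsingleton.2 hsub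
    interval_cases Nat.card {r : U // (r : R) = j}
    · exact frame_four
    · exact frame_five

theorem EP.mul {m a b x : ℕ} (ha : EP True m a x) (hb : EP True m b x) (ha0 : 0 < a)
    (hm : 2 ≤ m) : EP True m (a * b) x := by
  have := hb.blowup' ha0 hm (one_dvd a) odd_one
  rw [mul_one, mul_comm x] at this
  exact mul_comm a b ▸ ha.trans this

theorem EP.one {c : Prop} {m x : ℕ} : EP c m 1 x :=
  ⟨Empty, ⟨⟨nofun, nofun, nofun, nofun, nofun, fun u v => by simp [Subsingleton.elim u.1 v.1],
    nofun⟩⟩⟩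

theorem HasSlopes.ep {n u k x : ℕ} (h : HasSlopes n) (hu : u ≤ n) (hk : k * x = 6)
    (hn : EP True 3 (k * n + 1) x) (hu' : EP True 3 (k * u + 1) x) :
    EP True 3 (k * (4 * n + u) + 1) x := by
  have hx : 0 < x := by
    rcases x.eq_zero_or_pos with rfl | h
    · simp at hk
    · exact h
  have := (h.groupFrame hu).fill (n := fun a => k * a.elim u fun _ => n) hx
    (fun a => by rw [← hk]; ring) (by rintro (_ | _) <;> assumption)
  simp only [Fintype.sum_option, Option.elim, Finset.sum_const, Finset.card_univ,
    Fintype.card_fin, smul_eq_mul] at this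
  convert this using 2
  ring

theorem Frame.ep {s t k x : ℕ} (h : Frame s) (ht : t = 1 ∨ t = 2 ∨ t = 3) (hk : k * x = 6)
    (hE : EP True 3 (k * t + 1) x) : EP True 3 (s * (k * t) + 1) x := by
  have hx : 0 < x := by
    rcases x.eq_zero_or_pos with rfl | h
    · simp at hk
    · exact h
  have hG : GroupFrame (Fin s) fun _ => t := by
    rcases ht with rfl | rfl | rfl
    exacts [h.groupFrame, h.groupFrame_two, h.groupFrame_three]
  have := hG.fill (n := fun _ => k * t) hx (fun a => by rw [← hk]; ring) fun _ => hE
  simpa using this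

theorem ep_three_three_of_odd {y : ℕ} (hy : Odd y) : EP True 3 y 3 := by
  induction y using Nat.strong_induction_on with
  | _ y ih =>
  have hS {y : ℕ} (n u : ℕ) (ih : ∀ z < y, Odd z → EP True 3 z 3) (h : HasSlopes n) (hu : u ≤ n)
      (hn : 1 ≤ n) (hy : y = 8 * n + 2 * u + 1) : EP True 3 y 3 := by
    have := h.ep (k := 2) hu rfl (ih _ (by omega) ⟨n, rfl⟩) (ih _ (by omega) ⟨u, rfl⟩)
    convert this using 1
    omega
  have hF {y : ℕ} (s t : ℕ) (ih : ∀ z < y, Odd z → EP True 3 z 3) (h : Frame s)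
      (ht : t = 1 ∨ t = 2 ∨ t = 3) (hs : 2 ≤ s) (hy : y = s * (2 * t) + 1) : EP True 3 y 3 :=
    hy ▸ h.ep ht rfl (ih _ (by rcases ht with rfl | rfl | rfl <;> omega) ⟨t, rfl⟩)
  by_cases hc : ∃ a < y, ∃ b < y, y = a * b
  · obtain ⟨a, ha, b, hb, rfl⟩ := hc
    rw [Nat.odd_mul] at hy
    exact (ih a ha hy.1).mul (ih b hb hy.2) hy.1.pos (by simp)
  have h5 : HasSlopes 5 := hasSlopes_of_coprime (by decide)
  have h7 : HasSlopes 7 := hasSlopes_of_coprime (by decide)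
  have h9 : HasSlopes 9 := hasSlopes_prime_pow Nat.prime_three (k := 2) (by simp) (by simp)
  have h11 : HasSlopes 11 := hasSlopes_of_coprime (by decide)
  have h13 : HasSlopes 13 := hasSlopes_of_coprime (by decide)
  by_cases hlt : y < 137
  · have key : ∀ y < 137, Odd y → (¬ ∃ a < y, ∃ b < y, y = a * b) →
      y ∈ [1, 3, 5, 7, 11, 13, 17, 19, 23, 29, 31, 37, 41, 43, 47, 53, 59, 61, 67, 71, 73, 79, 83,
        89, 97, 101, 103, 107, 109, 113, 127, 131] := by decide +kernel
    have := key y hlt hy hc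
    simp only [List.mem_cons, List.not_mem_nil, or_false] at this
    rcases this with rfl | rfl | rfl | rfl | rfl | rfl | rfl | rfl | rfl | rfl | rfl | rfl | rfl |
      rfl | rfl | rfl | rfl | rfl | rfl | rfl | rfl | rfl | rfl | rfl | rfl | rfl | rfl | rfl |
      rfl | rfl | rfl | rfl
    · exact EP.one
    · exact ep_three Nat.prime_three le_rfl
    · exact ep_three_five
    · exact ep_three_seven
    · exact hF 5 1 ih frame_five (by simp) (by simp) rfl
    · exact ep_three_thirteen
    · exact hF 4 2 ih frame_four (by simp) (by simp) rfl
    · exact ep_three_nineteen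
    · exact hF 11 1 ih frame_eleven (by simp) (by simp) rfl
    · exact hF 7 2 ih frame_seven (by simp) (by simp) rfl
    · exact hF 5 3 ih frame_five (by simp) (by simp) rfl
    · exact hS 4 2 ih (hasSlopes_prime_pow Nat.prime_two (k := 2) (by simp) (by simp)) (by simp)
        (by simp) rfl
    · exact hS 5 0 ih h5 (by simp) (by simp) rfl
    · exact hS 5 1 ih h5 (by simp) (by simp) rfl
    · exact hS 5 3 ih h5 (by simp) (by simp) rfl
    · exact hF 13 2 ih frame_thirteen (by simp) (by simp) rfl
    · exact hS 7 1 ih h7 (by simp) (by simp) rfl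
    · exact hS 7 2 ih h7 (by simp) (by simp) rfl
    · exact hS 7 5 ih h7 (by simp) (by simp) rfl
    · exact hS 7 7 ih h7 (by simp) (by simp) rfl
    · exact hS 9 0 ih h9 (by simp) (by simp) rfl
    · exact hS 9 3 ih h9 (by simp) (by simp) rfl
    · exact hS 9 5 ih h9 (by simp) (by simp) rfl
    · exact hS 11 0 ih h11 (by simp) (by simp) rfl
    · exact hS 11 4 ih h11 (by simp) (by simp) rfl
    · exact hS 11 6 ih h11 (by simp) (by simp) rfl
    · exact hS 11 7 ih h11 (by simp) (by simp) rfl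
    · exact hS 11 9 ih h11 (by simp) (by simp) rfl
    · exact hS 11 10 ih h11 (by simp) (by simp) rfl
    · exact hS 13 4 ih h13 (by simp) (by simp) rfl
    · exact hS 13 11 ih h13 (by simp) (by simp) rfl
    · exact hS 13 13 ih h13 (by simp) (by simp) rfl
  · obtain ⟨n, hn, hn₁, hn₂⟩ : ∃ n, (n % 6 = 1 ∨ n % 6 = 5) ∧ 8 * n + 1 ≤ y ∧ y ≤ 10 * n + 1 := by
      have : (y - 1) / 8 % 6 < 6 := Nat.mod_lt _ (by simp)
      obtain h | h | h | h | h | h : (y - 1) / 8 % 6 = 0 ∨ (y - 1) / 8 % 6 = 1 ∨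
        (y - 1) / 8 % 6 = 2 ∨ (y - 1) / 8 % 6 = 3 ∨ (y - 1) / 8 % 6 = 4 ∨ (y - 1) / 8 % 6 = 5 := by
        omega
      exacts [⟨(y - 1) / 8 - 1, by omega⟩, ⟨(y - 1) / 8, by omega⟩, ⟨(y - 1) / 8 - 1, by omega⟩,
        ⟨(y - 1) / 8 - 2, by omega⟩, ⟨(y - 1) / 8 - 3, by omega⟩, ⟨(y - 1) / 8, by omega⟩]
    have hcop : n.Coprime 6 := by
      rw [Nat.Coprime, Nat.gcd_comm, Nat.gcd_rec]
      rcases hn with h | h <;> rw [h] <;> rfl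
    obtain ⟨z, rfl⟩ := hy
    exact hS n (z - 4 * n) ih (hasSlopes_of_coprime hcop) (by omega) (by omega) (by omega)

theorem ep_three_six {y : ℕ} (hy : 3 ≤ y) : EP True 3 y 6 := by
  have hodd {y : ℕ} (hy : Odd y) : EP True 3 y 6 := (ep_three_three_of_odd hy).double
  induction y using Nat.strong_induction_on with
  | _ y ih =>
  have hS {y : ℕ} (n u : ℕ) (ih : ∀ z < y, 3 ≤ z → EP True 3 z 6) (h : HasSlopes n) (hu : u ≤ n)
      (hu₂ : 2 ≤ u) (hy : y = 4 * n + u + 1) : EP True 3 y 6 := by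
    have := h.ep (k := 1) hu rfl (ih _ (by omega) (by omega)) (ih _ (by omega) (by omega))
    convert this using 1
    omega
  rcases Nat.even_or_odd y with hy₂ | hy₂
  swap
  · exact hodd hy₂
  by_cases hc : ∃ a < y, ∃ b < y, 3 ≤ a ∧ 3 ≤ b ∧ y = a * b
  · obtain ⟨a, ha, b, hb, ha₃, hb₃, rfl⟩ := hc
    exact (ih a ha ha₃).mul (ih b hb hb₃) (by omega) (by simp)
  have h5 : HasSlopes 5 := hasSlopes_of_coprime (by decide)
  have h7 : HasSlopes 7 := hasSlopes_of_coprime (by decide)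
  have h13 : HasSlopes 13 := hasSlopes_of_coprime (by decide)
  by_cases hlt : y < 72
  · have key : ∀ y < 72, (∃ a < y, ∃ b < y, (3 ≤ a ∧ 3 ≤ b) ∧ y = a * b) ∨ y < 3 ∨ ¬ Even y ∨
      y ∈ [4, 6, 8, 10, 14, 22, 26, 34, 38, 46, 58, 62] := by decide +kernel
    have := (((key y hlt).resolve_left (by simpa only [and_assoc] using hc)).resolve_left
      (by omega)).resolve_left (not_not.2 hy₂)
    simp only [List.mem_cons, List.not_mem_nil, or_false] at this
    rcases this with rfl | rfl | rfl | rfl | rfl | rfl | rfl | rfl | rfl | rfl | rfl | rfl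
    · exact ep_six_four
    · exact ep_six_six
    · exact ep_six_eight
    · exact ep_six_ten
    · exact ep_six_fourteen
    · exact frame_seven.ep (k := 1) (t := 3) (by simp) rfl ep_six_four
    · exact hS 5 5 ih h5 (by simp) (by simp) rfl
    · exact hS 7 5 ih h7 (by simp) (by simp) rfl
    · exact hS 8 5 ih (hasSlopes_prime_pow Nat.prime_two (k := 3) (by simp) (by simp)) (by simp)
        (by simp) rfl
    · exact hS 9 9 ih (hasSlopes_prime_pow Nat.prime_three (k := 2) (by simp) (by simp)) (by simp)
        (by simp) rfl
    · exact hS 13 5 ih h13 (by simp) (by simp) rfl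
    · exact hS 13 9 ih h13 (by simp) (by simp) rfl
  · obtain ⟨n, hn, hn₁, hn₂⟩ : ∃ n, (n % 6 = 1 ∨ n % 6 = 5) ∧ 4 * n + 4 ≤ y ∧ y ≤ 5 * n + 1 := by
      have hmod : (y - 4) / 4 % 6 < 6 := Nat.mod_lt _ (by simp)
      obtain ⟨z, rfl⟩ := hy₂
      obtain h | h | h | h | h | h : (z + z - 4) / 4 % 6 = 0 ∨ (z + z - 4) / 4 % 6 = 1 ∨
        (z + z - 4) / 4 % 6 = 2 ∨ (z + z - 4) / 4 % 6 = 3 ∨ (z + z - 4) / 4 % 6 = 4 ∨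
        (z + z - 4) / 4 % 6 = 5 := by omega
      exacts [⟨(z + z - 4) / 4 - 1, by omega⟩, ⟨(z + z - 4) / 4, by omega⟩,
        ⟨(z + z - 4) / 4 - 1, by omega⟩, ⟨(z + z - 4) / 4 - 2, by omega⟩,
        ⟨(z + z - 4) / 4 - 3, by omega⟩, ⟨(z + z - 4) / 4, by omega⟩]
    have hcop : n.Coprime 6 := by
      rw [Nat.Coprime, Nat.gcd_comm, Nat.gcd_rec]
      rcases hn with h | h <;> rw [h] <;> rfl
    exact hS n (y - 4 * n - 1) ih (hasSlopes_of_coprime hcop) (by omega) (by omega) (by omega)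

theorem ep_prime_of_odd {q y : ℕ} (hq : q.Prime) (hq₂ : q ≠ 2) (hy : Odd y) : EP True q y q := by
  obtain rfl | hq₃ := eq_or_ne q 3
  · exact ep_three_three_of_odd hy
  have hq₅ : 5 ≤ q := hq.five_le_of_ne_two_of_ne_three hq₂ hq₃
  induction y using Nat.strong_induction_on with
  | _ y ih =>
  obtain rfl | hy₁ := eq_or_ne y 1
  · exact EP.one
  have hp := Nat.minFac_prime hy₁
  obtain ⟨b, hb⟩ := Nat.minFac_dvd y
  generalize y.minFac = p at hp hb
  subst hb
  rw [Nat.odd_mul] at hy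
  obtain rfl | hb₁ := eq_or_ne b 1
  · rw [mul_one]
    obtain rfl | hp₃ := eq_or_ne p 3
    · exact ep_three hq (by omega)
    obtain rfl | hp₇ := eq_or_ne p 7
    · obtain rfl | hq₅' := eq_or_ne q 5
      · exact ep_five_seven
      · have : q ≠ 6 := by
          rintro rfl
          exact absurd hq (by decide)
        exact ep_seven hq (by omega)
    have hp₂ : p ≠ 2 := by
      rintro rfl
      exact absurd hy.1 (by decide)
    exact ep_prime hp (hp.five_le_of_ne_two_of_ne_three hp₂ hp₃) hp₇ hq hq₅
  · have hb₂ : 2 ≤ b := by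
      have := hy.2.pos
      omega
    exact (ih p (by nlinarith [hp.pos]) hy.1).mul (ih b (by nlinarith [hp.two_le]) hy.2) hp.pos
      hq.two_le

theorem ep_two_mul_prime_part {q y : ℕ} (hq : q.Prime) (hq₂ : q ≠ 2) (hy : 3 ≤ y) :
    EP True q y (2 * q) := by
  obtain rfl | hq₃ := eq_or_ne q 3
  · exact ep_three_six hy
  have hq₅ : 5 ≤ q := hq.five_le_of_ne_two_of_ne_three hq₂ hq₃
  induction y using Nat.strong_induction_on with
  | _ y ih =>
  obtain ⟨k, rfl | rfl⟩ := y.even_or_odd'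
  swap
  · rw [mul_comm 2 q]
    exact (ep_prime_of_odd hq hq₂ (odd_two_mul_add_one k)).double
  have hmul {a b : ℕ} (hab : 2 * k = a * b) (ha : 3 ≤ a) (hb : 3 ≤ b) : EP True q (2 * k) (2 * q) :=
    hab ▸ (ih a (by nlinarith) ha).mul (ih b (by nlinarith) hb) (by omega) hq.two_le
  obtain ⟨j, rfl | rfl⟩ := k.even_or_odd'
  · rcases (by omega : j = 1 ∨ j = 2 ∨ 3 ≤ j) with rfl | rfl | hj
    · exact ep_four hq hq₅
    · exact ep_eight hq hq₅
    · exact hmul (a := 4) (b := j) (by ring) (by simp) hj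
  · have hk := odd_two_mul_add_one j
    generalize 2 * j + 1 = k at *
    have hp := Nat.minFac_prime (n := k) (by omega)
    obtain ⟨b, hb⟩ := k.minFac_dvd
    generalize k.minFac = p at hp hb
    subst hb
    rw [Nat.odd_mul] at hk
    have hp₂ : p ≠ 2 := by
      rintro rfl
      exact absurd hk.1 (by decide)
    have := hp.two_le
    have := hk.2.pos
    obtain rfl | hb₁ := eq_or_ne b 1
    · rw [mul_one]
      obtain rfl | hp₃ := eq_or_ne p 3
      · exact ep_six hq hq₅
      · exact ep_two_mul_prime hp (hp.five_le_of_ne_two_of_ne_three hp₂ hp₃) hq hq₅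
    · exact hmul (a := p) (b := 2 * b) (by ring) (by omega) (by omega)

theorem ep_of_odd_of_dvd {m x y : ℕ} (hm : Odd m) (hm₃ : 3 ≤ m) (hmx : m ∣ x) (hx : 0 < x)
    (hy : 3 ≤ y) (hxy : Even x ∨ Odd y) : EP True m y x := by
  have hq := Nat.minFac_prime (n := m) (by omega)
  obtain ⟨a, ha⟩ := m.minFac_dvd
  generalize m.minFac = q at hq ha
  subst ha
  rw [Nat.odd_mul] at hm
  have hq₂ : q ≠ 2 := by
    rintro rfl
    exact absurd hm.1 (by decide)
  obtain ⟨n, rfl⟩ := hmx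
  by_cases hyo : Odd y
  · rw [mul_assoc] at hx ⊢
    exact (ep_prime_of_odd hq hq₂ hyo).blowup' (Nat.pos_of_mul_pos_left hx) hq.two_le
      (dvd_mul_right a n) hm.2
  · obtain ⟨k, rfl⟩ : 2 ∣ n := by
      have := hxy.resolve_right hyo
      rw [Nat.even_mul] at this
      exact (this.resolve_left (Nat.not_even_iff_odd.2 (hm.1.mul hm.2))).two_dvd
    have h := (ep_two_mul_prime_part hq hq₂ hy).blowup' (n := a * k) (a := a)
      (Nat.mul_pos hm.2.pos (by rw [Nat.pos_iff_ne_zero]; rintro rfl; simp at hx)) hq.two_le (dvd_mul_right a k) hm.2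
    convert h using 1
    ring

theorem ep_even {m x y : ℕ} (hm : Even m) (hx : Even x) (hx₀ : 0 < x) (hm₀ : 0 < m) (hy : 2 ≤ y)
    (hdvd : m ∣ x * y) : EP False m y x := by
  obtain ⟨z, rfl⟩ := hx.two_dvd
  have hz : 0 < z := by omega
  obtain ⟨t, rfl⟩ := hm.two_dvd
  have hA {w s q : ℕ} (hq : 2 ≤ q) (hw : 0 < w) (hs : s ∣ w) : EP False (2 * s) q (2 * w) :=
    (ep_two_two hq).blowup hw le_rfl (Or.inl even_two) hs
  have ht : t ∣ z * y := by
    rw [mul_assoc] at hdvd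
    exact Nat.dvd_of_mul_dvd_mul_left two_pos hdvd
  obtain ⟨a, b, ha, hb, rfl⟩ := exists_dvd_and_dvd_of_dvd_mul ht
  obtain ⟨k, rfl⟩ := hb
  have hb₀ : b ≠ 0 := by
    rintro rfl
    simp at hm₀
  have hk₀ : k ≠ 0 := by
    rintro rfl
    simp at hy
  obtain rfl | hb₁ := eq_or_ne b 1
  · simpa using hA hy hz ((mul_one a).symm ▸ ha)
  have h₁ := (ep_two_mul (n := b) (by omega)).blowup hz (by omega) (Or.inl (even_two_mul b)) ha
  rw [show 2 * b * a = 2 * (a * b) by ring] at h₁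
  obtain rfl | hk₁ := eq_or_ne k 1
  · simpa using h₁
  rw [mul_comm b k]
  refine h₁.trans ?_
  have := hA (q := k) (by omega) (Nat.mul_pos (Nat.pos_of_ne_zero hb₀) hz)
    (show a * b ∣ b * z from mul_comm a b ▸ Nat.mul_dvd_mul_left b ha)
  convert this using 1
  ring

theorem ep_odd {m x y : ℕ} (hm : Odd m) (hm₃ : 3 ≤ m) (hx₀ : 0 < x) (hy : 3 ≤ y)
    (hxy : Even x ∨ Odd y) (hdvd : m ∣ x * y) : EP True m y x := by
  obtain ⟨a, b, ha, hb, rfl⟩ := exists_dvd_and_dvd_of_dvd_mul hdvd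
  obtain ⟨k, rfl⟩ := hb
  have hm' := Nat.odd_mul.1 hm
  obtain rfl | hb₁ := eq_or_ne b 1
  · exact ep_of_odd_of_dvd hm hm₃ (by simpa using ha) hx₀ hy hxy
  have hb₃ : 3 ≤ b := by
    obtain ⟨c, rfl⟩ := hm'.2
    omega
  have hk₀ : k ≠ 0 := by
    rintro rfl
    simp at hy
  have h₁ := (ep_hamiltonian hb₃ hm'.2).blowup' hx₀ (by omega) ha hm'.1
  rw [one_mul, mul_comm b a] at h₁
  rcases (by omega : k = 1 ∨ k = 2 ∨ 3 ≤ k) with rfl | rfl | hk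
  · simpa using h₁
  · obtain ⟨z, rfl⟩ := (hxy.resolve_right (by simp)).two_dvd
    have h₂ : EP True b (2 * b) 2 := by
      obtain rfl | hb₅ := eq_or_ne b 3
      · exact ep_six_two
      · obtain ⟨c, rfl⟩ := hm'.2
        exact ep_two_two_mul (by omega) hm'.2
    have := h₂.blowup' (n := z) (by omega) (by omega)
      (hm'.1.coprime_two_right.dvd_of_dvd_mul_left ha) hm'.1
    rwa [mul_comm b a, mul_comm 2 b] at this
  · rw [mul_comm b k]
    refine h₁.trans (ep_of_odd_of_dvd hm hm₃ ?_ (Nat.mul_pos (by omega) hx₀) hk ?_)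
    · exact mul_comm a b ▸ Nat.mul_dvd_mul_left b ha
    · exact hxy.imp (fun h => h.mul_left b) fun h => (Nat.odd_mul.1 h).2

theorem EP.isFactorization {c : Prop} {m y x : ℕ} (h : EP c m y x) (hx : 0 < x) (hy : 0 < y) :
    ∃ k : ℕ, IsFactorization
      {p : (Fin y × Fin x) × (Fin y × Fin x) | p.1.1 ≠ p.2.1} (fun _ : Fin k => m) := by
  obtain ⟨ι, ⟨D⟩⟩ := h
  have : Finite ι := (D.card_eq (⟨0, hy⟩, ⟨0, hx⟩)).1
  let e := Finite.equivFin (ι × Bool)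
  refine ⟨_, fun i => D.f (e.symm i).1 (e.symm i).2, fun i v => D.period _ _ v id,
    fun i j v h => ?_, fun p => ?_⟩
  · have := D.inj _ _ _ _ v id id h
    exact e.symm.injective (Prod.ext this.1 this.2)
  · rw [← e.exists_congr_right]
    simpa using D.arc p.1 p.2

/-- Let `m ≥ 3` and `x ≥ 2`.  If `m ∣ x * y`, `x * (y - 1)` is even, and `m` is even
whenever `y = 2`, then the complete symmetric equipartite digraph `K_{(x:y)}*`, with
`y` parts of size `x` (vertex set `Fin y × Fin x`, a vertex `(i, a)` lying in part `i`)
and all ordered pairs of vertices in distinct parts as arcs, has a `C⃗_m`-factorization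
(a partition of its arc set into spanning factors all of whose components are directed
`m`-cycles). -/
theorem equipartite_directed_cycle_factorization (x y m : ℕ)
    (hm : 3 ≤ m) (hx : 2 ≤ x) (hdvd : m ∣ x * y) (heven : Even (x * (y - 1)))
    (hy2 : y = 2 → Even m) :
    ∃ k : ℕ, IsFactorization
      {p : (Fin y × Fin x) × (Fin y × Fin x) | p.1.1 ≠ p.2.1}
      (fun _ : Fin k => m) := by
  rcases (by omega : y = 0 ∨ y = 1 ∨ 2 ≤ y) with rfl | rfl | hy
  · exact ⟨0, nofun, nofun, nofun, fun p => p.1.1.elim0⟩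
  · exact (EP.one (c := True)).isFactorization (by omega) one_pos
  have hxy : Even x ∨ Odd y := by
    refine (Nat.even_mul.1 heven).imp id fun h => ?_
    obtain ⟨k, hk⟩ := h
    exact ⟨k, by omega⟩
  rcases m.even_or_odd with hm₂ | hm₂
  · refine (ep_even hm₂ (hxy.elim id fun hyo => ?_) (by omega) (by omega) hy
      hdvd).isFactorization (by omega) (by omega)
    have := hm₂.two_dvd.trans hdvd
    rw [← even_iff_two_dvd, Nat.even_mul] at this
    exact this.resolve_right (Nat.not_even_iff_odd.2 hyo)
  · have : y ≠ 2 := fun h => Nat.not_even_iff_odd.2 hm₂ (hy2 h)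
    exact (ep_odd hm₂ hm (by omega) (by omega) hxy hdvd).isFactorization (by omega) (by omega)
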